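/- Let F ∈ ℤ[t] be an irreducible polynomial of degree g ≥ 2. There exist constants c₁ ∈ ℝ and c₂, K > 0, depending only on F, such that for all x ≥ 3: |∑_{p ≤ x, p prime} ρ(p)/p − log log x − c₁| ≤ K · e^{−c₂ √(log x)}. -/

import Mathlib

open Real MeasureTheory
open scoped Classical

/-- number of residues n mod d with F(n) ≡ 0 (mod d) -/
noncomputable def polyRho (F : Polynomial ℤ) (d : ℕ) : ℕ :=
  ((Finset.range d).filter (fun n => (d : ℤ) ∣ F.eval (n : ℤ))).card

/-- H_F(x,y,z): number of positive n ≤ x with F(n) having a divisor in (y,z] -/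
noncomputable def polyH (F : Polynomial ℤ) (x y z : ℝ) : ℕ :=
  {n : ℕ | 0 < n ∧ (n : ℝ) ≤ x ∧
    ∃ d : ℕ, 0 < d ∧ (d : ℤ) ∣ F.eval (n : ℤ) ∧ y < (d : ℝ) ∧ (d : ℝ) ≤ z}.ncard

/-- H(x,y,z): number of positive n ≤ x having a divisor in (y,z] -/
noncomputable def Hdiv (x y z : ℝ) : ℕ :=
  {n : ℕ | 0 < n ∧ (n : ℝ) ≤ x ∧
    ∃ d : ℕ, 0 < d ∧ d ∣ n ∧ y < (d : ℝ) ∧ (d : ℝ) ≤ z}.ncard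

/-- L(a;σ) -/
noncomputable def Lfun (a : ℕ) (σ : ℝ) : ℝ :=
  (volume {x : ℝ | ∃ d : ℕ, d ∣ a ∧ Real.exp x < (d : ℝ) ∧ (d : ℝ) ≤ Real.exp (x + σ)}).toReal

/-- W(a;σ): ordered pairs of divisors near each other -/
noncomputable def Wfun (a : ℕ) (σ : ℝ) : ℕ :=
  {p : ℕ × ℕ | p.1 ∣ a ∧ p.2 ∣ a ∧ |Real.log ((p.1 : ℝ) / (p.2 : ℝ))| ≤ σ}.ncard

/-- 𝒫(s,t): squarefree integers with all prime factors in (s,t] -/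
def Psf (s t : ℝ) : Set ℕ :=
  {a : ℕ | 0 < a ∧ Squarefree a ∧ ∀ p : ℕ, p.Prime → p ∣ a → s < (p : ℝ) ∧ (p : ℝ) ≤ t}

/-- φ_F(n) = n ∏_{p|n} (1 - ρ(p)/p) -/
noncomputable def polyPhi (F : Polynomial ℤ) (n : ℕ) : ℝ :=
  (n : ℝ) * ∏ p ∈ n.primeFactors, (1 - (polyRho F p : ℝ) / p)

/-- P⁺(n): largest prime factor, P⁺(1)=0 -/
def Pplus (n : ℕ) : ℕ := n.primeFactors.sup id

/-- h(n;X): least prime q with ∏_{p^ν ∥ n, p ≤ q} p^ν > √X -/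
noncomputable def hfun (n : ℕ) (X : ℝ) : ℕ :=
  sInf {q : ℕ | q.Prime ∧
    Real.sqrt X < ∏ p ∈ n.primeFactors.filter (fun p => p ≤ q), (p : ℝ) ^ (n.factorization p)}

open Complex in
lemma norm_logDeriv_le_of_norm_le_exp_mul {f : ℂ → ℂ} {c : ℂ} {R M : ℝ} (hR : 0 < R) (hM : 0 < M)
    (hf : DifferentiableOn ℂ f (Metric.ball c R)) (hf0 : ∀ z ∈ Metric.ball c R, f z ≠ 0)
    (hb : ∀ z ∈ Metric.ball c R, ‖f z‖ ≤ Real.exp M * ‖f c‖) {z : ℂ}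
    (hz : ‖z - c‖ ≤ R / 2) : ‖deriv f z / f z‖ ≤ 24 * M / R := by
  have hcR : c ∈ Metric.ball c R := Metric.mem_ball_self hR
  have hfd : DifferentiableOn ℂ (deriv f) (Metric.ball c R) := hf.deriv Metric.isOpen_ball
  obtain ⟨g, hg⟩ := (hfd.div hf hf0).isExactOn_ball
  -- `g - g c` is a logarithm of `f / f c`
  have hexp : ∀ w ∈ Metric.ball c R, f w = f c * Complex.exp (g w - g c) := by
    have hconst : ∀ w ∈ Metric.ball c R,
        f w * Complex.exp (-(g w)) = f c * Complex.exp (-(g c)) := by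
      intro w hw
      have hder : ∀ u ∈ Metric.ball c R,
          HasDerivAt (fun u => f u * Complex.exp (-(g u))) 0 u := by
        intro u hu
        have h1 : HasDerivAt f (deriv f u) u :=
          (hf.differentiableAt (Metric.isOpen_ball.mem_nhds hu)).hasDerivAt
        have h2 := h1.mul ((hg u hu).neg.cexp)
        refine h2.congr_deriv ?_
        have := hf0 u hu
        simp only [Pi.neg_apply, Pi.div_apply]
        field_simp
        ring
      exact (convex_ball c R).is_const_of_fderivWithin_eq_zero (𝕜 := ℂ)
        (fun u hu => (hder u hu).differentiableAt.differentiableWithinAt)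
        (fun u hu => by
          rw [fderivWithin_of_isOpen Metric.isOpen_ball hu]
          have := (hder u hu).hasFDerivAt.fderiv
          rw [this]; ext; simp) hw hcR
    intro w hw
    have h3 := hconst w hw
    rw [Complex.exp_sub]
    have := Complex.exp_ne_zero (g w)
    have := Complex.exp_ne_zero (g c)
    rw [Complex.exp_neg, Complex.exp_neg] at h3
    field_simp at h3 ⊢
    linear_combination h3
  have hfc : 0 < ‖f c‖ := norm_pos_iff.2 (hf0 c hcR)
  have hre : ∀ w ∈ Metric.ball c R, (g w - g c).re ≤ M := by
    intro w hw
    have h1 := hb w hw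
    rw [hexp w hw, norm_mul, Complex.norm_exp, mul_comm] at h1
    exact Real.exp_le_exp.1 (le_of_mul_le_mul_right h1 hfc)
  have hBC : ∀ w ∈ Metric.ball (0 : ℂ) R, ‖g (c + w) - g c‖ ≤ 2 * M * ‖w‖ / (R - ‖w‖) := by
    intro w hw
    have hmem : ∀ u ∈ Metric.ball (0 : ℂ) R, c + u ∈ Metric.ball c R := by
      intro u hu; simpa using hu
    refine Complex.borelCaratheodory_zero (f := fun w => g (c + w) - g c) hM ?_ ?_ hR hw (by simp)
    · intro u hu
      have := (hg (c + u) (hmem u hu)).differentiableAt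
      have h2 : DifferentiableAt ℂ (fun w => g (c + w)) u :=
        DifferentiableAt.comp (g := g) (f := fun w => c + w) u this (by fun_prop)
      exact (h2.sub_const _).differentiableWithinAt
    · intro u hu
      exact hre _ (hmem u hu)
  have hzb : ∀ w ∈ Metric.closedBall z (R / 4), ‖w - c‖ ≤ 3 * R / 4 := by
    intro w hw
    rw [mem_closedBall_iff_norm] at hw
    calc ‖w - c‖ = ‖(w - z) + (z - c)‖ := by ring_nf
      _ ≤ ‖w - z‖ + ‖z - c‖ := norm_add_le _ _
      _ ≤ _ := by linarith
  have hzb' : ∀ w ∈ Metric.closedBall z (R / 4), w ∈ Metric.ball c R := by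
    intro w hw
    rw [mem_ball_iff_norm]
    linarith [hzb w hw]
  have hzmem : z ∈ Metric.ball c R := hzb' z (by simp; positivity)
  have hC : ‖deriv (fun w => g w - g c) z‖ ≤ 6 * M / (R / 4) := by
    refine Complex.norm_deriv_le_of_forall_mem_sphere_norm_le (by positivity) ?_ ?_
    · refine DifferentiableOn.diffContOnCl ?_
      rw [closure_ball z (by positivity)]
      intro w hw
      exact ((hg w (hzb' w hw)).differentiableAt.sub_const _).differentiableWithinAt
    · intro w hw
      have hw' := Metric.sphere_subset_closedBall hw
      have h1 := hBC (w - c) (by simpa [dist_eq_norm] using hzb' w hw')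
      rw [add_sub_cancel] at h1
      refine h1.trans ?_
      have h2 := hzb w hw'
      rw [div_le_iff₀ (by linarith)]
      nlinarith
  have hd : deriv (fun w => g w - g c) z = deriv f z / f z := by
    have := ((hg z hzmem).sub_const (g c)).deriv
    simpa using this
  rw [hd] at hC
  refine hC.trans (le_of_eq ?_)
  field_simp
  norm_num

lemma exists_dvd_blaschke {f : ℂ → ℂ} {B : ℝ} {w : ℂ} (hf : DiffContOnCl ℂ f (Metric.ball 0 1))
    (hf0 : f 0 ≠ 0) (hb : ∀ z ∈ Metric.closedBall (0 : ℂ) 1, ‖f z‖ ≤ B * ‖f 0‖)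
    (hw : ‖w‖ < 1) (hfw : f w = 0) :
    ∃ h : ℂ → ℂ, DiffContOnCl ℂ h (Metric.ball 0 1) ∧ h 0 ≠ 0 ∧
      (∀ z ∈ Metric.closedBall (0 : ℂ) 1, ‖h z‖ ≤ (B * ‖w‖) * ‖h 0‖) ∧
      (∀ z ∈ Metric.ball (0 : ℂ) 1, h z = 0 → z = w ∨ f z = 0) ∧
      deriv f 0 / f 0 = deriv h 0 / h 0 - (1 / w - (starRingEnd ℂ) w) := by
  have hw0 : w ≠ 0 := by rintro rfl; exact hf0 hfw
  have hwb : w ∈ Metric.ball (0 : ℂ) 1 := by simpa using hw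
  have hcl : closure (Metric.ball (0 : ℂ) 1) = Metric.closedBall 0 1 := closure_ball _ one_ne_zero
  set g : ℂ → ℂ := dslope f w with hg
  have hgd : DifferentiableOn ℂ g (Metric.ball 0 1) :=
    (Complex.differentiableOn_dslope (Metric.isOpen_ball.mem_nhds hwb)).2 hf.differentiableOn
  have hgc : ContinuousOn g (Metric.closedBall 0 1) := by
    refine (continuousOn_dslope ?_).2 ⟨hcl ▸ hf.continuousOn, ?_⟩
    · exact Filter.mem_of_superset (Metric.isOpen_ball.mem_nhds hwb) Metric.ball_subset_closedBall
    · exact hf.differentiableAt Metric.isOpen_ball hwb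
  have hfg : ∀ z, f z = (z - w) * g z := by
    intro z
    have := sub_smul_dslope f w z
    rw [smul_eq_mul, hfw, sub_zero] at this
    exact this.symm
  set q : ℂ → ℂ := fun z => 1 - (starRingEnd ℂ) w * z with hq
  have hqne : ∀ z ∈ Metric.closedBall (0 : ℂ) 1, q z ≠ 0 := by
    intro z hz h0
    have h1 : (starRingEnd ℂ) w * z = 1 := (sub_eq_zero.1 h0).symm
    have h2 : ‖w‖ * ‖z‖ = 1 := by
      rw [← Complex.norm_conj w, ← norm_mul, h1, norm_one]
    have h3 : ‖z‖ ≤ 1 := by simpa using hz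
    nlinarith [norm_nonneg w]
  have hqd : Differentiable ℂ q := by
    simp only [hq]; fun_prop
  have hq0 : q 0 = 1 := by simp [hq]
  have hdiff : DiffContOnCl ℂ (fun z => g z * q z) (Metric.ball 0 1) := by
    refine ⟨hgd.mul hqd.differentiableOn, ?_⟩
    rw [hcl]
    exact hgc.mul hqd.continuous.continuousOn
  have h00 : f 0 = -w * g 0 := by rw [hfg 0]; ring
  have hg0 : g 0 ≠ 0 := by rintro h; rw [h, mul_zero] at h00; exact hf0 h00
  refine ⟨fun z => g z * q z, hdiff, by simpa [hq0] using hg0, ?_, ?_, ?_⟩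
  · intro z hz
    have key : ∀ u ∈ frontier (Metric.ball (0 : ℂ) 1), ‖g u * q u‖ ≤ B * ‖f 0‖ := by
      intro u hu
      rw [frontier_ball _ one_ne_zero] at hu
      have hu1 : ‖u‖ = 1 := by simpa using hu
      have hqu : ‖q u‖ = ‖u - w‖ := by
        have e1 : q u = u * (starRingEnd ℂ) (u - w) := by
          have : u * (starRingEnd ℂ) u = 1 := by
            rw [Complex.mul_conj, Complex.normSq_eq_norm_sq, hu1]; simp
          simp only [hq, map_sub]
          linear_combination -this
        rw [e1, norm_mul, hu1, one_mul, Complex.norm_conj]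
      rw [norm_mul, hqu, mul_comm, ← norm_mul, ← hfg]
      exact hb u (Metric.sphere_subset_closedBall hu)
    have h1 := Complex.norm_le_of_forall_mem_frontier_norm_le Metric.isBounded_ball hdiff key
      (hcl.symm ▸ hz)
    refine h1.trans (le_of_eq ?_)
    simp only [hq0, mul_one]
    rw [h00, norm_mul, norm_neg]
    ring
  · intro z hz h0
    rcases mul_eq_zero.1 h0 with h | h
    · right; rw [hfg, h, mul_zero]
    · exact absurd h (hqne z (Metric.ball_subset_closedBall hz))
  · have h0b : (0 : ℂ) ∈ Metric.ball (0 : ℂ) 1 := by simp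
    have hg' : HasDerivAt g (deriv g 0) 0 :=
      (hgd.differentiableAt (Metric.isOpen_ball.mem_nhds h0b)).hasDerivAt
    have hq' : HasDerivAt q (-(starRingEnd ℂ) w) 0 := by
      have := ((hasDerivAt_id (0 : ℂ)).const_mul ((starRingEnd ℂ) w)).const_sub 1
      simpa [hq] using this
    have e1 : deriv f 0 = g 0 + -w * deriv g 0 := by
      have h1 : HasDerivAt (fun z => (z - w) * g z) (1 * g 0 + (0 - w) * deriv g 0) 0 :=
        ((hasDerivAt_id (0 : ℂ)).sub_const w).mul hg'
      have h2 : f = fun z => (z - w) * g z := funext hfg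
      conv_lhs => rw [h2]
      rw [h1.deriv]; ring
    have e2 : deriv (fun z => g z * q z) 0 = deriv g 0 - g 0 * (starRingEnd ℂ) w := by
      have h1 : HasDerivAt (fun z => g z * q z) _ 0 := hg'.mul hq'
      rw [h1.deriv, hq0]; ring
    rw [e1, e2, h00]
    simp only [hq0]
    field_simp
    ring

lemma neg_re_logDeriv_le_nat (N : ℕ) : ∀ (f : ℂ → ℂ) (M : ℝ), 0 < M → M ≤ N * Real.log 2 →
    DiffContOnCl ℂ f (Metric.ball 0 1) → f 0 ≠ 0 →
    (∀ z ∈ Metric.closedBall (0 : ℂ) 1, ‖f z‖ ≤ Real.exp M * ‖f 0‖) →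
    (∀ z ∈ Metric.ball (0 : ℂ) 1, f z = 0 → z.re ≤ 0) →
    -(deriv f 0 / f 0).re ≤ 48 * M := by
  induction N with
  | zero =>
    intro f M hM hMN
    simp at hMN
    linarith
  | succ N ih =>
    intro f M hM hMN hf hf0 hb hz
    by_cases hex : ∃ w ∈ Metric.ball (0 : ℂ) (1 / 2), f w = 0
    · obtain ⟨w, hw, hfw⟩ := hex
      have hw' : ‖w‖ < 1 / 2 := by simpa using hw
      have hw0 : w ≠ 0 := by rintro rfl; exact hf0 hfw
      have hwre : w.re ≤ 0 := hz w (Metric.ball_subset_ball (by norm_num) hw) hfw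
      obtain ⟨h, hd, h0, hhb, hhz, hh⟩ := exists_dvd_blaschke hf hf0 hb (by linarith) hfw
      have hhb' : ∀ z ∈ Metric.closedBall (0 : ℂ) 1,
          ‖h z‖ ≤ Real.exp (M - Real.log 2) * ‖h 0‖ := by
        intro z hz
        refine (hhb z hz).trans ?_
        rw [Real.exp_sub, Real.exp_log (by norm_num)]
        have := Real.exp_pos M
        have := norm_nonneg (h 0)
        gcongr
        nlinarith
      have hM1 : 0 ≤ M - Real.log 2 := by
        have h1 := hhb' 0 (by simp)
        have h2 : 0 < ‖h 0‖ := norm_pos_iff.2 h0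
        have h3 : 1 ≤ Real.exp (M - Real.log 2) := by
          by_contra! h4
          nlinarith
        rwa [Real.one_le_exp_iff] at h3
      have hhz' : ∀ z ∈ Metric.ball (0 : ℂ) 1, h z = 0 → z.re ≤ 0 := by
        intro z hzb hz0
        rcases hhz z hzb hz0 with h1 | h1
        · rw [h1]; exact hwre
        · exact hz z hzb h1
      have hre : (1 / w - (starRingEnd ℂ) w).re ≤ 0 := by
        have h1 : (1 / w).re = w.re / Complex.normSq w := by simp
        have hn : Complex.normSq w = ‖w‖ ^ 2 := Complex.normSq_eq_norm_sq w
        have hpos : 0 < Complex.normSq w := Complex.normSq_pos.2 hw0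
        have hlt : Complex.normSq w ≤ 1 := by rw [hn]; nlinarith [norm_nonneg w]
        rw [Complex.sub_re, h1, Complex.conj_re, sub_nonpos, div_le_iff₀ hpos]
        nlinarith
      have hstep : -(deriv f 0 / f 0).re ≤ -(deriv h 0 / h 0).re := by
        rw [hh, Complex.sub_re]; linarith
      refine hstep.trans ?_
      rcases hM1.eq_or_lt with hM0 | hM1
      · have h2 : IsMaxOn (norm ∘ h) (Metric.ball (0 : ℂ) 1) 0 := by
          intro z hz
          have := hhb' z (Metric.ball_subset_closedBall hz)
          rw [← hM0] at this
          simpa using this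
        have h3 : Set.EqOn h (Function.const ℂ (h 0)) (Metric.ball (0 : ℂ) 1) :=
          Complex.eqOn_of_isPreconnected_of_isMaxOn_norm
            (convex_ball (0 : ℂ) 1).isPreconnected Metric.isOpen_ball hd.differentiableOn
            (by simp) h2
        have h4 : deriv h 0 = 0 := by
          have : h =ᶠ[nhds 0] Function.const ℂ (h 0) :=
            h3.eventuallyEq_of_mem (Metric.isOpen_ball.mem_nhds (by simp))
          rw [this.deriv_eq]; exact deriv_const _ _
        rw [h4]; simp; positivity
      · have := ih h (M - Real.log 2) hM1 (by push_cast at hMN; linarith) hd h0 hhb' hhz'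
        have hl2 := Real.log_pos (show (1 : ℝ) < 2 by norm_num)
        linarith
    · push Not at hex
      have h1 := norm_logDeriv_le_of_norm_le_exp_mul (f := f) (c := 0) (R := 1 / 2) (z := 0)
        (by norm_num) hM
        (hf.differentiableOn.mono (Metric.ball_subset_ball (by norm_num))) hex
        (fun z hz => hb z (Metric.ball_subset_closedBall
          (Metric.ball_subset_ball (by norm_num) hz))) (by norm_num)
      have h2 := Complex.abs_re_le_norm (deriv f 0 / f 0)
      have h3 := neg_abs_le (deriv f 0 / f 0).re
      have h4 : 24 * M / (1 / 2) = 48 * M := by ring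
      linarith

lemma neg_re_logDeriv_le {f : ℂ → ℂ} {M : ℝ} (hM : 0 < M)
    (hf : DiffContOnCl ℂ f (Metric.ball 0 1)) (hf0 : f 0 ≠ 0)
    (hb : ∀ z ∈ Metric.closedBall (0 : ℂ) 1, ‖f z‖ ≤ Real.exp M * ‖f 0‖)
    (hz : ∀ z ∈ Metric.ball (0 : ℂ) 1, f z = 0 → z.re ≤ 0) :
    -(deriv f 0 / f 0).re ≤ 48 * M := by
  have hl2 := Real.log_pos (show (1 : ℝ) < 2 by norm_num)
  obtain ⟨N, hN⟩ := exists_nat_ge (M / Real.log 2)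
  exact neg_re_logDeriv_le_nat N f M hM ((div_le_iff₀ hl2).1 hN) hf hf0 hb hz

lemma neg_re_logDeriv_le_of_zero {f : ℂ → ℂ} {M x : ℝ} (hM : 0 < M)
    (hf : DiffContOnCl ℂ f (Metric.ball 0 1)) (hf0 : f 0 ≠ 0)
    (hb : ∀ z ∈ Metric.closedBall (0 : ℂ) 1, ‖f z‖ ≤ Real.exp M * ‖f 0‖)
    (hz : ∀ z ∈ Metric.ball (0 : ℂ) 1, f z = 0 → z.re ≤ 0)
    (hx0 : 0 < x) (hx1 : x < 1) (hfx : f (-x : ℝ) = 0) :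
    -(deriv f 0 / f 0).re ≤ 48 * M - (1 / x - x) := by
  have hn : ‖((-x : ℝ) : ℂ)‖ = x := by
    rw [Complex.norm_real, norm_neg, Real.norm_of_nonneg hx0.le]
  obtain ⟨h, hd, h0, hhb, hhz, hh⟩ := exists_dvd_blaschke hf hf0 hb (by rw [hn]; exact hx1) hfx
  have h1 := neg_re_logDeriv_le (f := h) hM hd h0 (fun z hz => (hhb z hz).trans (by
      rw [hn]
      have := Real.exp_pos M
      have := norm_nonneg (h 0)
      gcongr
      nlinarith)) (fun z hzb hz0 => by
      rcases hhz z hzb hz0 with h2 | h2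
      · rw [h2, Complex.ofReal_re]; linarith
      · exact hz z hzb h2)
  have h2 : (1 / ((-x : ℝ) : ℂ) - (starRingEnd ℂ) ((-x : ℝ) : ℂ)) = ((x - 1 / x : ℝ) : ℂ) := by
    rw [Complex.conj_ofReal]; push_cast; field_simp; ring
  rw [hh, h2, Complex.sub_re, Complex.ofReal_re]
  linarith

lemma one_le_log_abs_add_three (t : ℝ) : 1 ≤ Real.log (|t| + 3) := by
  rw [Real.le_log_iff_exp_le (by positivity)]
  have := Real.exp_one_lt_d9
  have := abs_nonneg t
  linarith

lemma growth_exponent_bound {C A c a t τ : ℝ} (hC : 0 < C) (hA : 0 ≤ A) (hc : 0 < c) (ha : 0 < a)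
    (ha1 : a ≤ 1) (hτ : |τ| ≤ 2 * |t|) :
    C * (|τ| + 4) ^ A ≤ Real.exp ((2 * A + 6 + |Real.log (C / c)|) *
      (Real.log (|t| + 3) / Real.sqrt a)) * (c * (a / Real.log (|t| + 3)) ^ 2) := by
  set y := |t| + 3 with hy
  set L := Real.log y with hL
  have hL1 : 1 ≤ L := one_le_log_abs_add_three t
  have ht := abs_nonneg t
  have hτ0 := abs_nonneg τ
  have hy0 : 0 < y := by positivity
  set q := 1 / Real.sqrt a with hq
  have hsq : 0 < Real.sqrt a := Real.sqrt_pos.2 ha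
  have hq1 : 1 ≤ q := by
    rw [hq, one_le_div hsq]; exact Real.sqrt_le_one.2 ha1
  have haq : 1 / a = q ^ 2 := by rw [hq, div_pow, Real.sq_sqrt ha.le]; simp
  have h1 : (|τ| + 4) ^ A ≤ Real.exp (2 * A * L) := by
    have e : Real.exp (2 * A * L) = (y ^ 2) ^ A := by
      rw [Real.rpow_def_of_pos (by positivity), Real.log_pow]
      congr 1; push_cast; ring
    rw [e]
    refine Real.rpow_le_rpow (by positivity) ?_ hA
    nlinarith
  have h2 : C ≤ Real.exp |Real.log (C / c)| * c := by
    have := Real.exp_le_exp.2 (le_abs_self (Real.log (C / c)))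
    rw [Real.exp_log (by positivity), div_le_iff₀ hc] at this
    exact this
  have h3 : 1 ≤ Real.exp (2 * L + 4 * q) * (a / L) ^ 2 := by
    have e1 : L ≤ Real.exp L := by linarith [Real.add_one_le_exp L]
    have e2 : q ≤ Real.exp q := by linarith [Real.add_one_le_exp q]
    have e3 : Real.exp (2 * L + 4 * q) = (Real.exp L) ^ 2 * (Real.exp q) ^ 4 := by
      rw [← Real.exp_nat_mul, ← Real.exp_nat_mul, ← Real.exp_add]; push_cast; ring_nf
    have e4 : L ^ 2 * q ^ 4 ≤ Real.exp (2 * L + 4 * q) := by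
      rw [e3]; gcongr
    have e5 : (a / L) ^ 2 = 1 / (L ^ 2 * q ^ 4) := by
      have : q ^ 4 = (1 / a) ^ 2 := by rw [haq]; ring
      rw [this]; field_simp
    rw [e5, mul_one_div, one_le_div (by positivity)]
    exact e4
  have h4 : 2 * A * L + |Real.log (C / c)| + (2 * L + 4 * q) ≤
      (2 * A + 6 + |Real.log (C / c)|) * (L / Real.sqrt a) := by
    have e : L / Real.sqrt a = L * q := by rw [hq]; ring
    rw [e]
    have hD := abs_nonneg (Real.log (C / c))
    have e1 : L ≤ L * q := by nlinarith
    have e2 : q ≤ L * q := by nlinarith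
    have e3 : 1 ≤ L * q := by nlinarith
    nlinarith [mul_le_mul_of_nonneg_left e1 hA, mul_le_mul_of_nonneg_left e3 hD]
  calc C * (|τ| + 4) ^ A ≤ (Real.exp |Real.log (C / c)| * c) * Real.exp (2 * A * L) * 1 := by
        rw [mul_one]; gcongr
    _ ≤ (Real.exp |Real.log (C / c)| * c) * Real.exp (2 * A * L) *
          (Real.exp (2 * L + 4 * q) * (a / L) ^ 2) := by gcongr
    _ = Real.exp (2 * A * L + |Real.log (C / c)| + (2 * L + 4 * q)) * (c * (a / L) ^ 2) := by
        rw [Real.exp_add (2 * A * L + _), Real.exp_add (2 * A * L), Real.exp_add (2 * L)]; ring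
    _ ≤ _ := by gcongr

/-- Analytic input for the classical zero-free region: `G s = (s - 1) Z s`, `H = -Z' / Z`. -/
structure ZeroFreeData (G H : ℂ → ℂ) (r C A c : ℝ) : Prop where
  r_pos : 0 < r
  r_le : r ≤ 1
  C_pos : 0 < C
  A_nonneg : 0 ≤ A
  c_pos : 0 < c
  diff : DifferentiableOn ℂ G {s | 1 - 2 * r < s.re}
  growth : ∀ s : ℂ, 1 - r ≤ s.re → s.re ≤ 3 → ‖G s‖ ≤ C * (|s.im| + 3) ^ A
  lower : ∀ s : ℂ, 1 < s.re → s.re ≤ 3 → c * (s.re - 1) ^ 2 ≤ ‖G s‖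
  logDeriv : ∀ s : ℂ, 1 < s.re → deriv G s / G s = 1 / (s - 1) - H s
  three_four_one : ∀ σ t : ℝ, 1 < σ →
    0 ≤ 3 * (H σ).re + 4 * (H (σ + t * Complex.I)).re + (H (σ + (2 * t : ℝ) * Complex.I)).re
  one_ne : G 1 ≠ 0

namespace ZeroFreeData

variable {G H : ℂ → ℂ} {r C A c : ℝ}

lemma isOpen_halfPlane (r : ℝ) : IsOpen {s : ℂ | 1 - 2 * r < s.re} :=
  isOpen_lt continuous_const Complex.continuous_re

lemma ne_zero_of_one_lt (h : ZeroFreeData G H r C A c) {s : ℂ} (hs : 1 < s.re) (hs3 : s.re ≤ 3) :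
    G s ≠ 0 := by
  intro h0
  have := h.lower s hs hs3
  rw [h0, norm_zero] at this
  have h1 := h.c_pos
  have : 0 < c * (s.re - 1) ^ 2 := by
    have : 0 < s.re - 1 := by linarith
    positivity
  linarith

lemma norm_le_near (h : ZeroFreeData G H r C A c) {s w : ℂ} {ε : ℝ} (hs : s.re ≤ 2)
    (hw : ‖w‖ ≤ 1) (hre : 1 - r ≤ (s + w).re) (hε : |s.im| ≤ ε) :
    ‖G (s + w)‖ ≤ C * (ε + 4) ^ A := by
  have h1 := Complex.abs_re_le_norm w
  have h2 := Complex.abs_im_le_norm w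
  refine (h.growth _ hre ?_).trans ?_
  · rw [Complex.add_re]; linarith [le_abs_self w.re]
  · have := h.C_pos
    have := abs_nonneg (s + w).im
    have h3 := h.A_nonneg
    gcongr C * ?_
    refine Real.rpow_le_rpow (by positivity) ?_ h3
    rw [Complex.add_im]
    linarith [abs_add_le s.im w.im]

lemma rescale (h : ZeroFreeData G H r C A c) {a t τ : ℝ} (ha : 0 < a) (ha1 : a ≤ 1)
    (hτ : |τ| ≤ 2 * |t|) :
    let s : ℂ := (1 + a / Real.log (|t| + 3) : ℝ) + τ * Complex.I
    let f : ℂ → ℂ := fun z => G (s + r * z)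
    let M := (2 * A + 6 + |Real.log (C / c)|) * (Real.log (|t| + 3) / Real.sqrt a)
    0 < M ∧ DiffContOnCl ℂ f (Metric.ball 0 1) ∧ f 0 ≠ 0 ∧
    (∀ z ∈ Metric.closedBall (0 : ℂ) 1, ‖f z‖ ≤ Real.exp M * ‖f 0‖) ∧
    (∀ z ∈ Metric.ball (0 : ℂ) 1, f z = 0 → z.re ≤ 0) ∧
    deriv f 0 / f 0 = r * (1 / (s - 1) - H s) := by
  intro s f M
  have hL := one_le_log_abs_add_three t
  set L := Real.log (|t| + 3) with hLdef
  have hr := h.r_pos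
  have hr1 := h.r_le
  have hA := h.A_nonneg
  have hsre : s.re = 1 + a / L := by simp [s, hLdef]
  have hsim : s.im = τ := by simp [s]
  have haL : 0 < a / L := by positivity
  have haL1 : a / L ≤ 1 := by
    rw [div_le_one (by positivity)]; linarith
  have hsq : 0 < Real.sqrt a := Real.sqrt_pos.2 ha
  have hnorm : ∀ z ∈ Metric.closedBall (0 : ℂ) 1, ‖(r : ℂ) * z‖ ≤ r := by
    intro z hz
    have hz1 : ‖z‖ ≤ 1 := by simpa using hz
    rw [norm_mul, Complex.norm_real, Real.norm_of_nonneg hr.le]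
    nlinarith
  have hre : ∀ z ∈ Metric.closedBall (0 : ℂ) 1, 1 - r ≤ (s + r * z).re := by
    intro z hz
    have h1 := hnorm z hz
    have h2 := neg_abs_le ((r : ℂ) * z).re
    have h3 := Complex.abs_re_le_norm ((r : ℂ) * z)
    rw [Complex.add_re, hsre]
    linarith
  have hf0 : f 0 = G s := by simp [f]
  have hne : f 0 ≠ 0 := by
    rw [hf0]
    exact h.ne_zero_of_one_lt (by rw [hsre]; linarith) (by rw [hsre]; linarith)
  have hdiffAt : ∀ u : ℂ, 1 - r ≤ u.re → DifferentiableAt ℂ G u := fun u hu =>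
    h.diff.differentiableAt ((isOpen_halfPlane r).mem_nhds (by
      simp only [Set.mem_ofPred_eq]; linarith))
  have hfd : ∀ z ∈ Metric.closedBall (0 : ℂ) 1, DifferentiableAt ℂ f z := by
    intro z hz
    exact DifferentiableAt.comp (g := G) (f := fun z => s + r * z) z (hdiffAt _ (hre z hz))
      (by fun_prop)
  refine ⟨?_, ?_, hne, ?_, ?_, ?_⟩
  · have := abs_nonneg (Real.log (C / c))
    positivity
  · refine DifferentiableOn.diffContOnCl ?_
    rw [closure_ball _ one_ne_zero]
    exact fun z hz => (hfd z hz).differentiableWithinAt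
  · intro z hz
    have h1 := h.norm_le_near (s := s) (w := r * z) (ε := |τ|) (by rw [hsre]; linarith)
      ((hnorm z hz).trans hr1) (hre z hz) (by rw [hsim])
    refine h1.trans ((growth_exponent_bound (t := t) h.C_pos hA h.c_pos ha ha1 hτ).trans ?_)
    have h2 := h.lower s (by rw [hsre]; linarith) (by rw [hsre]; linarith)
    rw [hsre, add_sub_cancel_left] at h2
    rw [hf0]
    gcongr
  · intro z hz hz0
    by_contra! hcon
    have hz' := Metric.ball_subset_closedBall hz
    have h1 := hnorm z hz'
    have h3 := Complex.abs_re_le_norm ((r : ℂ) * z)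
    refine h.ne_zero_of_one_lt (s := s + r * z) ?_ ?_ hz0
    · rw [Complex.add_re, hsre, Complex.re_ofReal_mul]; nlinarith
    · rw [Complex.add_re, hsre]; linarith [le_abs_self ((r : ℂ) * z).re]
  · have h1 : HasDerivAt f (deriv G s * r) 0 := by
      have h2 : HasDerivAt (fun z : ℂ => s + r * z) r 0 := by
        simpa using ((hasDerivAt_id (0 : ℂ)).const_mul (r : ℂ)).const_add s
      have h3 : HasDerivAt G (deriv G s) (s + r * 0) := by
        rw [mul_zero, add_zero]
        exact (hdiffAt s (by rw [hsre]; linarith)).hasDerivAt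
      exact HasDerivAt.comp 0 h3 h2
    rw [h1.deriv, hf0, ← h.logDeriv s (by rw [hsre]; linarith)]
    ring

lemma re_one_div_le {s : ℂ} {t₀ : ℝ} (ht₀ : 0 < t₀) (hs : t₀ ≤ |s.im|) :
    (1 / (s - 1)).re ≤ 1 / t₀ := by
  refine (Complex.re_le_norm _).trans ?_
  rw [norm_div, norm_one]
  have := Complex.abs_im_le_norm (s - 1)
  simp only [Complex.sub_im, Complex.one_im, sub_zero] at this
  exact one_div_le_one_div_of_le ht₀ (hs.trans this)

lemma zeroFree_arith {r t₀ L B q a b M : ℝ} (hr : 0 < r) (ht₀ : 0 < t₀) (hB : 0 ≤ B)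
    (hL : 1 ≤ L) (hq1 : 1 ≤ q)
    (hq : q = 2 * (384 * B / r + 5 / t₀ + 4 / r)) (ha : a = 1 / q ^ 2)
    (hb0 : 0 ≤ b) (hb9 : b ≤ a / 9) (hMq : M = B * L * q)
    (k1 : r * (4 / (r * ((a + b) / (L * r)))) ≤ r * (3 * (L / a) + 5 / t₀) + 8 * (48 * M) + 4) :
    False := by
  have hq0 : 0 < q := by linarith
  obtain ⟨E, hE⟩ : ∃ E, E = 384 * B / r + 5 / t₀ + 4 / r := ⟨_, rfl⟩
  rw [← hE] at hq
  have h4r : 0 < 4 / r := by positivity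
  have ha0 : 0 < a := by rw [ha]; positivity
  have haq : a * q ^ 2 = 1 := by rw [ha]; field_simp
  have k2 : 4 / (r * ((a + b) / (L * r))) = 4 * L / (a + b) := by field_simp
  rw [k2] at k1
  have k3 : 3.6 * L * q ^ 2 ≤ 4 * L / (a + b) := by
    rw [le_div_iff₀ (by positivity)]
    have e2 : (a + b) * q ^ 2 ≤ 10 / 9 := by
      have : b * q ^ 2 ≤ a / 9 * q ^ 2 := by gcongr
      linarith
    have : L * ((a + b) * q ^ 2) ≤ L * (10 / 9) := by gcongr
    linarith
  have k4 : L / a = L * q ^ 2 := by rw [ha]; field_simp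
  have k5 : r * (3.6 * L * q ^ 2) ≤ r * (3 * (L * q ^ 2)) + r * (E * L * q) := by
    refine (mul_le_mul_of_nonneg_left k3 hr.le).trans (k1.trans ?_)
    rw [k4, hMq]
    have e1 : r * (E * L * q) = 384 * (B * L * q) + r * (5 / t₀) * (L * q) + 4 * (L * q) := by
      rw [hE]; field_simp
    have e2 : 1 ≤ L * q := by
      nlinarith
    have e3 : 0 ≤ r * (5 / t₀) := by positivity
    have e4 : r * (5 / t₀) ≤ r * (5 / t₀) * (L * q) := le_mul_of_one_le_right e3 e2
    rw [e1]
    linarith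
  rw [← mul_add] at k5
  have k6 := le_of_mul_le_mul_left k5 hr
  have k7 : 0 < L * q := by positivity
  have k8 : E = q / 2 := by rw [hq]; ring
  rw [k8] at k6
  have k9 := mul_pos k7 hq0
  nlinarith

lemma ne_zero_of_le_abs_im (h : ZeroFreeData G H r C A c) {t₀ : ℝ} (ht₀ : 0 < t₀) :
    ∃ b, 0 < b ∧ ∀ s : ℂ, t₀ ≤ |s.im| → 1 - b / Real.log (|s.im| + 3) ≤ s.re → s.re ≤ 1 →
      G s ≠ 0 := by
  have hr := h.r_pos
  have hr1 := h.r_le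
  have hA := h.A_nonneg
  have hD := abs_nonneg (Real.log (C / c))
  set B := 2 * A + 6 + |Real.log (C / c)| with hB
  set E := 384 * B / r + 5 / t₀ + 4 / r with hE
  have hE4 : 4 / r ≤ E := by
    have : 0 ≤ 384 * B / r := by positivity
    have : 0 ≤ 5 / t₀ := by positivity
    linarith
  have h4r : 4 ≤ 4 / r := by rw [le_div_iff₀ hr]; linarith
  set q := 2 * E with hq
  have hq8 : 8 ≤ q := by linarith
  have hq0 : 0 < q := by linarith
  set a := 1 / q ^ 2 with ha
  have ha0 : 0 < a := by positivity
  have ha1 : a ≤ 1 := by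
    rw [ha, div_le_one (by positivity)]; nlinarith
  have hsqa : Real.sqrt a = 1 / q := by
    rw [ha, Real.sqrt_div zero_le_one, Real.sqrt_one, Real.sqrt_sq hq0.le]
  refine ⟨a / 9, by positivity, ?_⟩
  intro s hst hsb hs1 hs0
  have hL := one_le_log_abs_add_three s.im
  obtain ⟨b, hb⟩ : ∃ b, b = (1 - s.re) * Real.log (|s.im| + 3) := ⟨_, rfl⟩
  obtain ⟨hM, hd0, h00, hb0, hz0, hl0⟩ := h.rescale (t := s.im) (τ := 0) ha0 ha1 (by simp)
  obtain ⟨-, hd1, h01, hb1, hz1, hl1⟩ := h.rescale (t := s.im) (τ := s.im) ha0 ha1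
    (by linarith [abs_nonneg s.im])
  obtain ⟨-, hd2, h02, hb2, hz2, hl2⟩ := h.rescale (t := s.im) (τ := 2 * s.im) ha0 ha1
    (by rw [abs_mul]; simp)
  have h341 := h.three_four_one (1 + a / Real.log (|s.im| + 3)) s.im (by
    have : 0 < a / Real.log (|s.im| + 3) := by positivity
    linarith)
  set L := Real.log (|s.im| + 3) with hLdef
  have hb0' : 0 ≤ b := by rw [hb]; exact mul_nonneg (by linarith) (by linarith)
  have hb9 : b ≤ a / 9 := by
    have h5 : 1 - s.re ≤ a / 9 / L := by linarith
    rw [le_div_iff₀ (by linarith)] at h5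
    rw [hb]; exact h5
  have hbs : s.re = 1 - b / L := by rw [hb]; field_simp; ring
  set x := (a + b) / (L * r) with hx
  have hx0 : 0 < x := by positivity
  have hx1 : x < 1 := by
    rw [hx, div_lt_one (by positivity)]
    have e1 : a * q ^ 2 = 1 := by rw [ha]; field_simp
    have e2 : 4 ≤ q * r := by
      have : 4 / r ≤ q := by linarith
      rwa [div_le_iff₀ hr] at this
    have e3 : a * 8 ≤ r := by
      by_contra! hcon
      have h1 : r * q ^ 2 < a * 8 * q ^ 2 := by gcongr
      nlinarith
    nlinarith
  have g0 := neg_re_logDeriv_le hM hd0 h00 hb0 hz0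
  have g2 := neg_re_logDeriv_le hM hd2 h02 hb2 hz2
  have g1 := neg_re_logDeriv_le_of_zero hM hd1 h01 hb1 hz1 hx0 hx1 (by
    have : (((1 + a / L : ℝ) : ℂ) + s.im * Complex.I + r * ((-x : ℝ) : ℂ)) = s := by
      apply Complex.ext
      · simp only [Complex.add_re, Complex.ofReal_re, Complex.mul_re, Complex.I_re, mul_zero,
          Complex.ofReal_im, Complex.I_im, mul_one, sub_self, add_zero, sub_zero]
        rw [hbs, hx]; field_simp; ring
      · simp
    rw [this]; exact hs0)
  rw [hl0, Complex.re_ofReal_mul, Complex.sub_re] at g0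
  rw [hl1, Complex.re_ofReal_mul, Complex.sub_re] at g1
  rw [hl2, Complex.re_ofReal_mul, Complex.sub_re] at g2
  have p1 := re_one_div_le (s := ((1 + a / L : ℝ) : ℂ) + s.im * Complex.I) ht₀ (by simpa using hst)
  have p2 := re_one_div_le (s := ((1 + a / L : ℝ) : ℂ) + (2 * s.im : ℝ) * Complex.I) ht₀ (by
    simp; linarith [abs_nonneg s.im])
  have p0 : (1 / (((1 + a / L : ℝ) : ℂ) + (0 : ℝ) * Complex.I - 1)).re = L / a := by
    have : (((1 + a / L : ℝ) : ℂ) + (0 : ℝ) * Complex.I - 1) = ((a / L : ℝ) : ℂ) := by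
      push_cast; ring
    rw [this, ← Complex.ofReal_one, ← Complex.ofReal_div, Complex.ofReal_re, one_div_div]
  rw [p0] at g0
  rw [Complex.ofReal_zero, zero_mul, add_zero] at g0
  set u0 := (H ((1 + a / L : ℝ) : ℂ)).re
  set u1 := (H (((1 + a / L : ℝ) : ℂ) + s.im * Complex.I)).re
  set u2 := (H (((1 + a / L : ℝ) : ℂ) + (2 * s.im : ℝ) * Complex.I)).re
  set M := B * (L / Real.sqrt a) with hMdef
  have hMq : M = B * L * q := by rw [hMdef, hsqa]; field_simp
  -- combine the three inequalities
  have k1 : r * (4 / (r * x)) ≤ r * (3 * (L / a) + 5 / t₀) + 8 * (48 * M) + 4 := by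
    have e1 : r * (4 / (r * x)) = 4 * (1 / x) := by field_simp
    rw [e1]
    have e5 : r * (5 / t₀) = 5 * (r * (1 / t₀)) := by ring
    have e2 := mul_nonneg hr.le h341
    have e3 := mul_le_mul_of_nonneg_left p1 hr.le
    have e4 := mul_le_mul_of_nonneg_left p2 hr.le
    linarith [e5]
  exact zeroFree_arith hr ht₀ (by positivity) hL (by linarith) rfl rfl hb0' hb9 hMq k1

/-- The classical zero-free region. -/
lemma exists_zeroFree (h : ZeroFreeData G H r C A c) :
    ∃ b, 0 < b ∧ b ≤ r ∧ ∀ s : ℂ, 1 - b / Real.log (|s.im| + 3) ≤ s.re → s.re ≤ 3 → G s ≠ 0 := by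
  have hr := h.r_pos
  have hc1 : ContinuousAt G 1 :=
    (h.diff.differentiableAt ((isOpen_halfPlane r).mem_nhds (by simp; linarith))).continuousAt
  obtain ⟨e, he, hball⟩ := Metric.eventually_nhds_iff.1 (hc1.eventually_ne h.one_ne)
  obtain ⟨b, hb, hb'⟩ := h.ne_zero_of_le_abs_im (t₀ := e / 2) (by positivity)
  refine ⟨min b (min r (e / 3)), by positivity, (min_le_right _ _).trans (min_le_left _ _), ?_⟩
  intro s hs hs3
  have hL := one_le_log_abs_add_three s.im
  rcases lt_or_ge 1 s.re with h1 | h1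
  · exact h.ne_zero_of_one_lt h1 hs3
  · rcases le_or_gt (e / 2) |s.im| with h2 | h2
    · refine hb' s h2 (le_trans ?_ hs) h1
      have : min b (min r (e / 3)) ≤ b := min_le_left _ _
      gcongr
    · apply hball
      have h3 : min b (min r (e / 3)) / Real.log (|s.im| + 3) ≤ e / 3 := by
        refine (div_le_self (by positivity) hL).trans ?_
        exact (min_le_right _ _).trans (min_le_right _ _)
      rw [dist_eq_norm]
      refine (Complex.norm_le_abs_re_add_abs_im _).trans_lt ?_
      simp only [Complex.sub_re, Complex.one_re, Complex.sub_im, Complex.one_im, sub_zero]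
      rw [abs_of_nonpos (by linarith)]
      linarith

end ZeroFreeData

lemma sq_log_le_rpow_half {y : ℝ} (hy : 1 ≤ y) :
    Real.log y ^ 2 ≤ 16 * y ^ (1 / 2 : ℝ) := by
  have h0 : 0 ≤ y := by linarith
  have h1 := Real.log_le_rpow_div h0 (show (0 : ℝ) < 1 / 4 by norm_num)
  have h2 := Real.log_nonneg hy
  have h3 : (y ^ (1 / 4 : ℝ)) ^ 2 = y ^ (1 / 2 : ℝ) := by
    rw [← Real.rpow_natCast, ← Real.rpow_mul h0]; norm_num
  calc Real.log y ^ 2 ≤ (y ^ (1 / 4 : ℝ) / (1 / 4)) ^ 2 := by gcongr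
    _ = 16 * (y ^ (1 / 4 : ℝ)) ^ 2 := by ring
    _ = _ := by rw [h3]

namespace ZeroFreeData

variable {G H : ℂ → ℂ} {r C A c : ℝ}

/-- The logarithmic derivative grows slowly in a zero-free region. -/
lemma exists_logDeriv_bound (h : ZeroFreeData G H r C A c) :
    ∃ b D, 0 < b ∧ b ≤ r ∧ 0 < D ∧ ∀ s : ℂ, 1 - b / Real.log (|s.im| + 3) ≤ s.re → s.re ≤ 2 →
      G s ≠ 0 ∧ ‖deriv G s / G s‖ ≤ D * (|s.im| + 3) ^ (1 / 2 : ℝ) := by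
  obtain ⟨b, hb, hbr, hzf⟩ := h.exists_zeroFree
  have hr := h.r_pos
  have hr1 := h.r_le
  have hA := h.A_nonneg
  have hD := abs_nonneg (Real.log (C / c))
  set B := 2 * A + 6 + |Real.log (C / c)| with hB
  have hB0 : 0 < B := by positivity
  set ε := b / 8 with hε
  have hε0 : 0 < ε := by positivity
  have hsε : 0 < Real.sqrt ε := Real.sqrt_pos.2 hε0
  refine ⟨ε, 96 * (B / (ε * Real.sqrt ε)), hε0, by linarith, by positivity, ?_⟩
  intro s hs hs2
  have hL := one_le_log_abs_add_three s.im
  set L := Real.log (|s.im| + 3) with hLdef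
  have hbL : 8 * (ε / L) = b / L := by rw [hε]; ring
  have hεL : 0 < ε / L := by positivity
  have hεL1 : ε / L ≤ 1 / 8 := by
    have : ε / L ≤ ε := div_le_self hε0.le hL
    linarith
  have hεLr : 8 * (ε / L) ≤ r := by
    have : ε / L ≤ ε := div_le_self hε0.le hL
    linarith
  set σ := max s.re (1 + ε / L) with hσ
  have hσ1 : 1 + ε / L ≤ σ := le_max_right _ _
  have hσ2 : σ ≤ 2 := max_le hs2 (by linarith)
  have hσs : |s.re - σ| ≤ 2 * (ε / L) := by
    rw [abs_le]
    have : s.re ≤ σ := le_max_left _ _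
    refine ⟨?_, by linarith⟩
    rcases max_cases s.re (1 + ε / L) with ⟨h1, h2⟩ | ⟨h1, h2⟩ <;> linarith
  set u : ℂ := σ + s.im * Complex.I with hu
  have hure : u.re = σ := by simp [hu]
  have huim : u.im = s.im := by simp [hu]
  have hball : ∀ z ∈ Metric.ball u (4 * (ε / L)), 1 - 3 * (ε / L) ≤ z.re ∧ z.re ≤ 3 ∧
      Real.log (|z.im| + 3) ≤ 2 * L := by
    intro z hz
    rw [mem_ball_iff_norm] at hz
    have h1 := Complex.abs_re_le_norm (z - u)
    have h2 := Complex.abs_im_le_norm (z - u)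
    rw [Complex.sub_re, hure] at h1
    rw [Complex.sub_im, huim] at h2
    have h3 := neg_abs_le (z.re - σ)
    have h4 := le_abs_self (z.re - σ)
    refine ⟨by linarith, by linarith, ?_⟩
    have h5 : |z.im| ≤ |s.im| + 1 := by
      have := abs_sub_abs_le_abs_sub z.im s.im
      linarith
    have h6 := abs_nonneg s.im
    have h7 : 2 * L = Real.log ((|s.im| + 3) ^ 2) := by rw [Real.log_pow]; push_cast; rfl
    rw [h7]
    exact Real.log_le_log (by positivity) (by nlinarith)
  have hne : ∀ z ∈ Metric.ball u (4 * (ε / L)), G z ≠ 0 := by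
    intro z hz
    obtain ⟨h1, h2, h3⟩ := hball z hz
    refine hzf z (le_trans ?_ h1) h2
    have h4 : b / (2 * L) ≤ b / Real.log (|z.im| + 3) :=
      div_le_div_of_nonneg_left hb.le (by linarith [one_le_log_abs_add_three z.im]) h3
    have h5 : b / (2 * L) = 4 * (ε / L) := by rw [hε]; field_simp; norm_num
    linarith
  have hsu : ‖s - u‖ ≤ 4 * (ε / L) / 2 := by
    have : s - u = ((s.re - σ : ℝ) : ℂ) := by
      apply Complex.ext <;> simp [hu]
    rw [this, Complex.norm_real, Real.norm_eq_abs]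
    linarith
  have hdiff : DifferentiableOn ℂ G (Metric.ball u (4 * (ε / L))) := by
    refine h.diff.mono fun z hz => ?_
    have := (hball z hz).1
    simp only [Set.mem_ofPred_eq]
    linarith
  have hgrow : ∀ z ∈ Metric.ball u (4 * (ε / L)),
      ‖G z‖ ≤ Real.exp (B * (L / Real.sqrt ε)) * ‖G u‖ := by
    intro z hz
    have hz1 : ‖z - u‖ < 4 * (ε / L) := by rwa [mem_ball_iff_norm] at hz
    have h1 := h.norm_le_near (s := u) (w := z - u) (ε := |s.im|) (by rw [hure]; exact hσ2)
      (by linarith) (by rw [add_sub_cancel]; linarith [(hball z hz).1]) (by rw [huim])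
    rw [add_sub_cancel] at h1
    refine h1.trans ((growth_exponent_bound (t := s.im) h.C_pos hA h.c_pos hε0 (by linarith)
      (by linarith [abs_nonneg s.im])).trans ?_)
    have h2 := h.lower u (by rw [hure]; linarith) (by rw [hure]; linarith)
    rw [hure] at h2
    have h3 : ε / L ≤ σ - 1 := by linarith
    have h4 := h.c_pos
    gcongr
    refine le_trans ?_ h2
    gcongr
  have hs_mem : s ∈ Metric.ball u (4 * (ε / L)) := by
    rw [mem_ball_iff_norm]; linarith
  refine ⟨hne s hs_mem, ?_⟩
  have h1 := norm_logDeriv_le_of_norm_le_exp_mul (by positivity) (by positivity) hdiff hne hgrow hsu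
  refine h1.trans ?_
  have h2 : 24 * (B * (L / Real.sqrt ε)) / (4 * (ε / L)) =
      6 * (B / (ε * Real.sqrt ε)) * L ^ 2 := by field_simp; norm_num
  rw [h2]
  have h3 := sq_log_le_rpow_half (y := |s.im| + 3) (by linarith [abs_nonneg s.im])
  calc 6 * (B / (ε * Real.sqrt ε)) * L ^ 2 ≤
        6 * (B / (ε * Real.sqrt ε)) * (16 * (|s.im| + 3) ^ (1 / 2 : ℝ)) := by gcongr
    _ = _ := by ring

end ZeroFreeData

/-- A nonnegative arithmetic function `a` with logarithmic derivative `l`, whose summatory function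
is `κ t` up to a power saving. -/
structure DensityData (a l : ℕ → ℝ) (κ C δ : ℝ) : Prop where
  nonneg : ∀ n, 0 ≤ a n
  one : a 1 = 1
  log_nonneg : ∀ n, 0 ≤ l n
  log_le : ∀ n, l n ≤ C * ArithmeticFunction.vonMangoldt n
  conv : ∀ n, n ≠ 0 → a n * Real.log n = ∑ p ∈ n.divisorsAntidiagonal, l p.1 * a p.2
  κ_pos : 0 < κ
  C_pos : 0 < C
  δ_pos : 0 < δ
  δ_lt : δ < 1
  count : ∀ t : ℝ, 1 ≤ t → |∑ k ∈ Finset.Icc 1 ⌊t⌋₊, a k - κ * t| ≤ C * t ^ (1 - δ)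

namespace DensityData

open Filter Topology Asymptotics

variable {a l : ℕ → ℝ} {κ C δ : ℝ}

/-- The error term in the summatory function of `a`, cut off below `1`. -/
noncomputable def err (a : ℕ → ℝ) (κ : ℝ) : ℝ → ℂ :=
  (Set.Ioi (1 : ℝ)).indicator fun t => ((∑ k ∈ Finset.Icc 1 ⌊t⌋₊, a k - κ * t : ℝ) : ℂ)

lemma measurable_err : Measurable (err a κ) := by
  refine Measurable.indicator ?_ measurableSet_Ioi
  refine Complex.measurable_ofReal.comp (Measurable.sub ?_ (by fun_prop))
  exact (measurable_from_nat (f := fun n => ∑ k ∈ Finset.Icc 1 n, a k)).comp Nat.measurable_floor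

lemma norm_err_le (h : DensityData a l κ C δ) (t : ℝ) : ‖err a κ t‖ ≤ C * |t| ^ (1 - δ) := by
  by_cases ht : t ∈ Set.Ioi (1 : ℝ)
  · have ht1 : 1 < t := ht
    rw [err, Set.indicator_of_mem ht, Complex.norm_real, Real.norm_eq_abs,
      abs_of_pos (one_pos.trans ht1)]
    exact h.count t ht1.le
  · have := h.C_pos
    rw [err, Set.indicator_of_notMem ht, norm_zero]
    positivity

lemma err_isBigO_top (h : DensityData a l κ C δ) :
    err a κ =O[atTop] (· ^ (-(-(1 - δ)))) := by
  refine IsBigO.of_bound C ?_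
  filter_upwards [eventually_ge_atTop 0] with t ht
  rw [neg_neg, Real.norm_of_nonneg (Real.rpow_nonneg ht _)]
  simpa [abs_of_nonneg ht] using h.norm_err_le t

lemma err_isBigO_bot (b : ℝ) : err a κ =O[𝓝[>] 0] (· ^ (-b)) := by
  refine (isBigO_zero _ _).congr' ?_ EventuallyEq.rfl
  have : Set.Ioo (0 : ℝ) 1 ∈ 𝓝[>] (0 : ℝ) := Ioo_mem_nhdsGT one_pos
  filter_upwards [this] with t ht
  rw [err, Set.indicator_of_notMem]
  simpa using ht.2.le

lemma locallyIntegrableOn_err (h : DensityData a l κ C δ) :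
    LocallyIntegrableOn (err a κ) (Set.Ioi 0) := by
  have h1 : Continuous (fun t : ℝ => C * |t| ^ (1 - δ)) := by
    have := h.δ_lt
    exact continuous_const.mul
      ((Real.continuous_rpow_const (by linarith)).comp continuous_abs)
  refine (h1.locallyIntegrable.locallyIntegrableOn _).mono
    measurable_err.aestronglyMeasurable (Eventually.of_forall fun t => ?_)
  exact (h.norm_err_le t).trans (le_abs_self _)

/-- The analytic continuation of `(s - 1) * LSeries a s`. -/
noncomputable def cont (a : ℕ → ℝ) (κ : ℝ) (s : ℂ) : ℂ :=
  κ * s + (s - 1) * s * mellin (err a κ) (-s)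

lemma differentiableAt_mellin_err (h : DensityData a l κ C δ) {s : ℂ} (hs : 1 - δ < s.re) :
    DifferentiableAt ℂ (fun s => mellin (err a κ) (-s)) s := by
  have h1 : DifferentiableAt ℂ (mellin (err a κ)) (-s) :=
    mellin_differentiableAt_of_isBigO_rpow h.locallyIntegrableOn_err h.err_isBigO_top
      (by rw [Complex.neg_re]; linarith) (err_isBigO_bot (-s.re - 1))
      (by rw [Complex.neg_re]; linarith)
  exact h1.comp s differentiableAt_id.neg

lemma differentiableAt_cont (h : DensityData a l κ C δ) {s : ℂ} (hs : 1 - δ < s.re) :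
    DifferentiableAt ℂ (cont a κ) s := by
  have h1 := h.differentiableAt_mellin_err hs
  unfold cont
  fun_prop

lemma norm_mellin_err_le (h : DensityData a l κ C δ) {s : ℂ} (hs : 1 - δ < s.re) :
    ‖mellin (err a κ) (-s)‖ ≤ C / (s.re - (1 - δ)) := by
  have h0 : ∀ t ∈ Set.Ioi (0 : ℝ), ‖(t : ℂ) ^ (-s - 1) • err a κ t‖ ≤
      (Set.Ioi (1 : ℝ)).indicator (fun t => C * t ^ (-(s.re - (1 - δ)) - 1)) t := by
    intro t ht
    have ht0 : 0 < t := ht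
    by_cases ht1 : t ∈ Set.Ioi (1 : ℝ)
    · rw [Set.indicator_of_mem ht1, norm_smul, Complex.norm_cpow_eq_rpow_re_of_pos ht0]
      have h2 := h.norm_err_le t
      rw [abs_of_pos ht0] at h2
      have h3 : t ^ (-(s.re - (1 - δ)) - 1) = t ^ (-s - 1).re * t ^ (1 - δ) := by
        rw [← Real.rpow_add ht0]; congr 1; simp; ring
      rw [h3]
      calc _ ≤ t ^ (-s - 1).re * (C * t ^ (1 - δ)) := by gcongr
        _ = _ := by ring
    · rw [Set.indicator_of_notMem ht1, err, Set.indicator_of_notMem ht1]; simp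
  have hlt : -(s.re - (1 - δ)) - 1 < -1 := by linarith
  have hInt : IntegrableOn (fun t : ℝ => C * t ^ (-(s.re - (1 - δ)) - 1)) (Set.Ioi 1) :=
    (integrableOn_Ioi_rpow_of_lt hlt one_pos).const_mul C
  have hval : ∫ t in Set.Ioi (0 : ℝ), (Set.Ioi (1 : ℝ)).indicator
      (fun t => C * t ^ (-(s.re - (1 - δ)) - 1)) t = C / (s.re - (1 - δ)) := by
    rw [setIntegral_indicator measurableSet_Ioi,
      Set.inter_eq_right.2 (Set.Ioi_subset_Ioi zero_le_one), integral_const_mul,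
      integral_Ioi_rpow_of_lt hlt one_pos, Real.one_rpow]
    have : s.re - (1 - δ) ≠ 0 := by linarith
    have : -(s.re - (1 - δ)) - 1 + 1 ≠ 0 := by
      intro h; apply this; linarith
    field_simp
    ring
  rw [← hval]
  unfold mellin
  refine norm_integral_le_of_norm_le ?_ ((ae_restrict_iff' measurableSet_Ioi).2
    (Eventually.of_forall h0))
  exact (hInt.integrable_indicator measurableSet_Ioi).integrableOn

lemma norm_cont_le (h : DensityData a l κ C δ) {s : ℂ} (hs : 1 - δ / 4 ≤ s.re)
    (hs3 : s.re ≤ 3) : ‖cont a κ s‖ ≤ (κ + 2 * C / δ) * (|s.im| + 3) ^ (2 : ℝ) := by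
  have hδ := h.δ_pos
  have hδ1 := h.δ_lt
  have hC := h.C_pos
  have hκ := h.κ_pos
  have him := abs_nonneg s.im
  have h1 := h.norm_mellin_err_le (s := s) (by linarith)
  have h2 : ‖mellin (err a κ) (-s)‖ ≤ 2 * C / δ := by
    refine h1.trans ?_
    rw [div_le_div_iff₀ (by linarith) hδ]
    nlinarith
  have h3 : ‖s‖ ≤ |s.im| + 3 := by
    refine (Complex.norm_le_abs_re_add_abs_im s).trans ?_
    rw [abs_of_nonneg (by linarith)]; linarith
  have h4 : ‖s - 1‖ ≤ |s.im| + 3 := by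
    refine (Complex.norm_le_abs_re_add_abs_im _).trans ?_
    have : |(s - 1).re| ≤ 3 := by
      rw [abs_le]; constructor <;> simp <;> linarith
    have h5 : (s - 1).im = s.im := by simp
    rw [h5]; linarith
  have hsq : (|s.im| + 3) ^ (2 : ℝ) = (|s.im| + 3) * (|s.im| + 3) := by
    rw [Real.rpow_two]; ring
  rw [hsq, cont]
  refine (norm_add_le _ _).trans ?_
  rw [norm_mul, norm_mul, norm_mul, Complex.norm_real, Real.norm_of_nonneg hκ.le]
  calc κ * ‖s‖ + ‖s - 1‖ * ‖s‖ * ‖mellin (err a κ) (-s)‖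
      ≤ κ * ((|s.im| + 3) * (|s.im| + 3)) +
        (|s.im| + 3) * (|s.im| + 3) * (2 * C / δ) := by
        have : ‖s‖ ≤ (|s.im| + 3) * (|s.im| + 3) := by nlinarith
        gcongr
    _ = _ := by ring

lemma isBigO_sum (h : DensityData a l κ C δ) :
    (fun n : ℕ => ∑ k ∈ Finset.Icc 1 n, a k) =O[atTop] fun n => (n : ℝ) ^ (1 : ℝ) := by
  refine IsBigO.of_bound (C + κ) ?_
  filter_upwards [eventually_ge_atTop 1] with n hn
  have hn1 : (1 : ℝ) ≤ n := by exact_mod_cast hn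
  have h1 := h.count n hn1
  have hδ := h.δ_pos
  have hC := h.C_pos
  have hκ := h.κ_pos
  rw [Nat.floor_natCast] at h1
  have h2 : (n : ℝ) ^ (1 - δ) ≤ n := by
    conv_rhs => rw [← Real.rpow_one n]
    exact Real.rpow_le_rpow_of_exponent_le hn1 (by linarith)
  rw [Real.rpow_one, Real.norm_of_nonneg (Finset.sum_nonneg fun k _ => h.nonneg k),
    Real.norm_of_nonneg (by positivity)]
  have h3 := (abs_le.1 h1).2
  nlinarith

lemma summable_a (h : DensityData a l κ C δ) {s : ℂ} (hs : 1 < s.re) :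
    LSeriesSummable (fun n => (a n : ℂ)) s :=
  LSeriesSummable_of_sum_norm_bigO_and_nonneg h.isBigO_sum h.nonneg zero_le_one hs

lemma cont_eq (h : DensityData a l κ C δ) {s : ℂ} (hs : 1 < s.re) :
    cont a κ s = (s - 1) * LSeries (fun n => (a n : ℂ)) s := by
  have hδ := h.δ_pos
  have hs0 : s ≠ 0 := by rintro rfl; simp at hs; linarith
  have hs1 : s - 1 ≠ 0 := by
    intro h0; rw [sub_eq_zero.1 h0] at hs; simp at hs
  rw [LSeries_eq_mul_integral_of_nonneg a zero_le_one hs h.isBigO_sum h.nonneg]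
  have hconv : MellinConvergent (err a κ) (-s) :=
    mellinConvergent_of_isBigO_rpow h.locallyIntegrableOn_err h.err_isBigO_top
      (by rw [Complex.neg_re]; linarith) (err_isBigO_bot (-s.re - 1))
      (by rw [Complex.neg_re]; linarith)
  have e1 : mellin (err a κ) (-s) = ∫ t in Set.Ioi (1 : ℝ),
      ((∑ k ∈ Finset.Icc 1 ⌊t⌋₊, (a k : ℂ)) * (t : ℂ) ^ (-(s + 1)) - κ * (t : ℂ) ^ (-s)) := by
    have h1 : mellin (err a κ) (-s) = ∫ t in Set.Ioi (0 : ℝ), (Set.Ioi (1 : ℝ)).indicator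
        (fun t => (∑ k ∈ Finset.Icc 1 ⌊t⌋₊, (a k : ℂ)) * (t : ℂ) ^ (-(s + 1)) -
          κ * (t : ℂ) ^ (-s)) t := by
      unfold mellin
      refine setIntegral_congr_fun measurableSet_Ioi fun t ht => ?_
      have ht0 : (t : ℂ) ≠ 0 := by
        have : 0 < t := ht
        exact_mod_cast this.ne'
      by_cases ht1 : t ∈ Set.Ioi (1 : ℝ)
      · simp only [err, Set.indicator_of_mem ht1, smul_eq_mul]
        have e2 : (t : ℂ) ^ (-s) = (t : ℂ) ^ (-(s + 1)) * t := by
          rw [show -s = -(s + 1) + 1 by ring, Complex.cpow_add _ _ ht0, Complex.cpow_one]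
        have e3 : -s - 1 = -(s + 1) := by ring
        rw [e2, e3]
        push_cast
        ring
      · simp only [err, Set.indicator_of_notMem ht1, smul_zero]
    rw [h1, setIntegral_indicator measurableSet_Ioi,
      Set.inter_eq_right.2 (Set.Ioi_subset_Ioi zero_le_one)]
  have hInt2 : IntegrableOn (fun t : ℝ => (κ : ℂ) * (t : ℂ) ^ (-s)) (Set.Ioi 1) :=
    (integrableOn_Ioi_cpow_of_lt (by rw [Complex.neg_re]; linarith) one_pos).const_mul _
  have hInt1 : IntegrableOn (fun t : ℝ => (∑ k ∈ Finset.Icc 1 ⌊t⌋₊, (a k : ℂ)) *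
      (t : ℂ) ^ (-(s + 1))) (Set.Ioi 1) := by
    have h1 : IntegrableOn (fun t : ℝ => (t : ℂ) ^ (-s - 1) • err a κ t) (Set.Ioi 1) :=
      IntegrableOn.mono_set hconv (Set.Ioi_subset_Ioi zero_le_one)
    refine (h1.add hInt2).congr_fun (fun t ht => ?_) measurableSet_Ioi
    have ht0 : (t : ℂ) ≠ 0 := by
      have : 0 < t := one_pos.trans ht
      exact_mod_cast this.ne'
    simp only [err, Pi.add_apply, Set.indicator_of_mem ht, smul_eq_mul]
    have e2 : (t : ℂ) ^ (-s) = (t : ℂ) ^ (-(s + 1)) * t := by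
      rw [show -s = -(s + 1) + 1 by ring, Complex.cpow_add _ _ ht0, Complex.cpow_one]
    have e3 : -s - 1 = -(s + 1) := by ring
    rw [e2, e3]
    push_cast
    ring
  rw [cont, e1, integral_sub hInt1 hInt2, integral_const_mul,
    integral_Ioi_cpow_of_lt (by rw [Complex.neg_re]; linarith) one_pos]
  have : -s + 1 ≠ 0 := by
    intro h0; apply hs1; linear_combination -h0
  simp only [Complex.ofReal_one, Complex.one_cpow]
  field_simp
  ring

end DensityData

namespace DensityData

open Filter Topology

variable {a l : ℕ → ℝ} {κ C δ : ℝ}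

lemma summable_of_le_vonMangoldt {f : ℕ → ℝ} {B : ℝ} (hf : ∀ n, 0 ≤ f n)
    (hB : ∀ n, f n ≤ B * ArithmeticFunction.vonMangoldt n) {s : ℂ} (hs : 1 < s.re) :
    LSeriesSummable (fun n => (f n : ℂ)) s := by
  have h1 := (ArithmeticFunction.LSeriesSummable_vonMangoldt hs).norm.mul_left B
  refine Summable.of_norm_bounded h1 fun n => ?_
  rcases eq_or_ne n 0 with rfl | hn
  · simp
  · rw [LSeries.term_of_ne_zero hn, LSeries.term_of_ne_zero hn, norm_div, norm_div, mul_div_assoc']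
    gcongr
    rw [Complex.norm_real, Complex.norm_real, Real.norm_of_nonneg (hf n),
      Real.norm_of_nonneg ArithmeticFunction.vonMangoldt_nonneg]
    exact hB n

lemma summable_l (h : DensityData a l κ C δ) {s : ℂ} (hs : 1 < s.re) :
    LSeriesSummable (fun n => (l n : ℂ)) s :=
  summable_of_le_vonMangoldt h.log_nonneg h.log_le hs

lemma l_one (h : DensityData a l κ C δ) : l 1 = 0 := by
  have h1 := h.log_le 1
  simp at h1
  exact le_antisymm h1 (h.log_nonneg 1)

lemma summable_l_div_log (h : DensityData a l κ C δ) {s : ℂ} (hs : 1 < s.re) :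
    LSeriesSummable (fun n => ((l n / Real.log n : ℝ) : ℂ)) s := by
  have hl2 := Real.log_pos (show (1 : ℝ) < 2 by norm_num)
  refine summable_of_le_vonMangoldt (B := C / Real.log 2)
    (fun n => div_nonneg (h.log_nonneg n) (Real.log_natCast_nonneg n)) (fun n => ?_) hs
  have hC := h.C_pos
  have hΛ := ArithmeticFunction.vonMangoldt_nonneg (n := n)
  rcases lt_or_ge n 2 with hn | hn
  · have : Real.log n = 0 := by interval_cases n <;> simp
    rw [this, div_zero]
    positivity
  · have h1 : Real.log 2 ≤ Real.log n := Real.log_le_log (by norm_num) (by exact_mod_cast hn)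
    calc l n / Real.log n ≤ l n / Real.log 2 :=
          div_le_div_of_nonneg_left (h.log_nonneg n) hl2 h1
      _ ≤ C * ArithmeticFunction.vonMangoldt n / Real.log 2 := by
          gcongr; exact h.log_le n
      _ = _ := by ring

lemma abscissa_le_one {f : ℕ → ℂ} (hf : ∀ s : ℂ, 1 < s.re → LSeriesSummable f s) {s : ℂ}
    (hs : 1 < s.re) : LSeries.abscissaOfAbsConv f < s.re := by
  have h1 : LSeries.abscissaOfAbsConv f ≤ (1 : ℝ) :=
    LSeries.abscissaOfAbsConv_le_of_forall_lt_LSeriesSummable fun y hy => hf y (by simpa using hy)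
  exact h1.trans_lt (by exact_mod_cast hs)

lemma hasDerivAt_LSeries_a (h : DensityData a l κ C δ) {s : ℂ} (hs : 1 < s.re) :
    HasDerivAt (LSeries fun n => (a n : ℂ))
      (-(LSeries (fun n => (l n : ℂ)) s * LSeries (fun n => (a n : ℂ)) s)) s := by
  have h1 := LSeries_hasDerivAt (abscissa_le_one (f := fun n => (a n : ℂ))
    (fun s hs => h.summable_a hs) hs)
  rw [← LSeries_convolution' (h.summable_l hs) (h.summable_a hs)]
  convert h1 using 2
  refine LSeries_congr (fun {n} hn => ?_) s
  rw [LSeries.convolution_def, LSeries.logMul]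
  have := h.conv n hn
  rw [← Complex.natCast_log]
  have h2 := congrArg (fun x : ℝ => (x : ℂ)) this
  simp only [Complex.ofReal_mul, Complex.ofReal_sum] at h2
  rw [mul_comm]
  exact h2.symm

lemma hasDerivAt_LSeries_l_div_log (h : DensityData a l κ C δ) {s : ℂ} (hs : 1 < s.re) :
    HasDerivAt (LSeries fun n => ((l n / Real.log n : ℝ) : ℂ))
      (-(LSeries (fun n => (l n : ℂ)) s)) s := by
  have h1 := LSeries_hasDerivAt (abscissa_le_one (f := fun n => ((l n / Real.log n : ℝ) : ℂ))
    (fun s hs => h.summable_l_div_log hs) hs)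
  convert h1 using 2
  refine LSeries_congr (fun {n} hn => ?_) s
  rw [LSeries.logMul, ← Complex.natCast_log, ← Complex.ofReal_mul]
  congr 1
  rcases eq_or_ne n 1 with rfl | hn1
  · simp [h.l_one]
  · have : Real.log n ≠ 0 := by
      have h2 : (1 : ℝ) < n := by exact_mod_cast (by omega : 1 < n)
      exact (Real.log_pos h2).ne'
    field_simp

lemma re_LSeries_ofReal_le {f : ℕ → ℝ} (hf : ∀ n, 0 ≤ f n)
    (hsum : ∀ s : ℂ, 1 < s.re → LSeriesSummable (fun n => (f n : ℂ)) s) {s : ℂ} (hs : 1 < s.re) :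
    -(LSeries (fun n => (f n : ℂ)) s.re).re ≤ (LSeries (fun n => (f n : ℂ)) s).re := by
  have hs' : 1 < ((s.re : ℝ) : ℂ).re := by simpa using hs
  rw [LSeries, LSeries, Complex.re_tsum (hsum s hs), Complex.re_tsum (hsum _ hs'), ← tsum_neg]
  refine Summable.tsum_le_tsum (fun n => ?_) (Complex.hasSum_re (hsum _ hs').hasSum).summable.neg
    (Complex.hasSum_re (hsum s hs).hasSum).summable
  rcases eq_or_ne n 0 with rfl | hn
  · simp
  · have h1 := Complex.abs_re_le_norm (LSeries.term (fun n => (f n : ℂ)) s n)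
    have h2 : (LSeries.term (fun n => (f n : ℂ)) s.re n).re =
        ‖LSeries.term (fun n => (f n : ℂ)) s n‖ := by
      rw [LSeries.norm_term_eq, if_neg hn, LSeries.term_of_ne_zero hn, Complex.norm_real,
        Real.norm_of_nonneg (hf n), ← Complex.ofReal_natCast,
        ← Complex.ofReal_cpow (Nat.cast_nonneg n), ← Complex.ofReal_div, Complex.ofReal_re]
    rw [h2]
    exact (abs_le.1 h1).1

/-- `LSeries a` is a nonzero constant times an exponential. -/
lemma exists_eq_exp (h : DensityData a l κ C δ) : ∃ k : ℂ, k ≠ 0 ∧ ∀ s : ℂ, 1 < s.re →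
    LSeries (fun n => (a n : ℂ)) s =
      k * Complex.exp (LSeries (fun n => ((l n / Real.log n : ℝ) : ℂ)) s) := by
  set Z := LSeries (fun n => (a n : ℂ)) with hZ
  set P := LSeries (fun n => ((l n / Real.log n : ℝ) : ℂ)) with hP
  have hopen : IsOpen {s : ℂ | 1 < s.re} := isOpen_lt continuous_const Complex.continuous_re
  have hder : ∀ s ∈ {s : ℂ | 1 < s.re}, HasDerivAt (fun s => Z s * Complex.exp (-(P s))) 0 s := by
    intro s hs
    refine ((h.hasDerivAt_LSeries_a hs).mul
      (h.hasDerivAt_LSeries_l_div_log hs).neg.cexp).congr_deriv ?_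
    ring
  have h2 : (2 : ℂ) ∈ {s : ℂ | 1 < s.re} := by simp
  have hconst : ∀ s ∈ {s : ℂ | 1 < s.re}, Z s * Complex.exp (-(P s)) =
      Z 2 * Complex.exp (-(P 2)) := fun s hs =>
    (convex_halfSpace_re_gt 1).is_const_of_fderivWithin_eq_zero (𝕜 := ℂ)
      (fun u hu => (hder u hu).differentiableAt.differentiableWithinAt)
      (fun u hu => by
        rw [fderivWithin_of_isOpen hopen hu, (hder u hu).hasFDerivAt.fderiv]
        ext; simp) hs h2
  have hZ2 : 1 ≤ (Z 2).re := by
    have hs := h.summable_a h2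
    rw [hZ, LSeries, Complex.re_tsum hs]
    have hnn : ∀ n, 0 ≤ (LSeries.term (fun n => (a n : ℂ)) 2 n).re := by
      intro n
      rcases eq_or_ne n 0 with rfl | hn
      · simp
      · rw [LSeries.term_of_ne_zero hn]
        have : (a n : ℂ) / (n : ℂ) ^ (2 : ℂ) = ((a n / (n : ℝ) ^ 2 : ℝ) : ℂ) := by
          have e : (n : ℂ) ^ (2 : ℂ) = (n : ℂ) ^ (2 : ℕ) := by
            rw [← Complex.cpow_natCast]; norm_num
          rw [e]; push_cast; rfl
        rw [this, Complex.ofReal_re]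
        exact div_nonneg (h.nonneg n) (by positivity)
    have h1 := (Complex.hasSum_re hs.hasSum).summable.le_tsum 1 (fun n _ => hnn n)
    refine le_trans (le_of_eq ?_) h1
    rw [LSeries.term_of_ne_zero one_ne_zero]
    simp [h.one]
  refine ⟨Z 2 * Complex.exp (-(P 2)), mul_ne_zero ?_ (Complex.exp_ne_zero _), fun s hs => ?_⟩
  · intro h0
    rw [h0] at hZ2
    simp at hZ2
    linarith
  · rw [← hconst s hs, mul_assoc, ← Complex.exp_add]
    simp

lemma exists_cont_lower (h : DensityData a l κ C δ) : ∃ c, 0 < c ∧ ∀ s : ℂ, 1 < s.re → s.re ≤ 3 →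
    c * (s.re - 1) ^ 2 ≤ ‖cont a κ s‖ := by
  obtain ⟨k, hk, hZ⟩ := h.exists_eq_exp
  have hk0 : 0 < ‖k‖ := norm_pos_iff.2 hk
  have hκ := h.κ_pos
  have hC := h.C_pos
  have hδ := h.δ_pos
  set B := (κ + 2 * C / δ) * (3 : ℝ) ^ (2 : ℝ) with hB
  have hB0 : 0 < B := by positivity
  refine ⟨‖k‖ ^ 2 / B, by positivity, fun s hs hs3 => ?_⟩
  have hs' : 1 < ((s.re : ℝ) : ℂ).re := by simpa using hs
  have h1 := h.norm_cont_le (s := (s.re : ℝ)) (by simp; linarith) (by simpa using hs3)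
  have h2 := re_LSeries_ofReal_le (f := fun n => l n / Real.log n)
    (fun n => div_nonneg (h.log_nonneg n) (Real.log_natCast_nonneg n))
    (fun s hs => h.summable_l_div_log hs) hs
  rw [h.cont_eq hs', hZ _ hs', norm_mul, norm_mul, Complex.norm_exp] at h1
  rw [h.cont_eq hs, hZ s hs, norm_mul, norm_mul, Complex.norm_exp]
  simp only [Complex.ofReal_im, abs_zero, zero_add] at h1
  set p := (LSeries (fun n => ((l n / Real.log n : ℝ) : ℂ)) (s.re : ℝ)).re
  set p' := (LSeries (fun n => ((l n / Real.log n : ℝ) : ℂ)) s).re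
  have e1 : ‖((s.re : ℝ) : ℂ) - 1‖ = s.re - 1 := by
    rw [← Complex.ofReal_one, ← Complex.ofReal_sub, Complex.norm_real,
      Real.norm_of_nonneg (by linarith)]
  rw [e1] at h1
  have e2 : s.re - 1 ≤ ‖s - 1‖ := by
    have := Complex.re_le_norm (s - 1)
    simpa using this
  have hpos : 0 < s.re - 1 := by linarith
  have e3 : Real.exp (-p) ≤ Real.exp p' := Real.exp_le_exp.2 h2
  have e4 : Real.exp p * Real.exp (-p) = 1 := by rw [← Real.exp_add]; simp
  calc ‖k‖ ^ 2 / B * (s.re - 1) ^ 2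
      = (‖k‖ * (s.re - 1)) * Real.exp (-p) *
          ((s.re - 1) * (‖k‖ * Real.exp p)) / B := by
        field_simp; linear_combination -e4
    _ ≤ (‖k‖ * (s.re - 1)) * Real.exp (-p) * B / B := by gcongr
    _ = (s.re - 1) * (‖k‖ * Real.exp (-p)) := by field_simp
    _ ≤ _ := by gcongr

lemma three_four_one_term {x : ℝ} (hx : 0 ≤ x) {n : ℕ} (hn : 0 < n) (σ t : ℝ) :
    0 ≤ 3 * ((x : ℂ) / (n : ℂ) ^ (σ : ℂ)).re +
      4 * ((x : ℂ) / (n : ℂ) ^ ((σ : ℂ) + t * Complex.I)).re +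
      ((x : ℂ) / (n : ℂ) ^ ((σ : ℂ) + (2 * t : ℝ) * Complex.I)).re := by
  have hn0 : (n : ℂ) ≠ 0 := by exact_mod_cast hn.ne'
  have hn1 : (0 : ℝ) < n := by exact_mod_cast hn
  set w : ℂ := (n : ℂ) ^ (-(t * Complex.I)) with hw
  have hw1 : ‖w‖ = 1 := by
    rw [hw, Complex.norm_natCast_cpow_of_pos hn]; simp
  have hr : (x : ℂ) / (n : ℂ) ^ (σ : ℂ) = ((x / (n : ℝ) ^ σ : ℝ) : ℂ) := by
    rw [← Complex.ofReal_natCast, ← Complex.ofReal_cpow hn1.le, Complex.ofReal_div]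
  have e1 : (x : ℂ) / (n : ℂ) ^ ((σ : ℂ) + t * Complex.I) =
      ((x / (n : ℝ) ^ σ : ℝ) : ℂ) * w := by
    rw [← hr, hw, Complex.cpow_add _ _ hn0, Complex.cpow_neg]
    field_simp
  have e2 : (x : ℂ) / (n : ℂ) ^ ((σ : ℂ) + (2 * t : ℝ) * Complex.I) =
      ((x / (n : ℝ) ^ σ : ℝ) : ℂ) * (w * w) := by
    rw [← hr, hw, ← Complex.cpow_add _ _ hn0,
      show -((t : ℂ) * Complex.I) + -(t * Complex.I) = -((2 * t : ℝ) * Complex.I) by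
        push_cast; ring, Complex.cpow_add _ _ hn0, Complex.cpow_neg]
    field_simp
  rw [e1, e2, hr, Complex.re_ofReal_mul, Complex.re_ofReal_mul, Complex.ofReal_re, Complex.mul_re]
  have h1 : w.re ^ 2 + w.im ^ 2 = 1 := by
    have := Complex.normSq_eq_norm_sq w
    rw [hw1, Complex.normSq_apply] at this
    linarith
  have h2 : 0 ≤ x / (n : ℝ) ^ σ := by positivity
  nlinarith [mul_nonneg h2 (sq_nonneg (1 + w.re))]

lemma three_four_one (h : DensityData a l κ C δ) (σ t : ℝ) (hσ : 1 < σ) :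
    0 ≤ 3 * (LSeries (fun n => (l n : ℂ)) σ).re +
      4 * (LSeries (fun n => (l n : ℂ)) (σ + t * Complex.I)).re +
      (LSeries (fun n => (l n : ℂ)) (σ + (2 * t : ℝ) * Complex.I)).re := by
  have s0 := Complex.hasSum_re (h.summable_l (s := σ) (by simpa using hσ)).hasSum
  have s1 := Complex.hasSum_re (h.summable_l (s := σ + t * Complex.I) (by simpa using hσ)).hasSum
  have s2 := Complex.hasSum_re
    (h.summable_l (s := σ + (2 * t : ℝ) * Complex.I) (by simpa using hσ)).hasSum
  refine ((s0.mul_left 3).add (s1.mul_left 4) |>.add s2).nonneg fun n => ?_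
  rcases eq_or_ne n 0 with rfl | hn
  · simp
  · simp only [LSeries.term_of_ne_zero hn]
    exact three_four_one_term (h.log_nonneg n) (Nat.pos_of_ne_zero hn) σ t

/-- Abstract density data provides the input for the zero-free region. -/
lemma exists_zeroFreeData (h : DensityData a l κ C δ) : ∃ C' c : ℝ,
    ZeroFreeData (cont a κ) (LSeries fun n => (l n : ℂ)) (δ / 4) C' 2 c := by
  obtain ⟨c, hc, hlow⟩ := h.exists_cont_lower
  have hκ := h.κ_pos
  have hC := h.C_pos
  have hδ := h.δ_pos
  have hδ1 := h.δ_lt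
  refine ⟨κ + 2 * C / δ, c, by positivity, by linarith, by positivity, by norm_num, hc, ?_, ?_,
    hlow, ?_, h.three_four_one, ?_⟩
  · intro s hs
    have hs' : 1 - 2 * (δ / 4) < s.re := hs
    exact (h.differentiableAt_cont (by linarith)).differentiableWithinAt
  · intro s hs hs3
    exact h.norm_cont_le hs hs3
  · intro s hs
    have hs1 : s - 1 ≠ 0 := by
      intro h0; rw [sub_eq_zero.1 h0] at hs; simp at hs
    have hopen : IsOpen {s : ℂ | 1 < s.re} := isOpen_lt continuous_const Complex.continuous_re
    have heq : cont a κ =ᶠ[𝓝 s] fun s => (s - 1) * LSeries (fun n => (a n : ℂ)) s := by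
      filter_upwards [hopen.mem_nhds hs] with u hu using h.cont_eq hu
    have hd : HasDerivAt (fun s => (s - 1) * LSeries (fun n => (a n : ℂ)) s) _ s :=
      ((hasDerivAt_id s).sub_const 1).mul (h.hasDerivAt_LSeries_a hs)
    rw [heq.deriv_eq, hd.deriv, h.cont_eq hs]
    have hZ : LSeries (fun n => (a n : ℂ)) s ≠ 0 := by
      obtain ⟨k, hk, hZ⟩ := h.exists_eq_exp
      rw [hZ s hs]
      exact mul_ne_zero hk (Complex.exp_ne_zero _)
    simp only [id]
    field_simp
    ring
  · simp only [cont, sub_self, zero_mul, add_zero, mul_one]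
    exact_mod_cast hκ.ne'

end DensityData

lemma integrable_kernel_majorant : Integrable (fun t : ℝ => (1 + |t|) ^ (-(5 / 4) : ℝ)) := by
  have := integrable_one_add_norm (μ := (volume : Measure ℝ)) (E := ℝ) (r := 5 / 4)
    (by rw [Module.finrank_self]; norm_num)
  simpa using this

lemma norm_mul_cpow_div_le {q s : ℂ} {D x : ℝ} (hx : 0 < x) (hs : 1 / 2 ≤ s.re)
    (hD : 0 ≤ D) (hq : ‖q‖ ≤ D * (|s.im| + 3) ^ (1 / 2 : ℝ)) :
    ‖q * ((x : ℂ) ^ s / (s * (s + 1)))‖ ≤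
      49 * D * x ^ s.re * ((1 + |s.im|) ^ (-(1 / 4) : ℝ) * (1 + |s.im|) ^ (-(5 / 4) : ℝ)) := by
  set y := |s.im| + 3 with hy
  have ht := abs_nonneg s.im
  have hy0 : 0 < y := by positivity
  have h1 : y ≤ 7 * ‖s‖ := by
    have e1 := Complex.abs_im_le_norm s
    have e2 := (le_abs_self _).trans (Complex.abs_re_le_norm s)
    linarith
  have h2 : ‖s‖ ≤ ‖s + 1‖ := by
    refine (sq_le_sq₀ (norm_nonneg _) (norm_nonneg _)).1 ?_
    rw [← Complex.normSq_eq_norm_sq, ← Complex.normSq_eq_norm_sq, Complex.normSq_apply,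
      Complex.normSq_apply]
    simp only [Complex.add_re, Complex.one_re, Complex.add_im, Complex.one_im, add_zero]
    nlinarith
  have h3 : y ^ 2 / 49 ≤ ‖s * (s + 1)‖ := by
    rw [norm_mul]
    have : ‖s‖ * ‖s‖ ≤ ‖s‖ * ‖s + 1‖ := by gcongr
    nlinarith
  have h4 : 0 < y ^ 2 / 49 := by positivity
  rw [norm_mul, norm_div, Complex.norm_cpow_eq_rpow_re_of_pos hx, ← Real.rpow_add (by positivity)]
  have h5 : y ^ (1 / 2 : ℝ) / y ^ 2 ≤ (1 + |s.im|) ^ (-(1 / 4) + -(5 / 4) : ℝ) := by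
    have : y ^ (1 / 2 : ℝ) / y ^ 2 = y ^ (-(1 / 4) + -(5 / 4) : ℝ) := by
      rw [← Real.rpow_natCast, ← Real.rpow_sub hy0]; norm_num
    rw [this]
    exact Real.rpow_le_rpow_of_nonpos (by positivity) (by linarith) (by norm_num)
  calc ‖q‖ * (x ^ s.re / ‖s * (s + 1)‖) ≤ D * y ^ (1 / 2 : ℝ) * (x ^ s.re / (y ^ 2 / 49)) := by
        gcongr
    _ = 49 * D * x ^ s.re * (y ^ (1 / 2 : ℝ) / y ^ 2) := by field_simp
    _ ≤ _ := by gcongr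

lemma kernel_denominator_ne_zero {s : ℂ} (hs : 1 / 2 ≤ s.re) : s * (s + 1) ≠ 0 := by
  intro hz
  rcases mul_eq_zero.1 hz with hz | hz
  · rw [hz] at hs; norm_num at hs
  · have := congrArg Complex.re hz
    simp at this; linarith

lemma integrable_line_kernel {Q : ℝ → ℂ} {D σ x : ℝ} (hx : 0 < x) (hD : 0 ≤ D) (h0 : 1 / 2 ≤ σ)
    (hline : Continuous Q) (hbd : ∀ t : ℝ, ‖Q t‖ ≤ D * (|t| + 3) ^ (1 / 2 : ℝ)) :
    Integrable fun t : ℝ => Q t * ((x : ℂ) ^ (σ + t * Complex.I) /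
        ((σ + t * Complex.I) * (σ + t * Complex.I + 1))) := by
  refine Integrable.mono' (g := fun t : ℝ => 49 * D * x ^ σ * (1 + |t|) ^ (-(5 / 4) : ℝ))
    (integrable_kernel_majorant.const_mul _) ?_ ?_
  · refine Continuous.aestronglyMeasurable ?_
    refine hline.mul (Continuous.div ?_ (by fun_prop)
      fun t => kernel_denominator_ne_zero (by simp; linarith))
    refine Continuous.const_cpow (by fun_prop) (Or.inl (by exact_mod_cast hx.ne'))
  · refine Filter.Eventually.of_forall fun t => ?_
    have := norm_mul_cpow_div_le (s := σ + t * Complex.I) hx (by simp; linarith) hD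
      (by simpa using hbd t)
    refine this.trans ?_
    simp only [Complex.add_re, Complex.ofReal_re, Complex.mul_re, Complex.I_re, mul_zero,
      Complex.ofReal_im, Complex.I_im, mul_one, sub_self, add_zero, Complex.add_im,
      Complex.mul_im, zero_add]
    have e : (1 + |t|) ^ (-(1 / 4) : ℝ) ≤ 1 :=
      Real.rpow_le_one_of_one_le_of_nonpos (by linarith [abs_nonneg t]) (by norm_num)
    have e0 : (0:ℝ) ≤ (1 + |t|) ^ (-(5 / 4) : ℝ) := by positivity
    gcongr
    exact mul_le_of_le_one_left e0 e

/-- Shifting the truncated line integral of `Q s * x ^ s / (s * (s + 1))` to the left. -/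
lemma norm_integral_le_of_shift {Q : ℂ → ℂ} {D σ₀ σ T x : ℝ} (hx : 1 ≤ x) (hD : 0 ≤ D)
    (h0 : 1 / 2 ≤ σ₀) (h1 : σ₀ ≤ σ) (h2 : σ ≤ 2) (hT : 0 ≤ T)
    (hdiff : DifferentiableOn ℂ Q (Set.Icc σ₀ σ ×ℂ Set.Icc (-T) T))
    (hbd : ∀ s : ℂ, σ₀ ≤ s.re → s.re ≤ σ → |s.im| ≤ T → ‖Q s‖ ≤ D * (|s.im| + 3) ^ (1 / 2 : ℝ))
    (hline : Continuous fun t : ℝ => Q (σ + t * Complex.I))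
    (hbd' : ∀ t : ℝ, ‖Q (σ + t * Complex.I)‖ ≤ D * (|t| + 3) ^ (1 / 2 : ℝ)) :
    ‖∫ t : ℝ, Q (σ + t * Complex.I) * ((x : ℂ) ^ (σ + t * Complex.I) /
        ((σ + t * Complex.I) * (σ + t * Complex.I + 1)))‖ ≤
      49 * D * (((∫ t : ℝ, (1 + |t|) ^ (-(5 / 4) : ℝ)) + 4) * (x ^ σ * (1 + T) ^ (-(1 / 4) : ℝ)) +
        (∫ t : ℝ, (1 + |t|) ^ (-(5 / 4) : ℝ)) * x ^ σ₀) := by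
  have hx0 : 0 < x := by linarith
  set J := ∫ t : ℝ, (1 + |t|) ^ (-(5 / 4) : ℝ) with hJ
  set f : ℂ → ℂ := fun s => Q s * ((x : ℂ) ^ s / (s * (s + 1))) with hf
  have hne : ∀ s : ℂ, 1 / 2 ≤ s.re → s * (s + 1) ≠ 0 := fun s => kernel_denominator_ne_zero
  have hInt : Integrable (fun t : ℝ => f (σ + t * Complex.I)) :=
    integrable_line_kernel hx0 hD (h0.trans h1) hline hbd'
  have htail : ‖∫ t in (Set.Ioc (-T) T)ᶜ, f (σ + t * Complex.I)‖ ≤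
      49 * D * (x ^ σ * (1 + T) ^ (-(1 / 4) : ℝ)) * J := by
    have : ∀ t ∈ (Set.Ioc (-T) T)ᶜ, ‖f (σ + t * Complex.I)‖ ≤
        49 * D * (x ^ σ * (1 + T) ^ (-(1 / 4) : ℝ)) * (1 + |t|) ^ (-(5 / 4) : ℝ) := by
      intro t ht
      have hTt : T ≤ |t| := by
        by_contra hc
        push Not at hc
        rw [abs_lt] at hc
        exact ht ⟨hc.1, hc.2.le⟩
      have := norm_mul_cpow_div_le (s := σ + t * Complex.I) hx0 (by simp; linarith) hD
        (by simpa using hbd' t)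
      refine this.trans ?_
      simp only [Complex.add_re, Complex.ofReal_re, Complex.mul_re, Complex.I_re, mul_zero,
        Complex.ofReal_im, Complex.I_im, mul_one, sub_self, add_zero, Complex.add_im,
        Complex.mul_im, zero_add]
      have e : (1 + |t|) ^ (-(1 / 4) : ℝ) ≤ (1 + T) ^ (-(1 / 4) : ℝ) :=
        Real.rpow_le_rpow_of_nonpos (by linarith) (by linarith) (by norm_num)
      calc _ ≤ 49 * D * x ^ σ * ((1 + T) ^ (-(1 / 4) : ℝ) * (1 + |t|) ^ (-(5 / 4) : ℝ)) := by gcongr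
        _ = _ := by ring
    refine (norm_integral_le_of_norm_le (integrable_kernel_majorant.const_mul _).integrableOn
      (ae_restrict_of_forall_mem measurableSet_Ioc.compl this)).trans ?_
    rw [integral_const_mul]
    gcongr
    exact setIntegral_le_integral integrable_kernel_majorant
      (Filter.Eventually.of_forall fun t => by positivity)
  have hleft : ‖∫ t in (-T)..T, f (σ₀ + t * Complex.I)‖ ≤ 49 * D * x ^ σ₀ * J := by
    rw [intervalIntegral.integral_of_le (by linarith)]
    have : ∀ t ∈ Set.Ioc (-T) T, ‖f (σ₀ + t * Complex.I)‖ ≤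
        49 * D * x ^ σ₀ * (1 + |t|) ^ (-(5 / 4) : ℝ) := by
      intro t ht
      have htT : |t| ≤ T := abs_le.2 ⟨ht.1.le, ht.2⟩
      have := norm_mul_cpow_div_le (s := σ₀ + t * Complex.I) hx0 (by simp; linarith) hD
        (hbd _ (by simp) (by simpa using h1) (by simpa using htT))
      refine this.trans ?_
      simp only [Complex.add_re, Complex.ofReal_re, Complex.mul_re, Complex.I_re, mul_zero,
        Complex.ofReal_im, Complex.I_im, mul_one, sub_self, add_zero, Complex.add_im,
        Complex.mul_im, zero_add]
      have e : (1 + |t|) ^ (-(1 / 4) : ℝ) ≤ 1 :=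
        Real.rpow_le_one_of_one_le_of_nonpos (by linarith [abs_nonneg t]) (by norm_num)
      have e0 : (0:ℝ) ≤ (1 + |t|) ^ (-(5 / 4) : ℝ) := by positivity
      gcongr
      exact mul_le_of_le_one_left e0 e
    refine (norm_integral_le_of_norm_le (integrable_kernel_majorant.const_mul _).integrableOn
      (ae_restrict_of_forall_mem measurableSet_Ioc this)).trans ?_
    rw [integral_const_mul]
    gcongr
    exact setIntegral_le_integral integrable_kernel_majorant
      (Filter.Eventually.of_forall fun t => by positivity)
  have hhor : ∀ τ : ℝ, |τ| = T → ‖∫ u in σ₀..σ, f (u + τ * Complex.I)‖ ≤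
      49 * D * (x ^ σ * (1 + T) ^ (-(1 / 4) : ℝ)) * 2 := by
    intro τ hτ
    have : ∀ u ∈ Set.uIoc σ₀ σ, ‖f (u + τ * Complex.I)‖ ≤
        49 * D * (x ^ σ * (1 + T) ^ (-(1 / 4) : ℝ)) := by
      intro u hu
      rw [Set.uIoc_of_le h1] at hu
      have := norm_mul_cpow_div_le (s := u + τ * Complex.I) hx0 (by simp; linarith [hu.1]) hD
        (hbd _ (by simpa using hu.1.le) (by simpa using hu.2) (by simpa using hτ.le))
      refine this.trans ?_
      simp only [Complex.add_re, Complex.ofReal_re, Complex.mul_re, Complex.I_re, mul_zero,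
        Complex.ofReal_im, Complex.I_im, mul_one, sub_self, add_zero, Complex.add_im,
        Complex.mul_im, zero_add, hτ]
      have e : (1 + T) ^ (-(5 / 4) : ℝ) ≤ 1 :=
        Real.rpow_le_one_of_one_le_of_nonpos (by linarith) (by norm_num)
      have e0 : (0:ℝ) ≤ (1 + T) ^ (-(1 / 4) : ℝ) := by positivity
      have e1 : x ^ u ≤ x ^ σ := Real.rpow_le_rpow_of_exponent_le hx hu.2
      calc _ ≤ 49 * D * x ^ σ * ((1 + T) ^ (-(1 / 4) : ℝ) * 1) := by gcongr
        _ = _ := by ring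
    refine (intervalIntegral.norm_integral_le_of_norm_le_const this).trans ?_
    gcongr
    rw [abs_of_nonneg (by linarith)]; linarith
  have hrect := Complex.integral_boundary_rect_eq_zero_of_differentiableOn f
    (⟨σ₀, -T⟩ : ℂ) (⟨σ, T⟩ : ℂ) (by
      simp only
      rw [Set.uIcc_of_le h1, Set.uIcc_of_le (by linarith)]
      refine hdiff.mul (DifferentiableOn.div ?_ (by fun_prop) ?_)
      · refine Differentiable.differentiableOn ?_
        exact differentiable_id.const_cpow (Or.inl (by exact_mod_cast hx0.ne'))
      · intro s hs
        exact hne s (h0.trans hs.1.1))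
  simp only [smul_eq_mul] at hrect
  have hsplit : ∫ t : ℝ, f (σ + t * Complex.I) =
      (∫ t in (-T)..T, f (σ + t * Complex.I)) +
        ∫ t in (Set.Ioc (-T) T)ᶜ, f (σ + t * Complex.I) := by
    rw [intervalIntegral.integral_of_le (by linarith), integral_add_compl measurableSet_Ioc hInt]
  have hA := hhor (-T) (by rw [abs_neg, abs_of_nonneg hT])
  have hB := hhor T (abs_of_nonneg hT)
  set a1 := ∫ u in σ₀..σ, f (u + (-T : ℝ) * Complex.I)
  set a2 := ∫ u in σ₀..σ, f (u + T * Complex.I)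
  set a3 := ∫ t in (-T)..T, f (σ + t * Complex.I)
  set a4 := ∫ t in (-T)..T, f (σ₀ + t * Complex.I)
  have e3 : a3 = a4 + Complex.I * (a1 - a2) := by
    linear_combination (-Complex.I) * hrect + (a3 - a4) * Complex.I_mul_I
  have : ‖a3‖ ≤ ‖a4‖ + (‖a1‖ + ‖a2‖) := by
    rw [e3]
    refine (norm_add_le _ _).trans ?_
    gcongr
    rw [norm_mul, Complex.norm_I, one_mul]
    exact norm_sub_le _ _
  rw [hsplit]
  refine (norm_add_le _ _).trans ?_
  nlinarith

lemma hasMellin_max_one_sub {s : ℂ} (hs : 0 < s.re) :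
    HasMellin (fun t : ℝ => ((max (1 - t) 0 : ℝ) : ℂ)) s (1 / (s * (s + 1))) := by
  have h1 := hasMellin_cpow_Ioc 0 (s := s) (by simpa using hs)
  have h2 := hasMellin_cpow_Ioc 1 (s := s) (by simp; linarith)
  have h3 := hasMellin_sub h1.1 h2.1
  have e : Set.EqOn (fun t : ℝ => Set.indicator (Set.Ioc 0 1) (fun t : ℝ => (t : ℂ) ^ (0 : ℂ)) t -
      Set.indicator (Set.Ioc 0 1) (fun t : ℝ => (t : ℂ) ^ (1 : ℂ)) t)
      (fun t : ℝ => ((max (1 - t) 0 : ℝ) : ℂ)) (Set.Ioi 0) := by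
    intro t ht
    rw [Set.mem_Ioi] at ht
    simp only [Set.indicator_apply, Set.mem_Ioc, ht, true_and]
    split_ifs with h
    · rw [max_eq_left (by linarith)]; simp
    · rw [max_eq_right (by linarith)]; simp
  have hs0 : s ≠ 0 := by rintro rfl; simp at hs
  have hs1 : s + 1 ≠ 0 := by
    intro hz
    have := congrArg Complex.re hz
    simp at this; linarith
  refine ⟨h3.1.congr_fun ?_ measurableSet_Ioi, ?_⟩
  · intro t ht
    simp only [e ht]
  · rw [h1.2, h2.2] at h3
    have := h3.2
    rw [mellin, setIntegral_congr_fun (g := fun t : ℝ => (t : ℂ) ^ (s - 1) •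
      ((max (1 - t) 0 : ℝ) : ℂ)) measurableSet_Ioi (fun t ht => by simp only [e ht])] at this
    rw [mellin, this, add_zero]
    field_simp
    ring

lemma hasMellin_max_one_sub_sq {s : ℂ} (hs : 1 < s.re) :
    HasMellin (fun t : ℝ => (((max (1 - t) 0) ^ 2 / (2 * t) : ℝ) : ℂ)) s
      (1 / (s - 1) * (1 / (s * (s + 1)))) := by
  have h0 := hasMellin_cpow_Ioc (-1) (s := s) (by simp; linarith)
  have h1 := hasMellin_cpow_Ioc 0 (s := s) (by simp; linarith)
  have h2 := hasMellin_cpow_Ioc 1 (s := s) (by simp; linarith)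
  have h4 := hasMellin_add h0.1 h2.1
  have h5 : HasMellin _ _ _ := ⟨h4.1.const_smul (1 / 2 : ℂ), rfl⟩
  have h3 := hasMellin_sub h5.1 h1.1
  rw [mellin_const_smul, h4.2, h0.2, h1.2, h2.2] at h3
  have e : ∀ t ∈ Set.Ioi (0 : ℝ), ((1 / 2 : ℂ) • (Set.indicator (Set.Ioc 0 1)
      (fun t : ℝ => (t : ℂ) ^ (-1 : ℂ)) t + Set.indicator (Set.Ioc 0 1)
      (fun t : ℝ => (t : ℂ) ^ (1 : ℂ)) t)) -
      Set.indicator (Set.Ioc 0 1) (fun t : ℝ => (t : ℂ) ^ (0 : ℂ)) t =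
      (((max (1 - t) 0) ^ 2 / (2 * t) : ℝ) : ℂ) := by
    intro t ht
    rw [Set.mem_Ioi] at ht
    have htc : (t : ℂ) ≠ 0 := by exact_mod_cast ht.ne'
    simp only [Set.indicator_apply, Set.mem_Ioc, ht, true_and]
    split_ifs with h
    · rw [max_eq_left (by linarith), Complex.cpow_neg_one]; simp; field_simp; ring
    · rw [max_eq_right (by linarith)]; simp
  have hs0 : s ≠ 0 := by rintro rfl; simp at hs; linarith
  have hs1 : s + 1 ≠ 0 := by
    intro hz
    have := congrArg Complex.re hz
    simp at this; linarith
  have hs2 : s - 1 ≠ 0 := by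
    intro hz
    have := congrArg Complex.re hz
    simp at this; linarith
  refine ⟨h3.1.congr_fun ?_ measurableSet_Ioi, ?_⟩
  · intro t ht
    simp only [e t ht]
  · have := h3.2
    rw [mellin, setIntegral_congr_fun (g := fun t : ℝ => (t : ℂ) ^ (s - 1) •
      (((max (1 - t) 0) ^ 2 / (2 * t) : ℝ) : ℂ)) measurableSet_Ioi
      (fun t ht => by simp only [e t ht])] at this
    rw [mellin, this, ← sub_eq_add_neg, smul_eq_mul, add_zero]
    field_simp
    ring

lemma max_one_sub_eq_integral {σ y : ℝ} (hσ : 1 / 2 ≤ σ) (hy : 0 < y) :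
    ((max (1 - 1 / y) 0 : ℝ) : ℂ) = 1 / (2 * π) * ∫ t : ℝ,
      (y : ℂ) ^ (σ + t * Complex.I) / ((σ + t * Complex.I) * (σ + t * Complex.I + 1)) := by
  have hm : ∀ t : ℝ, mellin (fun t : ℝ => ((max (1 - t) 0 : ℝ) : ℂ)) (σ + t * Complex.I) =
      1 / ((σ + t * Complex.I) * (σ + t * Complex.I + 1)) := fun t =>
    (hasMellin_max_one_sub (by simp; linarith)).2
  have h := mellinInv_mellin_eq σ (fun t : ℝ => ((max (1 - t) 0 : ℝ) : ℂ)) (x := 1 / y)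
    (by positivity) (hasMellin_max_one_sub (by simp; linarith)).1 ?_ (by fun_prop)
  · rw [← h, mellinInv]
    simp only [hm, smul_eq_mul]
    rw [Complex.real_smul]
    congr 1
    · push_cast; rfl
    · refine integral_congr_ae (Filter.Eventually.of_forall fun t => ?_)
      simp only
      rw [mul_one_div, Complex.ofReal_div, Complex.ofReal_one, one_div, Complex.inv_cpow,
        Complex.cpow_neg, inv_inv]
      rw [Complex.arg_ofReal_of_nonneg hy.le]; exact Real.pi_pos.ne
  · have := integrable_line_kernel (Q := fun _ => 1) (D := 1) (σ := σ) (x := 1) one_pos zero_le_one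
      hσ continuous_const (fun t => by
        rw [norm_one, one_mul]
        exact Real.one_le_rpow (by linarith [abs_nonneg t]) (by norm_num))
    rw [Complex.VerticalIntegrable]
    refine this.congr (Filter.Eventually.of_forall fun t => ?_)
    simp only [hm, Complex.ofReal_one, Complex.one_cpow, one_mul]

lemma integrable_line_pole {σ x : ℝ} (hx : 0 < x) (hσ : 1 < σ) :
    Integrable fun t : ℝ => 1 / (σ + t * Complex.I - 1) * ((x : ℂ) ^ (σ + t * Complex.I) /
        ((σ + t * Complex.I) * (σ + t * Complex.I + 1))) := by
  have h3 : 0 < σ - 1 := by linarith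
  refine integrable_line_kernel (D := 1 / (σ - 1)) hx (by positivity) (by linarith)
    (continuous_const.div (by fun_prop) fun t hz => ?_) fun t => ?_
  · have := congrArg Complex.re hz
    simp at this; linarith
  · have h1 : (1 : ℝ) ≤ (|t| + 3) ^ (1 / 2 : ℝ) :=
      Real.one_le_rpow (by linarith [abs_nonneg t]) (by norm_num)
    have h2 : σ - 1 ≤ ‖(σ + t * Complex.I - 1 : ℂ)‖ := by
      refine le_trans ?_ ((le_abs_self _).trans (Complex.abs_re_le_norm _))
      simp
    rw [norm_div, norm_one]
    calc 1 / ‖(σ + t * Complex.I - 1 : ℂ)‖ ≤ 1 / (σ - 1) * 1 := by rw [mul_one]; gcongr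
      _ ≤ _ := by gcongr

lemma max_one_sub_sq_eq_integral {σ y : ℝ} (hσ : 1 < σ) (hy : 0 < y) :
    (((max (1 - 1 / y) 0) ^ 2 / (2 * (1 / y)) : ℝ) : ℂ) = 1 / (2 * π) * ∫ t : ℝ,
      1 / (σ + t * Complex.I - 1) *
      ((y : ℂ) ^ (σ + t * Complex.I) / ((σ + t * Complex.I) * (σ + t * Complex.I + 1))) := by
  have hm : ∀ t : ℝ, mellin (fun t : ℝ => (((max (1 - t) 0) ^ 2 / (2 * t) : ℝ) : ℂ))
      (σ + t * Complex.I) = 1 / (σ + t * Complex.I - 1) *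
        (1 / ((σ + t * Complex.I) * (σ + t * Complex.I + 1))) := fun t =>
    (hasMellin_max_one_sub_sq (by simp; linarith)).2
  have h := mellinInv_mellin_eq σ (fun t : ℝ => (((max (1 - t) 0) ^ 2 / (2 * t) : ℝ) : ℂ))
    (x := 1 / y) (by positivity) (hasMellin_max_one_sub_sq (by simp; linarith)).1 ?_ ?_
  · rw [← h, mellinInv]
    simp only [hm, smul_eq_mul]
    rw [Complex.real_smul]
    congr 1
    · push_cast; rfl
    · refine integral_congr_ae (Filter.Eventually.of_forall fun t => ?_)
      simp only
      rw [Complex.ofReal_div, Complex.ofReal_one, one_div (y : ℂ), Complex.inv_cpow,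
        Complex.cpow_neg, inv_inv]
      · ring
      rw [Complex.arg_ofReal_of_nonneg hy.le]; exact Real.pi_pos.ne
  · have := integrable_line_pole (x := 1) one_pos hσ
    rw [Complex.VerticalIntegrable]
    refine this.congr (Filter.Eventually.of_forall fun t => ?_)
    simp only [hm, Complex.ofReal_one, Complex.one_cpow]
  · refine ContinuousAt.comp Complex.continuous_ofReal.continuousAt ?_
    exact ContinuousAt.div (by fun_prop) (by fun_prop) (by positivity)

namespace DensityData

variable {a l : ℕ → ℝ} {κ C δ : ℝ}

lemma l_zero (h : DensityData a l κ C δ) : l 0 = 0 := by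
  have h1 := h.log_le 0
  simp only [ArithmeticFunction.map_zero, mul_zero] at h1
  exact le_antisymm h1 (h.log_nonneg 0)

lemma sum_smoothed_eq_integral (h : DensityData a l κ C δ) {x σ : ℝ} (hx : 1 ≤ x) (hσ : 1 < σ) :
    ((∑ n ∈ Finset.Icc 1 ⌊x⌋₊, l n * (1 - n / x) : ℝ) : ℂ) = 1 / (2 * π) * ∫ t : ℝ,
      LSeries (fun n => (l n : ℂ)) (σ + t * Complex.I) *
      ((x : ℂ) ^ (σ + t * Complex.I) / ((σ + t * Complex.I) * (σ + t * Complex.I + 1))) := by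
  have hx0 : 0 < x := by linarith
  set f : ℕ → ℂ := fun n => (l n : ℂ) with hf
  set k : ℝ → ℂ := fun t => (x : ℂ) ^ (σ + t * Complex.I) /
    ((σ + t * Complex.I) * (σ + t * Complex.I + 1)) with hk
  have hone : ∀ t : ℝ, (1 : ℝ) ≤ (|t| + 3) ^ (1 / 2 : ℝ) := fun t =>
    Real.one_le_rpow (by linarith [abs_nonneg t]) (by norm_num)
  have hterm : ∀ n, ∀ t : ℝ, ‖LSeries.term f (σ + t * Complex.I) n‖ = ‖LSeries.term f σ n‖ := by
    intro n t
    rw [LSeries.norm_term_eq, LSeries.norm_term_eq]; simp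
  have hcont : ∀ n, Continuous fun t : ℝ => LSeries.term f (σ + t * Complex.I) n := by
    intro n
    rcases eq_or_ne n 0 with rfl | hn
    · simp only [LSeries.term_zero]; exact continuous_const
    · simp only [LSeries.term_of_ne_zero hn]
      have hn' : (n : ℂ) ≠ 0 := by exact_mod_cast hn
      refine continuous_const.div (Continuous.const_cpow (by fun_prop) (Or.inl hn')) fun t => ?_
      rw [Complex.cpow_ne_zero_iff_of_exponent_ne_zero]
      · exact hn'
      · intro hz
        have := congrArg Complex.re hz
        simp at this; linarith
  have hInt : ∀ n, Integrable fun t : ℝ => LSeries.term f (σ + t * Complex.I) n * k t := by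
    intro n
    refine integrable_line_kernel (D := ‖LSeries.term f σ n‖) hx0 (norm_nonneg _) (by linarith)
      (hcont n) fun t => ?_
    rw [hterm]
    exact le_mul_of_one_le_right (norm_nonneg _) (hone t)
  have hsum : Summable fun n => ∫ t : ℝ, ‖LSeries.term f (σ + t * Complex.I) n * k t‖ := by
    simp only [norm_mul, hterm, integral_const_mul]
    exact (h.summable_l (s := σ) (by simpa using hσ)).norm.mul_right _
  have hS := hasSum_integral_of_summable_integral_norm hInt hsum
  have hval : ∀ n, 1 / (2 * π) * ∫ t : ℝ, LSeries.term f (σ + t * Complex.I) n * k t =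
      ((l n * max (1 - n / x) 0 : ℝ) : ℂ) := by
    intro n
    rcases Nat.eq_zero_or_pos n with rfl | hn
    · simp [h.l_zero]
    · have hn' : (0 : ℝ) < n := by exact_mod_cast hn
      have e := max_one_sub_eq_integral (σ := σ) (y := x / n) (by linarith) (by positivity)
      rw [one_div_div] at e
      rw [Complex.ofReal_mul, e, ← mul_assoc, mul_comm (l n : ℂ), mul_assoc]
      congr 1
      rw [← integral_const_mul]
      refine integral_congr_ae (Filter.Eventually.of_forall fun t => ?_)
      simp only [LSeries.term_of_ne_zero hn.ne', hk, hf]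
      rw [Complex.ofReal_div, Complex.div_cpow_ofReal_nonneg hx0.le hn'.le]
      simp only [Complex.ofReal_natCast]
      ring
  have hS2 := hS.mul_left (1 / (2 * π : ℂ))
  simp only [hval] at hS2
  have e2 : ∀ t : ℝ, ∑' n, LSeries.term f (σ + t * Complex.I) n * k t =
      LSeries f (σ + t * Complex.I) * k t := fun t => by
    rw [tsum_mul_right]; rfl
  simp only [e2] at hS2
  rw [← hS2.tsum_eq, tsum_eq_sum (s := Finset.Icc 1 ⌊x⌋₊)]
  · push_cast
    refine Finset.sum_congr rfl fun n hn => ?_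
    have hn1 := Finset.mem_Icc.1 hn
    have hnx : (n : ℝ) ≤ x := (Nat.le_floor_iff hx0.le).1 hn1.2
    have : (n : ℝ) / x ≤ 1 := (div_le_one hx0).2 hnx
    rw [max_eq_left (by linarith)]
    push_cast; rfl
  · intro n hn
    rcases Nat.eq_zero_or_pos n with rfl | hn0
    · simp [h.l_zero]
    · have : x ≤ n := by
        by_contra hc
        push Not at hc
        exact hn (Finset.mem_Icc.2 ⟨hn0, Nat.le_floor hc.le⟩)
      have : 1 ≤ (n : ℝ) / x := (one_le_div hx0).2 this
      rw [max_eq_right (by linarith)]; simp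

/-- The smoothed explicit formula. -/
lemma sum_smoothed_sub_eq (h : DensityData a l κ C δ) {x σ : ℝ} (hx : 1 ≤ x) (hσ : 1 < σ)
    (hInt : Integrable fun t : ℝ =>
      (LSeries (fun n => (l n : ℂ)) (σ + t * Complex.I) - 1 / (σ + t * Complex.I - 1)) *
      ((x : ℂ) ^ (σ + t * Complex.I) / ((σ + t * Complex.I) * (σ + t * Complex.I + 1)))) :
    ((∑ n ∈ Finset.Icc 1 ⌊x⌋₊, l n * (1 - n / x) - (x - 1) ^ 2 / (2 * x) : ℝ) : ℂ) =
      1 / (2 * π) * ∫ t : ℝ,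
      (LSeries (fun n => (l n : ℂ)) (σ + t * Complex.I) - 1 / (σ + t * Complex.I - 1)) *
      ((x : ℂ) ^ (σ + t * Complex.I) / ((σ + t * Complex.I) * (σ + t * Complex.I + 1))) := by
  have hx0 : 0 < x := by linarith
  have e2 := max_one_sub_sq_eq_integral hσ hx0
  have e3 : (max (1 - 1 / x) 0) ^ 2 / (2 * (1 / x)) = (x - 1) ^ 2 / (2 * x) := by
    rw [max_eq_left (by rw [sub_nonneg, div_le_one hx0]; exact hx)]
    field_simp
  rw [e3] at e2
  rw [Complex.ofReal_sub, h.sum_smoothed_eq_integral hx hσ, e2, sub_eq_iff_eq_add, ← mul_add,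
    ← integral_add hInt (integrable_line_pole hx0 hσ)]
  simp only [sub_mul, sub_add_cancel]

end DensityData

lemma log_exp_add_three_le {u : ℝ} (hu : 1 ≤ u) : Real.log (Real.exp u + 3) ≤ 3 * u := by
  rw [Real.log_le_iff_le_exp (by positivity), show 3 * u = u + u + u by ring, Real.exp_add,
    Real.exp_add]
  have h1 : 2 ≤ Real.exp u := by linarith [Real.add_one_le_exp u]
  nlinarith [mul_le_mul h1 h1 (by norm_num) (by linarith)]

namespace DensityData

variable {a l : ℕ → ℝ} {κ C δ : ℝ}

lemma exists_smoothed_bound (h : DensityData a l κ C δ) : ∃ c K : ℝ, 0 < c ∧ 0 < K ∧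
    ∀ x : ℝ, 3 ≤ x → |∑ n ∈ Finset.Icc 1 ⌊x⌋₊, l n * (1 - n / x) - (x - 1) ^ 2 / (2 * x)| ≤
      K * x * Real.exp (-c * Real.sqrt (Real.log x)) := by
  obtain ⟨C', c', hz⟩ := h.exists_zeroFreeData
  obtain ⟨b, D, hb, hbr, hD, hbd⟩ := hz.exists_logDeriv_bound
  have hδ1 := h.δ_lt
  set G := cont a κ with hG
  set Q : ℂ → ℂ := fun s => -(deriv G s / G s) with hQ
  set J := ∫ t : ℝ, (1 + |t|) ^ (-(5 / 4) : ℝ) with hJ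
  have hJ0 : 0 ≤ J := integral_nonneg fun t => by positivity
  have hQd : ∀ s : ℂ, 1 - b / Real.log (|s.im| + 3) ≤ s.re → s.re ≤ 2 →
      DifferentiableAt ℂ Q s := by
    intro s h1 h2
    have hs : 1 - 2 * (δ / 4) < s.re := by
      have : b / Real.log (|s.im| + 3) ≤ b := div_le_self hb.le (one_le_log_abs_add_three _)
      have := h.δ_pos
      linarith
    have hU : {s : ℂ | 1 - 2 * (δ / 4) < s.re} ∈ nhds s :=
      (isOpen_lt continuous_const Complex.continuous_re).mem_nhds hs
    have hd := (hz.diff.analyticAt hU)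
    exact (hd.deriv.differentiableAt.div hd.differentiableAt (hbd s h1 h2).1).neg
  have hQeq : ∀ s : ℂ, 1 < s.re → LSeries (fun n => (l n : ℂ)) s - 1 / (s - 1) = Q s := by
    intro s hs
    simp only [hQ]
    rw [hz.logDeriv s hs]; ring
  refine ⟨min (1 / 4) (b / 3), 49 * D * ((J + 4) * Real.exp 1 + J) + 1,
    lt_min (by norm_num) (by positivity), by positivity, fun x hx => ?_⟩
  set c := min (1 / 4) (b / 3) with hc
  have hx0 : 0 < x := by linarith
  have hL : 1 ≤ Real.log x := by
    rw [Real.le_log_iff_exp_le hx0]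
    linarith [Real.exp_one_lt_d9]
  set u := Real.sqrt (Real.log x) with hu
  have hu1 : 1 ≤ u := Real.one_le_sqrt.2 hL
  have huu : u * u = Real.log x := Real.mul_self_sqrt (by linarith)
  set T := Real.exp u with hT
  have hT0 : 0 < T := Real.exp_pos u
  set σ := 1 + 1 / Real.log x with hσ
  set σ₀ := 1 - b / Real.log (T + 3) with hσ0
  have hσ1 : 1 < σ := by rw [hσ]; linarith [show 0 < 1 / Real.log x by positivity]
  have hσ2 : σ ≤ 2 := by
    have : 1 / Real.log x ≤ 1 := by rw [div_le_one (by linarith)]; exact hL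
    linarith
  have hLT : 1 ≤ Real.log (T + 3) := by
    have := one_le_log_abs_add_three T
    rwa [abs_of_pos hT0] at this
  have hσ01 : σ₀ ≤ 1 := by rw [hσ0]; linarith [show 0 ≤ b / Real.log (T + 3) by positivity]
  have hσ0h : 1 / 2 ≤ σ₀ := by
    have : b / Real.log (T + 3) ≤ b := div_le_self hb.le hLT
    linarith
  have hreg : ∀ s : ℂ, σ₀ ≤ s.re → |s.im| ≤ T → 1 - b / Real.log (|s.im| + 3) ≤ s.re := by
    intro s h1 h2
    refine le_trans ?_ h1
    have := one_le_log_abs_add_three s.im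
    rw [hσ0]
    gcongr
  have hreg1 : ∀ t : ℝ, 1 - b / Real.log (|((σ : ℂ) + t * Complex.I).im| + 3) ≤
      ((σ : ℂ) + t * Complex.I).re := by
    intro t
    have := one_le_log_abs_add_three ((σ : ℂ) + t * Complex.I).im
    have : 0 ≤ b / Real.log (|((σ : ℂ) + t * Complex.I).im| + 3) := by positivity
    simp at this ⊢
    linarith
  have hre : ∀ t : ℝ, ((σ : ℂ) + t * Complex.I).re = σ := fun t => by simp
  have him : ∀ t : ℝ, ((σ : ℂ) + t * Complex.I).im = t := fun t => by simp
  have hline : Continuous fun t : ℝ => Q (σ + t * Complex.I) := by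
    rw [continuous_iff_continuousAt]
    intro t
    exact ContinuousAt.comp (f := fun t : ℝ => (σ : ℂ) + t * Complex.I)
      (hQd _ (hreg1 t) (by rw [hre]; exact hσ2)).continuousAt (by fun_prop)
  have hbl : ∀ t : ℝ, ‖Q (σ + t * Complex.I)‖ ≤ D * (|t| + 3) ^ (1 / 2 : ℝ) := by
    intro t
    have := (hbd _ (hreg1 t) (by rw [hre]; exact hσ2)).2
    rw [him] at this
    simpa only [hQ, norm_neg] using this
  have hQline : ∀ t : ℝ, LSeries (fun n => (l n : ℂ)) (σ + t * Complex.I) -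
      1 / (σ + t * Complex.I - 1) = Q (σ + t * Complex.I) := fun t =>
    hQeq _ (by rw [hre]; exact hσ1)
  have hInt := integrable_line_kernel hx0 hD.le (by linarith : 1 / 2 ≤ σ) hline hbl
  have hformula := h.sum_smoothed_sub_eq (by linarith : 1 ≤ x) hσ1
    (by simp only [hQline]; exact hInt)
  simp only [hQline] at hformula
  have hshift := norm_integral_le_of_shift (Q := Q) (by linarith : 1 ≤ x) hD.le hσ0h
    (hσ01.trans hσ1.le) hσ2 hT0.le
    (fun s hs => (hQd s (hreg s hs.1.1 (abs_le.2 hs.2)) (hs.1.2.trans hσ2)).differentiableWithinAt)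
    (fun s h1 h2 h3 => by
      have := (hbd s (hreg s h1 h3) (h2.trans hσ2)).2
      simpa only [hQ, norm_neg] using this) hline hbl
  rw [← Real.norm_eq_abs, ← Complex.norm_real]
  rw [hformula, norm_mul]
  have hpi : ‖(1 / (2 * π) : ℂ)‖ ≤ 1 := by
    rw [norm_div, norm_one, norm_mul, Complex.norm_real, Real.norm_eq_abs, abs_of_pos Real.pi_pos]
    rw [div_le_one (by simp [Real.pi_pos])]
    have := Real.pi_gt_three
    norm_num; linarith
  have hxσ : x ^ σ = Real.exp 1 * x := by
    rw [hσ, Real.rpow_add hx0, Real.rpow_one, Real.rpow_def_of_pos hx0, mul_one_div_cancel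
      (by linarith)]
    ring
  have hcu : 0 ≤ u := by linarith
  have hTp : (1 + T) ^ (-(1 / 4) : ℝ) ≤ Real.exp (-c * u) := by
    calc (1 + T) ^ (-(1 / 4) : ℝ) ≤ T ^ (-(1 / 4) : ℝ) :=
          Real.rpow_le_rpow_of_nonpos hT0 (by linarith) (by norm_num)
      _ = Real.exp (-(1 / 4) * u) := by rw [hT, ← Real.exp_mul, mul_comm]
      _ ≤ _ := by
          apply Real.exp_le_exp.2
          have : c ≤ 1 / 4 := min_le_left _ _
          nlinarith
  have hxσ0 : x ^ σ₀ ≤ x * Real.exp (-c * u) := by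
    rw [hσ0, sub_eq_add_neg, Real.rpow_add hx0, Real.rpow_one, Real.rpow_def_of_pos hx0]
    refine mul_le_mul_of_nonneg_left (Real.exp_le_exp.2 ?_) hx0.le
    have h1 : Real.log (T + 3) ≤ 3 * u := log_exp_add_three_le hu1
    have h2 : b / (3 * u) ≤ b / Real.log (T + 3) := by gcongr
    have h3 : c ≤ b / 3 := min_le_right _ _
    calc Real.log x * -(b / Real.log (T + 3)) ≤ Real.log x * -(b / (3 * u)) := by gcongr
      _ = -(b / 3) * u := by rw [← huu]; field_simp
      _ ≤ _ := by nlinarith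
  set E := Real.exp (-c * u) with hE
  have hE0 : 0 < E := Real.exp_pos _
  calc _ ≤ 1 * (49 * D * ((J + 4) * (x ^ σ * (1 + T) ^ (-(1 / 4) : ℝ)) + J * x ^ σ₀)) := by gcongr
    _ ≤ 1 * (49 * D * ((J + 4) * (Real.exp 1 * x * E) + J * (x * E))) := by rw [hxσ]; gcongr
    _ = (49 * D * ((J + 4) * Real.exp 1 + J)) * x * E := by ring
    _ ≤ _ := by gcongr; linarith

end DensityData

lemma sum_mul_sub_eq_sum_max {l : ℕ → ℝ} {y z : ℝ} (hy : 0 ≤ y) (hyz : y ≤ z) :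
    ∑ n ∈ Finset.Icc 1 ⌊y⌋₊, l n * (y - n) = ∑ n ∈ Finset.Icc 1 ⌊z⌋₊, l n * max (y - n) 0 := by
  refine Finset.sum_congr_of_eq_on_inter ?_ ?_ ?_
  · intro n hn hn'
    have h1 := Finset.mem_Icc.1 hn
    exact absurd (Finset.mem_Icc.2 ⟨h1.1, h1.2.trans (Nat.floor_le_floor hyz)⟩) hn'
  · intro n hn hn'
    have h1 := Finset.mem_Icc.1 hn
    have : y ≤ n := by
      by_contra hc
      push Not at hc
      exact hn' (Finset.mem_Icc.2 ⟨h1.1, Nat.le_floor hc.le⟩)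
    rw [max_eq_right (by linarith), mul_zero]
  · intro n hn _
    have h1 := (Nat.le_floor_iff hy).1 (Finset.mem_Icc.1 hn).2
    rw [max_eq_left (by linarith)]

lemma mul_sum_le_sub_of_nonneg {l : ℕ → ℝ} (hl : ∀ n, 0 ≤ l n) {x h : ℝ} (hx : 0 ≤ x)
    (hh : 0 ≤ h) : h * ∑ n ∈ Finset.Icc 1 ⌊x⌋₊, l n ≤
      ∑ n ∈ Finset.Icc 1 ⌊x + h⌋₊, l n * (x + h - n) - ∑ n ∈ Finset.Icc 1 ⌊x⌋₊, l n * (x - n) := by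
  rw [le_sub_iff_add_le, Finset.mul_sum, ← Finset.sum_add_distrib]
  rw [sum_mul_sub_eq_sum_max (y := x + h) (z := x + h) (by linarith) le_rfl]
  calc _ = ∑ n ∈ Finset.Icc 1 ⌊x⌋₊, l n * max (x + h - n) 0 := by
        refine Finset.sum_congr rfl fun n hn => ?_
        have h1 := (Nat.le_floor_iff hx).1 (Finset.mem_Icc.1 hn).2
        rw [max_eq_left (by linarith)]; ring
    _ ≤ _ := by
        refine Finset.sum_le_sum_of_subset_of_nonneg ?_ fun n _ _ =>
          mul_nonneg (hl n) (le_max_right _ _)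
        exact Finset.Icc_subset_Icc le_rfl (Nat.floor_le_floor (by linarith))

lemma sub_le_mul_sum_of_nonneg {l : ℕ → ℝ} (hl : ∀ n, 0 ≤ l n) {x h : ℝ} (hh : 0 ≤ h)
    (hx : h ≤ x) : ∑ n ∈ Finset.Icc 1 ⌊x⌋₊, l n * (x - n) -
      ∑ n ∈ Finset.Icc 1 ⌊x - h⌋₊, l n * (x - h - n) ≤ h * ∑ n ∈ Finset.Icc 1 ⌊x⌋₊, l n := by
  rw [sub_le_iff_le_add, Finset.mul_sum,
    sum_mul_sub_eq_sum_max (y := x - h) (z := x) (by linarith) (by linarith),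
    ← Finset.sum_add_distrib]
  refine Finset.sum_le_sum fun n hn => ?_
  have h1 := hl n
  have h2 : x - n ≤ h + max (x - h - n) 0 := by linarith [le_max_left (x - h - n) 0]
  nlinarith [mul_le_mul_of_nonneg_left h2 h1]

lemma exp_sqrt_log_half_le {c x : ℝ} (hc : 0 ≤ c) (hx : 3 ≤ x) :
    Real.exp (-c * Real.sqrt (Real.log (x / 2))) ≤
      Real.exp c * Real.exp (-c * Real.sqrt (Real.log x)) := by
  rw [← Real.exp_add, Real.exp_le_exp]
  have hL : 1 ≤ Real.log x := by
    rw [Real.le_log_iff_exp_le (by linarith)]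
    linarith [Real.exp_one_lt_d9]
  have h1 : 1 ≤ Real.sqrt (Real.log x) := Real.one_le_sqrt.2 hL
  have h2 : Real.sqrt (Real.log x) - 1 ≤ Real.sqrt (Real.log (x / 2)) := by
    apply Real.le_sqrt_of_sq_le
    rw [Real.log_div (by linarith) (by norm_num)]
    have := Real.sq_sqrt (by linarith : 0 ≤ Real.log x)
    have := Real.log_two_lt_d9
    nlinarith
  nlinarith

lemma exp_sqrt_log_anti {c x y : ℝ} (hc : 0 ≤ c) (hx : 0 < x) (hxy : x ≤ y) :
    Real.exp (-c * Real.sqrt (Real.log y)) ≤ Real.exp (-c * Real.sqrt (Real.log x)) := by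
  rw [Real.exp_le_exp]
  have : Real.sqrt (Real.log x) ≤ Real.sqrt (Real.log y) :=
    Real.sqrt_le_sqrt (Real.log_le_log hx hxy)
  nlinarith

lemma desmooth_algebra {ψ x η s₀ s₁ s₂ W V : ℝ} (hη : 0 < η) (hW : W = η * V)
    (up : η * ψ ≤ s₁ - s₀) (lo : s₀ - s₂ ≤ η * ψ) (b₀ : |s₀ - (x - 1) ^ 2 / 2| ≤ W)
    (b₁ : |s₁ - (x + η - 1) ^ 2 / 2| ≤ 4 * W) (b₂ : |s₂ - (x - η - 1) ^ 2 / 2| ≤ W) :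
    ψ ≤ (x - 1) + η / 2 + 5 * V ∧ (x - 1) - η / 2 - 2 * V ≤ ψ := by
  rw [abs_le] at b₀ b₁ b₂
  constructor
  · refine le_of_mul_le_mul_left ?_ hη
    have : (x + η - 1) ^ 2 / 2 - (x - 1) ^ 2 / 2 = η * ((x - 1) + η / 2) := by ring
    rw [mul_add]
    linarith
  · refine le_of_mul_le_mul_left ?_ hη
    have : (x - 1) ^ 2 / 2 - (x - η - 1) ^ 2 / 2 = η * ((x - 1) - η / 2) := by ring
    rw [mul_sub]
    linarith

/-- Removing the smoothing weight by monotonicity. -/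
lemma exists_bound_of_smoothed {l : ℕ → ℝ} (hl : ∀ n, 0 ≤ l n) {c K : ℝ} (hc : 0 < c) (hK : 0 < K)
    (h : ∀ x : ℝ, 3 ≤ x → |∑ n ∈ Finset.Icc 1 ⌊x⌋₊, l n * (1 - n / x) - (x - 1) ^ 2 / (2 * x)| ≤
      K * x * Real.exp (-c * Real.sqrt (Real.log x))) :
    ∃ c' K' : ℝ, 0 < c' ∧ 0 < K' ∧ ∀ x : ℝ, 2 ≤ x →
      |∑ n ∈ Finset.Icc 1 ⌊x⌋₊, l n - x| ≤ K' * x * Real.exp (-c' * Real.sqrt (Real.log x)) := by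
  set S : ℝ → ℝ := fun x => ∑ n ∈ Finset.Icc 1 ⌊x⌋₊, l n * (x - n) with hS
  set E : ℝ → ℝ := fun x => Real.exp (-c * Real.sqrt (Real.log x)) with hE
  set e : ℝ → ℝ := fun x => Real.exp (-(min (c / 2) 1) * Real.sqrt (Real.log x)) with he
  have hSb : ∀ x, 3 ≤ x → |S x - (x - 1) ^ 2 / 2| ≤ K * x ^ 2 * E x := by
    intro x hx
    have hx0 : 0 < x := by linarith
    have h1 : S x - (x - 1) ^ 2 / 2 =
        x * (∑ n ∈ Finset.Icc 1 ⌊x⌋₊, l n * (1 - n / x) - (x - 1) ^ 2 / (2 * x)) := by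
      rw [mul_sub, Finset.mul_sum]
      congr 1
      · refine Finset.sum_congr rfl fun n _ => ?_
        field_simp
      · field_simp
    rw [h1, abs_mul, abs_of_pos hx0]
    calc _ ≤ x * (K * x * E x) := by gcongr; exact h x hx
      _ = _ := by ring
  set M := ∑ n ∈ Finset.Icc 1 ⌊(6 : ℝ)⌋₊, l n with hM
  have hM0 : 0 ≤ M := Finset.sum_nonneg fun n _ => hl n
  have hepos : ∀ x, 0 < e x := fun x => Real.exp_pos _
  have hEpos : ∀ x, 0 < E x := fun x => Real.exp_pos _
  have hc' : 0 < min (c / 2) 1 := lt_min (by linarith) one_pos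
  refine ⟨min (c / 2) 1, (M + 6) / e 6 + (2 + 12 * K * Real.exp c), hc', by have := hepos 6; positivity,
    fun x hx => ?_⟩
  have hx0 : 0 < x := by linarith
  change _ ≤ _ * x * e x
  rcases le_total x 6 with h6 | h6
  · have h1 : ∑ n ∈ Finset.Icc 1 ⌊x⌋₊, l n ≤ M := Finset.sum_le_sum_of_subset_of_nonneg
      (Finset.Icc_subset_Icc le_rfl (Nat.floor_le_floor h6)) fun n _ _ => hl n
    have h0 : 0 ≤ ∑ n ∈ Finset.Icc 1 ⌊x⌋₊, l n := Finset.sum_nonneg fun n _ => hl n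
    have h2 : e 6 ≤ e x := exp_sqrt_log_anti hc'.le hx0 h6
    calc _ ≤ M + 6 := by rw [abs_le]; constructor <;> linarith
      _ = (M + 6) / e 6 * 1 * e 6 := by have := hepos 6; field_simp
      _ ≤ _ := by
        have := hepos 6
        have := Real.exp_pos c
        gcongr
        · exact le_add_of_nonneg_right (by positivity)
        · linarith
  · have hEe : E x ≤ e x ^ 2 := by
      simp only [hE, he]
      rw [← Real.exp_nat_mul, Real.exp_le_exp]
      have : min (c / 2) 1 ≤ c / 2 := min_le_left _ _
      have := Real.sqrt_nonneg (Real.log x)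
      push_cast
      nlinarith
    have he1 : e x ≤ 1 := by
      apply Real.exp_le_one_iff.2
      have := Real.sqrt_nonneg (Real.log x)
      nlinarith
    have hxe : 1 ≤ x * e x := by
      have hL : 1 ≤ Real.log x := by
        rw [Real.le_log_iff_exp_le (by linarith)]
        linarith [Real.exp_one_lt_d9]
      have h1 : Real.sqrt (Real.log x) ≤ Real.log x := by
        rw [Real.sqrt_le_left (by linarith)]; nlinarith
      have h2 : Real.exp (-Real.log x) ≤ e x := by
        apply Real.exp_le_exp.2
        have : min (c / 2) 1 ≤ 1 := min_le_right _ _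
        have := Real.sqrt_nonneg (Real.log x)
        nlinarith
      rw [Real.exp_neg, Real.exp_log hx0] at h2
      calc (1 : ℝ) = x * x⁻¹ := by field_simp
        _ ≤ _ := by gcongr
    set ψ := ∑ n ∈ Finset.Icc 1 ⌊x⌋₊, l n with hψ
    set η := x * e x / 2 with hη
    have hη0 : 0 < η := by have := hepos x; positivity
    have hηx : η ≤ x / 2 := by rw [hη]; nlinarith
    have hexpc : 1 ≤ Real.exp c := Real.one_le_exp hc.le
    have up := mul_sum_le_sub_of_nonneg hl hx0.le hη0.le
    have lo := sub_le_mul_sum_of_nonneg hl hη0.le (by linarith : η ≤ x)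
    have E1 : K * (x + η) ^ 2 * E (x + η) ≤ K * (4 * x ^ 2) * (e x ^ 2 * Real.exp c) := by
      have : E (x + η) ≤ e x ^ 2 * Real.exp c := by
        have := exp_sqrt_log_anti hc.le hx0 (by linarith : x ≤ x + η)
        exact (this.trans hEe).trans (le_mul_of_one_le_right (by positivity) hexpc)
      have h3 : (x + η) ^ 2 ≤ 4 * x ^ 2 := by nlinarith
      have := (hEpos (x + η)).le
      gcongr
    have E0 : K * x ^ 2 * E x ≤ K * x ^ 2 * (e x ^ 2 * Real.exp c) := by
      gcongr
      exact hEe.trans (le_mul_of_one_le_right (by positivity) hexpc)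
    have E2 : K * (x - η) ^ 2 * E (x - η) ≤ K * x ^ 2 * (e x ^ 2 * Real.exp c) := by
      have : E (x - η) ≤ e x ^ 2 * Real.exp c := by
        have h1 := exp_sqrt_log_anti hc.le (by linarith : 0 < x / 2) (by linarith : x / 2 ≤ x - η)
        have h2 := exp_sqrt_log_half_le hc.le (by linarith : 3 ≤ x)
        calc _ ≤ _ := h1.trans h2
          _ ≤ Real.exp c * e x ^ 2 := by gcongr
          _ = _ := by ring
      have h3 : (x - η) ^ 2 ≤ x ^ 2 := by nlinarith
      have := (hEpos (x - η)).le
      gcongr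
    obtain ⟨U, L⟩ := desmooth_algebra (V := 2 * K * Real.exp c * (x * e x))
      (W := K * x ^ 2 * (e x ^ 2 * Real.exp c)) hη0 (by rw [hη]; ring) up lo ((hSb x (by linarith)).trans E0)
      ((hSb (x + η) (by linarith)).trans (E1.trans_eq (by ring)))
      ((hSb (x - η) (by linarith)).trans E2)
    have hfin : (2 + 12 * K * Real.exp c) * x * e x ≤
        ((M + 6) / e 6 + (2 + 12 * K * Real.exp c)) * x * e x := by
      have h1 := hepos 6
      have h2 := hepos x
      have h3 : 0 ≤ (M + 6) / e 6 * x * e x := by positivity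
      linarith
    refine le_trans ?_ hfin
    have hP : (0 : ℝ) ≤ K * Real.exp c * (x * e x) := by have := hepos x; positivity
    rw [show (2 + 12 * K * Real.exp c) * x * e x =
      2 * (x * e x) + 12 * (K * Real.exp c * (x * e x)) by ring, abs_le]
    constructor <;> linarith

namespace DensityData

variable {a l : ℕ → ℝ} {κ C δ : ℝ}

/-- The abstract prime number theorem with classical error term. -/
theorem exists_sum_bound (h : DensityData a l κ C δ) : ∃ c K : ℝ, 0 < c ∧ 0 < K ∧
    ∀ x : ℝ, 2 ≤ x → |∑ n ∈ Finset.Icc 1 ⌊x⌋₊, l n - x| ≤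
      K * x * Real.exp (-c * Real.sqrt (Real.log x)) := by
  obtain ⟨c, K, hc, hK, hb⟩ := h.exists_smoothed_bound
  exact exists_bound_of_smoothed h.log_nonneg hc hK hb

end DensityData

lemma hasDerivAt_inv_mul_log {t : ℝ} (ht : 1 < t) :
    HasDerivAt (fun t : ℝ => (t * Real.log t)⁻¹)
      (-((Real.log t + 1) / (t * Real.log t) ^ 2)) t := by
  have hl := Real.log_pos ht
  have h0 : t ≠ 0 := by linarith
  have h1 := ((hasDerivAt_id t).mul (Real.hasDerivAt_log h0)).inv (mul_ne_zero h0 hl.ne')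
  exact h1.congr_deriv (by simp only [id, Pi.mul_apply]; field_simp)

lemma hasDerivAt_log_log_sub_inv {t : ℝ} (ht : 1 < t) :
    HasDerivAt (fun t : ℝ => Real.log (Real.log t) - (Real.log t)⁻¹)
      ((Real.log t + 1) / (t * Real.log t) ^ 2 * t) t := by
  have hl := Real.log_pos ht
  have h0 : t ≠ 0 := by linarith
  have h1 := Real.hasDerivAt_log h0
  exact ((h1.log hl.ne').sub (h1.inv hl.ne')).congr_deriv (by field_simp; ring)

lemma hasDerivAt_exp_sqrt_log {c t : ℝ} (hc : 0 < c) (ht : 1 < t) :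
    HasDerivAt (fun t : ℝ => -(2 / c) * Real.exp (-c * Real.sqrt (Real.log t)))
      (Real.exp (-c * Real.sqrt (Real.log t)) / (t * Real.sqrt (Real.log t))) t := by
  have hl := Real.log_pos ht
  have h0 : t ≠ 0 := by linarith
  have hs := Real.sqrt_pos.2 hl
  exact ((((Real.hasDerivAt_log h0).sqrt hl.ne').const_mul (-c)).exp.const_mul
    (-(2 / c))).congr_deriv (by field_simp)

lemma weight_le {t : ℝ} (ht : 2 ≤ t) :
    (Real.log t + 1) / (t * Real.log t) ^ 2 * t ≤ 4 / (t * Real.sqrt (Real.log t)) := by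
  have hl : 0.69 ≤ Real.log t := by
    have := Real.log_le_log (by norm_num) ht
    linarith [Real.log_two_gt_d9]
  set s := Real.sqrt (Real.log t) with hs
  have hss : Real.log t = s ^ 2 := (Real.sq_sqrt (by linarith)).symm
  have hs1 : 0.83 ≤ s := Real.le_sqrt_of_sq_le (by linarith)
  rw [hss] at *
  have ht0 : 0 < t := by linarith
  have hs0 : 0 < s := by linarith
  have e1 : (s ^ 2 + 1) / (t * s ^ 2) ^ 2 * t = (s ^ 2 + 1) / s ^ 3 / (t * s) := by field_simp
  rw [e1]
  gcongr
  rw [div_le_iff₀ (by positivity)]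
  nlinarith [mul_nonneg (sub_nonneg.2 hs1) (sq_nonneg s)]

/-- Partial summation from `∑ b n ~ x` to `∑ b n / (n log n) = log log x + c + o(1)`. -/
lemma exists_sum_div_mul_log_bound {b : ℕ → ℝ} (b0 : b 0 = 0) (b1 : b 1 = 0) {c K : ℝ}
    (hc : 0 < c) (hK : 0 < K)
    (h : ∀ x : ℝ, 2 ≤ x → |∑ n ∈ Finset.Icc 0 ⌊x⌋₊, b n - x| ≤
      K * x * Real.exp (-c * Real.sqrt (Real.log x))) :
    ∃ c₁ K' : ℝ, 0 < K' ∧ ∀ x : ℝ, 3 ≤ x →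
      |(∑ n ∈ Finset.Icc 0 ⌊x⌋₊, (n * Real.log n)⁻¹ * b n) - Real.log (Real.log x) - c₁| ≤
        K' * Real.exp (-c * Real.sqrt (Real.log x)) := by
  set w : ℝ → ℝ := fun t => (Real.log t + 1) / (t * Real.log t) ^ 2 with hw
  set e : ℝ → ℝ := fun t => Real.exp (-c * Real.sqrt (Real.log t)) with he
  set A : ℝ → ℝ := fun t => ∑ n ∈ Finset.Icc 0 ⌊t⌋₊, b n with hA
  have hAm : Measurable A :=
    (measurable_from_nat (f := fun n => ∑ k ∈ Finset.Icc 0 n, b k)).comp Nat.measurable_floor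
  have hwm : Measurable w := by fun_prop
  have hwpos : ∀ t, 2 ≤ t → 0 ≤ w t := fun t ht => by
    have := Real.log_nonneg (by linarith : 1 ≤ t)
    positivity
  have hwc : ContinuousOn w (Set.Ici 2) := by
    intro t ht
    have h2 : (2 : ℝ) ≤ t := ht
    have := Real.log_pos (by linarith : 1 < t)
    have ht0 : t ≠ 0 := by linarith
    refine ContinuousAt.continuousWithinAt ?_
    exact ContinuousAt.div (by fun_prop (disch := assumption)) (by fun_prop (disch := assumption))
      (by positivity)
  have hbound : ∀ t, 2 ≤ t → ‖w t * (A t - t)‖ ≤ 4 * K * (e t / (t * Real.sqrt (Real.log t))) := by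
    intro t ht
    rw [norm_mul, Real.norm_eq_abs, Real.norm_eq_abs, abs_of_nonneg (hwpos t ht)]
    have he0 : 0 ≤ e t := (Real.exp_pos _).le
    have := hwpos t ht
    calc w t * |A t - t| ≤ w t * (K * t * e t) := by gcongr; exact h t ht
      _ = (w t * t) * (K * e t) := by ring
      _ ≤ 4 / (t * Real.sqrt (Real.log t)) * (K * e t) := by gcongr; exact weight_le ht
      _ = _ := by ring
  have hlim : Filter.Tendsto (fun t : ℝ => -(2 / c) * e t) Filter.atTop (nhds 0) := by
    have h1 : Filter.Tendsto (fun t => c * Real.sqrt (Real.log t)) Filter.atTop Filter.atTop :=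
      (Real.tendsto_sqrt_atTop.comp Real.tendsto_log_atTop).const_mul_atTop hc
    have h2 := (Real.tendsto_exp_neg_atTop_nhds_zero.comp h1).const_mul (-(2 / c))
    simpa [he, Function.comp_def] using h2
  have hepos : ∀ y : ℝ, 2 ≤ y → ∀ t ∈ Set.Ioi y, 0 ≤ e t / (t * Real.sqrt (Real.log t)) := by
    intro y hy t ht
    have : 0 < t := by have := Set.mem_Ioi.1 ht; linarith
    have := Real.exp_pos (-c * Real.sqrt (Real.log t))
    positivity
  have hei : ∀ y : ℝ, 2 ≤ y → IntegrableOn (fun t => e t / (t * Real.sqrt (Real.log t)))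
      (Set.Ioi y) := fun y hy => integrableOn_Ioi_deriv_of_nonneg'
    (fun t ht => hasDerivAt_exp_sqrt_log hc (by have := Set.mem_Ici.1 ht; linarith))
    (hepos y hy) hlim
  have hev : ∀ y : ℝ, 2 ≤ y → ∫ t in Set.Ioi y, e t / (t * Real.sqrt (Real.log t)) =
      2 / c * e y := fun y hy => by
    rw [integral_Ioi_of_hasDerivAt_of_nonneg' (fun t ht => hasDerivAt_exp_sqrt_log hc
      (by have := Set.mem_Ici.1 ht; linarith)) (hepos y hy) hlim]
    ring
  have hRi : IntegrableOn (fun t => w t * (A t - t)) (Set.Ioi 2) := by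
    refine Integrable.mono' ((hei 2 le_rfl).const_mul (4 * K))
      (hwm.mul (hAm.sub measurable_id)).aestronglyMeasurable ?_
    exact ae_restrict_of_forall_mem measurableSet_Ioi fun t ht => hbound t (Set.mem_Ioi.1 ht).le
  refine ⟨(∫ t in Set.Ioi 2, w t * (A t - t)) - (Real.log (Real.log 2) - (Real.log 2)⁻¹),
    K + 4 * K * (2 / c), by positivity, fun x hx => ?_⟩
  have hx0 : 0 < x := by linarith
  have hL : 1 ≤ Real.log x := by
    rw [Real.le_log_iff_exp_le hx0]
    linarith [Real.exp_one_lt_d9]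
  have hderiv : ∀ t ∈ Set.Icc 2 x, deriv (fun t : ℝ => (t * Real.log t)⁻¹) t = -w t :=
    fun t ht => (hasDerivAt_inv_mul_log (by linarith [ht.1])).deriv
  have hwi : IntegrableOn w (Set.Icc 2 x) :=
    (hwc.mono Set.Icc_subset_Ici_self).integrableOn_Icc
  have habel := sum_mul_eq_sub_integral_mul₁ (f := fun t : ℝ => (t * Real.log t)⁻¹) b b0 b1 x
    (fun t ht => (hasDerivAt_inv_mul_log (by linarith [ht.1])).differentiableAt)
    ((integrableOn_congr_fun hderiv measurableSet_Icc).2 hwi.neg)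
  have h1 : ∫ t in Set.Ioc 2 x, deriv (fun t : ℝ => (t * Real.log t)⁻¹) t *
      ∑ n ∈ Finset.Icc 0 ⌊t⌋₊, b n = -((∫ t in Set.Ioc 2 x, w t * (A t - t)) +
        ∫ t in Set.Ioc 2 x, w t * t) := by
    rw [← integral_add (hRi.mono_set Set.Ioc_subset_Ioi_self), ← integral_neg]
    · refine setIntegral_congr_fun measurableSet_Ioc fun t ht => ?_
      rw [hderiv t (Set.Ioc_subset_Icc_self ht)]
      ring
    · refine (ContinuousOn.integrableOn_Icc ?_).mono_set Set.Ioc_subset_Icc_self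
      exact (hwc.mono Set.Icc_subset_Ici_self).mul continuousOn_id
  have h2 : ∫ t in Set.Ioc 2 x, w t * t = (Real.log (Real.log x) - (Real.log x)⁻¹) -
      (Real.log (Real.log 2) - (Real.log 2)⁻¹) := by
    rw [← intervalIntegral.integral_of_le (by linarith)]
    refine intervalIntegral.integral_eq_sub_of_hasDerivAt (f := fun t : ℝ =>
      Real.log (Real.log t) - (Real.log t)⁻¹) ?_ ?_
    · intro t ht
      rw [Set.uIcc_of_le (by linarith)] at ht
      exact hasDerivAt_log_log_sub_inv (by linarith [ht.1])
    · refine ContinuousOn.intervalIntegrable ?_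
      rw [Set.uIcc_of_le (by linarith)]
      exact (hwc.mono Set.Icc_subset_Ici_self).mul continuousOn_id
  have h3 : ∫ t in Set.Ioi 2, w t * (A t - t) = (∫ t in Set.Ioc 2 x, w t * (A t - t)) +
      ∫ t in Set.Ioi x, w t * (A t - t) := by
    rw [← setIntegral_union (Set.Ioc_disjoint_Ioi le_rfl) measurableSet_Ioi
      (hRi.mono_set Set.Ioc_subset_Ioi_self) (hRi.mono_set (Set.Ioi_subset_Ioi (by linarith))),
      Set.Ioc_union_Ioi_eq_Ioi (by linarith)]
  have h4 : |∫ t in Set.Ioi x, w t * (A t - t)| ≤ 4 * K * (2 / c * e x) := by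
    rw [← hev x (by linarith), ← integral_const_mul, ← Real.norm_eq_abs]
    refine norm_integral_le_of_norm_le ((hei x (by linarith)).const_mul _) ?_
    exact ae_restrict_of_forall_mem measurableSet_Ioi fun t ht =>
      hbound t (by have := Set.mem_Ioi.1 ht; linarith)
  have h5 : |(x * Real.log x)⁻¹ * (A x - x)| ≤ K * e x := by
    have he0 : 0 < e x := Real.exp_pos _
    rw [abs_mul, abs_of_pos (by positivity)]
    calc _ ≤ (x * Real.log x)⁻¹ * (K * x * e x) := by gcongr; exact h x (by linarith)
      _ = K * e x / Real.log x := by field_simp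
      _ ≤ _ := div_le_self (by positivity) hL
  have h6 : (x * Real.log x)⁻¹ * A x = (x * Real.log x)⁻¹ * (A x - x) + (Real.log x)⁻¹ := by
    field_simp; ring
  rw [habel, h1, h2, h3]
  change |(x * Real.log x)⁻¹ * A x - _ - _ - _| ≤ _
  rw [h6]
  have h7 := abs_le.1 h4
  have h8 := abs_le.1 h5
  rw [add_mul, abs_le]
  constructor <;> linarith

lemma exists_sqrt_mul_log_le (c : ℝ) : ∃ K : ℝ, 0 < K ∧ ∀ x : ℝ, 2 ≤ x →
    2 * √x * Real.log x + 1 ≤ K * x * Real.exp (-c * √(Real.log x)) := by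
  refine ⟨17 * Real.exp (2 * c ^ 2), by positivity, fun x hx => ?_⟩
  have hl : 0 < Real.log x := Real.log_pos (by linarith)
  set u := √(Real.log x) with hu
  have hu2 : Real.log x = u ^ 2 := (Real.sq_sqrt hl.le).symm
  have hx0 : 0 < x := by linarith
  have hxe : x = Real.exp (u ^ 2) := by rw [← hu2, Real.exp_log hx0]
  have hsx : √x = Real.exp (u ^ 2 / 2) := by
    rw [hxe, Real.sqrt_eq_rpow, ← Real.exp_mul]; ring_nf
  have h1 : u ^ 2 ≤ 8 * Real.exp (u ^ 2 / 8) := by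
    have := Real.add_one_le_exp (u ^ 2 / 8); linarith
  have e1 : Real.exp (u ^ 2 / 2) * Real.exp (u ^ 2 / 8) ≤
      Real.exp (2 * c ^ 2) * Real.exp (u ^ 2) * Real.exp (-c * u) := by
    rw [← Real.exp_add, ← Real.exp_add, ← Real.exp_add, Real.exp_le_exp]
    nlinarith [sq_nonneg (u - 2 * c), sq_nonneg (u - 4 / 3 * c), sq_nonneg c]
  have e2 : 1 ≤ Real.exp (2 * c ^ 2) * Real.exp (u ^ 2) * Real.exp (-c * u) := by
    rw [← Real.exp_add, ← Real.exp_add, Real.one_le_exp_iff]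
    nlinarith [sq_nonneg (u - c), sq_nonneg c, sq_nonneg u]
  rw [hu2, hsx]
  rw [hxe]
  have := mul_le_mul_of_nonneg_left h1 (Real.exp_pos (u ^ 2 / 2)).le
  nlinarith

/-- A Mertens-type estimate for a weight on primes that agrees with `DensityData`
at all but finitely many primes. -/
lemma DensityData.exists_prime_sum_bound {a l : ℕ → ℝ} {κ C δ : ℝ} (h : DensityData a l κ C δ)
    {r : ℕ → ℝ} {P : ℕ} (hr : ∀ p, p.Prime → P < p → l p = r p * Real.log p) :
    ∃ c₁ c₂ K : ℝ, 0 < c₂ ∧ 0 < K ∧ ∀ x : ℝ, 3 ≤ x →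
      |(∑ p ∈ (Finset.range (⌊x⌋₊ + 1)).filter Nat.Prime, r p / p) -
          Real.log (Real.log x) - c₁| ≤ K * Real.exp (-c₂ * Real.sqrt (Real.log x)) := by
  obtain ⟨c, K, hc, hK, hlsum⟩ := h.exists_sum_bound
  set b : ℕ → ℝ := fun n => if n.Prime then r n * Real.log n else 0 with hb
  set D : ℝ := ∑ n ∈ Finset.range (P + 1), |l n - b n| with hD
  have hD0 : 0 ≤ D := Finset.sum_nonneg fun _ _ => abs_nonneg _
  have hdiff : ∀ x : ℝ, 2 ≤ x → |∑ n ∈ Finset.Icc 1 ⌊x⌋₊, l n - ∑ n ∈ Finset.Icc 1 ⌊x⌋₊, b n| ≤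
      C * (2 * √x * Real.log x) + D := by
    intro x hx
    rw [← Finset.sum_sub_distrib]
    refine (Finset.abs_sum_le_sum_abs _ _).trans ?_
    have hle : ∀ n ∈ Finset.Icc 1 ⌊x⌋₊, |l n - b n| ≤
        (if ¬ n.Prime then C * ArithmeticFunction.vonMangoldt n else 0) +
        (if n ∈ Finset.range (P + 1) then |l n - b n| else 0) := by
      intro n _
      by_cases hn : n.Prime
      · by_cases hnP : n ∈ Finset.range (P + 1)
        · simp [hn, hnP]
        · have : P < n := by simpa [Nat.lt_succ_iff] using hnP
          simp [hn, hb, hr n hn this]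
      · have h1 : |l n - b n| ≤ C * ArithmeticFunction.vonMangoldt n := by
          simp only [hb, hn, if_false, sub_zero, abs_of_nonneg (h.log_nonneg n)]
          exact h.log_le n
        simp only [hn, not_false_eq_true, if_true]
        split_ifs <;> linarith [abs_nonneg (l n - b n)]
    refine (Finset.sum_le_sum hle).trans ?_
    rw [Finset.sum_add_distrib]
    refine add_le_add ?_ ?_
    · rw [← Finset.sum_filter, ← Finset.mul_sum]
      refine mul_le_mul_of_nonneg_left ?_ h.C_pos.le
      have h1 := Chebyshev.psi_sub_theta_eq_sum_not_prime x
      have h2 := Chebyshev.abs_psi_sub_theta_le_sqrt_mul_log (x := x) (by linarith)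
      rw [h1] at h2
      refine (le_abs_self _).trans (le_trans (le_of_eq ?_) h2)
      rfl
    · rw [← Finset.sum_filter]
      refine Finset.sum_le_sum_of_subset_of_nonneg ?_ fun _ _ _ => abs_nonneg _
      intro n hn
      exact (Finset.mem_filter.1 hn).2
  obtain ⟨K₁, hK₁, hs⟩ := exists_sqrt_mul_log_le c
  have hbsum : ∀ x : ℝ, 2 ≤ x → |∑ n ∈ Finset.Icc 0 ⌊x⌋₊, b n - x| ≤
      (K + (C + D) * K₁) * x * Real.exp (-c * Real.sqrt (Real.log x)) := by
    intro x hx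
    have h0 : ∑ n ∈ Finset.Icc 0 ⌊x⌋₊, b n = ∑ n ∈ Finset.Icc 1 ⌊x⌋₊, b n := by
      symm
      refine Finset.sum_subset (Finset.Icc_subset_Icc_left zero_le_one) fun n hn hn' => ?_
      have : n = 0 := by
        simp only [Finset.mem_Icc] at hn hn'
        omega
      subst this
      simp [hb]
    rw [h0]
    have h1 := hlsum x hx
    have h2 := hdiff x hx
    have h3 := hs x hx
    have hsl : 0 ≤ 2 * √x * Real.log x := by
      have := Real.log_nonneg (by linarith : 1 ≤ x)
      positivity
    have h4 : C * (2 * √x * Real.log x) + D ≤ (C + D) * (2 * √x * Real.log x + 1) := by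
      nlinarith [h.C_pos]
    have h5 := mul_le_mul_of_nonneg_left h3 (by linarith [h.C_pos] : 0 ≤ C + D)
    have h6 : |∑ n ∈ Finset.Icc 1 ⌊x⌋₊, b n - x| ≤ |∑ n ∈ Finset.Icc 1 ⌊x⌋₊, l n - x| +
        |∑ n ∈ Finset.Icc 1 ⌊x⌋₊, l n - ∑ n ∈ Finset.Icc 1 ⌊x⌋₊, b n| := by
      rw [add_comm, abs_sub_comm (∑ n ∈ Finset.Icc 1 ⌊x⌋₊, l n) (∑ n ∈ Finset.Icc 1 ⌊x⌋₊, b n)]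
      exact abs_sub_le _ _ _
    linarith
  obtain ⟨c₁, K', hK', hfin⟩ := exists_sum_div_mul_log_bound (b := b) (by simp [hb])
    (by simp [hb, Nat.not_prime_one]) hc (by have := h.C_pos; positivity) hbsum
  refine ⟨c₁, c, K', hc, hK', fun x hx => ?_⟩
  have heq : ∑ p ∈ (Finset.range (⌊x⌋₊ + 1)).filter Nat.Prime, r p / p =
      ∑ n ∈ Finset.Icc 0 ⌊x⌋₊, (n * Real.log n)⁻¹ * b n := by
    rw [Finset.sum_filter, Finset.range_eq_Ico, ← Finset.Ico_add_one_right_eq_Icc]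
    refine Finset.sum_congr rfl fun p _ => ?_
    by_cases hp : p.Prime
    · have h1 : Real.log p ≠ 0 := (Real.log_pos (by exact_mod_cast hp.one_lt)).ne'
      have h2 : (p : ℝ) ≠ 0 := by exact_mod_cast hp.ne_zero
      simp only [hp, if_true, hb]
      field_simp
    · simp [hp, hb]
  rw [heq]
  exact hfin x hx

open Module Submodule in
/-- The number of lattice points in a set is its volume over the covolume, up to the volume of a
neighbourhood of its boundary. -/
lemma ZLattice.exists_abs_card_mul_covolume_sub_le {E : Type*} [NormedAddCommGroup E]
    [NormedSpace ℝ E] [FiniteDimensional ℝ E] [MeasurableSpace E] [BorelSpace E]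
    (L : Submodule ℤ E) [DiscreteTopology L] [IsZLattice ℝ L]
    (μ : Measure E) [μ.IsAddHaarMeasure] :
    ∃ ρ : ℝ, 0 < ρ ∧ ∀ S B : Set E, Bornology.IsBounded S → μ B ≠ ⊤ →
      (∀ x y, ‖x - y‖ ≤ ρ → x ∈ S → y ∉ S → x ∈ B ∧ y ∈ B) →
      |Nat.card ↑(S ∩ L) * ZLattice.covolume L μ - μ.real S| ≤ μ.real B := by
  set b := Free.chooseBasis ℤ L
  have hfd := ZLattice.isAddFundamentalDomain b μ
  set D := ZSpan.fundamentalDomain (b.ofZLatticeBasis ℝ L) with hD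
  have hspan : span ℤ (Set.range (b.ofZLatticeBasis ℝ L)) = L := b.ofZLatticeBasis_span ℝ
  obtain ⟨ρ, hρ⟩ := (ZSpan.fundamentalDomain_isBounded (b.ofZLatticeBasis ℝ L)).exists_norm_le
  have hDm : MeasurableSet D := ZSpan.fundamentalDomain_measurableSet _
  have hDfin : μ D ≠ ⊤ := (ZSpan.fundamentalDomain_isBounded _).measure_lt_top.ne
  refine ⟨max ρ 1, by positivity, fun S B hS hB hSB => ?_⟩
  have hfin : (S ∩ L).Finite := by
    have := ZSpan.setFinite_inter (b.ofZLatticeBasis ℝ L) hS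
    rwa [hspan] at this
  set N : Finset E := hfin.toFinset with hN
  have hNmem : ∀ v, v ∈ N ↔ v ∈ S ∧ v ∈ L := fun v => by simp [hN]
  have hSfin : μ S ≠ ⊤ := hS.measure_lt_top.ne
  set U : Set E := ⋃ v ∈ N, (fun x => v + x) '' D with hU
  have huniq : ∀ v w x y, v ∈ L → w ∈ L → x ∈ D → y ∈ D → v + x = w + y → v = w := by
    intro v w x y hv hw hx hy hxy
    have e1 := ZSpan.fract_zSpan_add (b.ofZLatticeBasis ℝ L) x (v := v) (by rwa [hspan])
    have e2 := ZSpan.fract_zSpan_add (b.ofZLatticeBasis ℝ L) y (v := w) (by rwa [hspan])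
    rw [ZSpan.fract_eq_self.2 hx] at e1
    rw [ZSpan.fract_eq_self.2 hy, ← hxy, e1] at e2
    rw [e2] at hxy
    exact add_right_cancel hxy
  have hUm : μ.real U = N.card * μ.real D := by
    rw [hU, measureReal_biUnion_finset (h := fun v _ => by
      rw [Set.image_add_left, measure_preimage_add]
      exact hDfin)]
    · have : ∀ v ∈ N, μ.real ((fun x => v + x) '' D) = μ.real D := fun v _ => by
        rw [Set.image_add_left, measureReal_def, measure_preimage_add, measureReal_def]
      rw [Finset.sum_congr rfl this, Finset.sum_const, nsmul_eq_mul]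
    · intro v hv w hw hvw
      rw [Function.onFun, Set.disjoint_left]
      rintro _ ⟨x, hx, rfl⟩ ⟨y, hy, hxy⟩
      exact hvw (huniq v w x y ((hNmem v).1 hv).2 ((hNmem w).1 hw).2 hx hy hxy.symm)
    · intro v _
      rw [Set.image_add_left]
      exact measurable_const_add (-v) hDm
  have hUfin : μ U ≠ ⊤ := by
    refine (measure_biUnion_lt_top N.finite_toSet fun v _ => ?_).ne
    rw [Set.image_add_left, measure_preimage_add]
    exact hDfin.lt_top
  have hUS : U ⊆ S ∪ B := by
    rintro _ hx
    simp only [hU, Set.mem_iUnion] at hx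
    obtain ⟨v, hv, x, hx, rfl⟩ := hx
    by_cases h : v + x ∈ S
    · exact Or.inl h
    · refine Or.inr (hSB v (v + x) ?_ ((hNmem v).1 hv).1 h).2
      rw [sub_add_cancel_left, norm_neg]
      exact (hρ x hx).trans (le_max_left _ _)
  have hSU : S ⊆ U ∪ B := by
    intro x hx
    have hL : (ZSpan.floor (b.ofZLatticeBasis ℝ L) x : E) ∈ L := by
      refine hspan.le ?_
      exact (ZSpan.floor (b.ofZLatticeBasis ℝ L) x).2
    have hf := ZSpan.fract_mem_fundamentalDomain (b.ofZLatticeBasis ℝ L) x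
    by_cases h : (ZSpan.floor (b.ofZLatticeBasis ℝ L) x : E) ∈ S
    · refine Or.inl ?_
      simp only [hU, Set.mem_iUnion]
      exact ⟨_, (hNmem _).2 ⟨h, hL⟩, _, hf, by simp [ZSpan.fract_apply]⟩
    · refine Or.inr (hSB x _ ?_ hx h).1
      rw [← ZSpan.fract_apply]
      exact (hρ _ hf).trans (le_max_left _ _)
  have hcard : Nat.card ↑(S ∩ L) = N.card := by
    rw [Nat.card_coe_set_eq, Set.ncard_eq_toFinset_card _ hfin]
  rw [hcard, ZLattice.covolume_eq_measure_fundamentalDomain L μ hfd, ← hUm, abs_sub_le_iff]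
  constructor
  · have := (measureReal_mono hUS (measure_union_ne_top hSfin hB)).trans (measureReal_union_le S B)
    linarith
  · have := (measureReal_mono hSU (measure_union_ne_top hUfin hB)).trans (measureReal_union_le U B)
    linarith

section NormLeOne

open NumberField NumberField.InfinitePlace NumberField.mixedEmbedding
  NumberField.mixedEmbedding.fundamentalCone NumberField.Units NumberField.Units.dirichletUnitTheorem
open scoped ENNReal

variable (K : Type*) [Field K] [NumberField K]

/-- The points of the mixed space whose exponential coordinates lie in a given set. -/
def paramPreimage (s : Set (realSpace K)) : Set (mixedSpace K) :=
  normAtAllPlaces ⁻¹' (expMapBasis '' s)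

variable {K}

lemma measurableSet_paramPreimage {s : Set (realSpace K)} (hs : MeasurableSet s) :
    MeasurableSet (paramPreimage K s) :=
  (hs.image_of_continuousOn_injOn (continuous_expMapBasis K).continuousOn
    (injective_expMapBasis K).injOn).preimage (continuous_normAtAllPlaces K).measurable

lemma setLIntegral_pi_exp (t : InfinitePlace K → Set ℝ) (n : ℕ) :
    ∫⁻ x : realSpace K in Set.univ.pi t, ENNReal.ofReal (Real.exp (x w₀ * n)) =
      (∏ w ∈ Finset.univ.erase w₀, volume (t w)) *
        ∫⁻ y in t w₀, ENNReal.ofReal (Real.exp (y * n)) := by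
  rw [volume_pi, Measure.restrict_pi_pi, lintegral_eq_lmarginal_univ 0,
    lmarginal_erase' _ (by fun_prop) (Finset.mem_univ w₀)]
  simp_rw [Function.update_self, lmarginal, lintegral_const, Measure.pi_univ,
    Measure.restrict_apply_univ]
  rw [mul_comm]
  congr 1
  exact Finset.prod_coe_sort (Finset.univ.erase w₀) fun w => volume (t w)

variable (K)

lemma exists_volume_paramPreimage_pi : ∃ A : ℝ≥0∞, A ≠ ⊤ ∧ ∀ t : InfinitePlace K → Set ℝ,
    (∀ w, MeasurableSet (t w)) → volume (paramPreimage K (Set.univ.pi t)) =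
      A * ((∏ w ∈ Finset.univ.erase w₀, volume (t w)) *
        ∫⁻ y in t w₀, ENNReal.ofReal (Real.exp (y * Module.finrank ℚ K))) := by
  refine ⟨2 ^ nrRealPlaces K * .ofReal (2 * π) ^ nrComplexPlaces K *
    ((2 : ℝ≥0∞)⁻¹ ^ nrComplexPlaces K * ENNReal.ofReal (regulator K) * (Module.finrank ℚ K)),
    ?_, fun t ht => ?_⟩
  · finiteness
  · have hm : MeasurableSet (Set.univ.pi t) := MeasurableSet.univ_pi ht
    rw [← setLIntegral_pi_exp, paramPreimage, volume_eq_two_pow_mul_two_pi_pow_mul_integral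
      Set.preimage_image_preimage (measurableSet_paramPreimage hm),
      normAtAllPlaces_image_preimage_expMapBasis, setLIntegral_expMapBasis_image hm (by fun_prop)]
    simp_rw [ENNReal.inv_mul_cancel_right
      (Finset.prod_ne_zero_iff.mpr fun _ _ ↦ ENNReal.ofReal_ne_zero_iff.mpr (expMapBasis_pos _ _))
      (ENNReal.prod_ne_top fun _ _ ↦ ENNReal.ofReal_ne_top)]
    ring

/-- A slab of width `2 η` around `k` in the coordinate `j`, in the parameter space of the
fundamental cone. -/
def paramSlab (j : InfinitePlace K) (k η : ℝ) : Set (realSpace K) :=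
  Set.univ.pi fun w => if w = j then Set.Icc (k - η) (k + η) else
    if w = w₀ then Set.Iic 1 else Set.Icc (-1) 2

lemma exists_volume_paramSlab_le : ∃ C : ℝ, 0 < C ∧ ∀ (j : InfinitePlace K) (k η : ℝ),
    0 < η → η ≤ 1 → k ≤ 1 →
      volume (paramPreimage K (paramSlab K j k η)) ≤ ENNReal.ofReal (C * η) := by
  obtain ⟨A, hA, hvol⟩ := exists_volume_paramPreimage_pi K
  set d := Module.finrank ℚ K with hd
  have hd0 : (0 : ℝ) < d := Nat.cast_pos.2 Module.finrank_pos
  set m := (Finset.univ.erase (w₀ : InfinitePlace K)).card with hm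
  set I : ℝ≥0∞ := ∫⁻ y in Set.Iic 1, ENNReal.ofReal (Real.exp (y * d)) with hI
  have hIfin : I ≠ ⊤ := by
    have : IntegrableOn (fun y : ℝ => Real.exp (y * d)) (Set.Iic 1) := by
      simpa only [mul_comm] using integrableOn_exp_mul_Iic hd0 1
    exact this.lintegral_lt_top.ne
  set M : ℝ≥0∞ := A * (3 ^ m * (I + ENNReal.ofReal (2 * Real.exp (2 * d)))) with hM
  have hMfin : M ≠ ⊤ := by finiteness
  refine ⟨M.toReal + 1, by positivity, fun j k η hη hη1 hk => ?_⟩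
  rw [paramSlab, hvol _ fun w => by
    split_ifs
    exacts [measurableSet_Icc, measurableSet_Iic, measurableSet_Icc]]
  have hle : A * ((∏ w ∈ Finset.univ.erase w₀, volume (if w = j then Set.Icc (k - η) (k + η) else
      if w = w₀ then Set.Iic 1 else Set.Icc (-1) 2)) *
        ∫⁻ y in (if w₀ = j then Set.Icc (k - η) (k + η) else
      if (w₀ : InfinitePlace K) = w₀ then Set.Iic 1 else Set.Icc (-1) 2),
        ENNReal.ofReal (Real.exp (y * d))) ≤ M * ENNReal.ofReal η := by
    have h1 : ∏ w ∈ Finset.univ.erase (w₀ : InfinitePlace K),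
        volume (if w = j then Set.Icc (k - η) (k + η) else
          if w = w₀ then Set.Iic 1 else Set.Icc (-1) 2) ≤
        3 ^ m * (if j = w₀ then 1 else ENNReal.ofReal η) := by
      have : ∏ w ∈ Finset.univ.erase (w₀ : InfinitePlace K),
          3 * (if w = j then ENNReal.ofReal η else 1) =
          3 ^ m * (if j = w₀ then 1 else ENNReal.ofReal η) := by
        rw [Finset.prod_mul_distrib, Finset.prod_const, Finset.prod_ite_eq']
        by_cases hj : j = w₀ <;> simp [hj, hm]
      rw [← this]
      refine Finset.prod_le_prod' fun w hw => ?_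
      have hw0 := Finset.ne_of_mem_erase hw
      split_ifs
      · rw [Real.volume_Icc, ← ENNReal.ofReal_ofNat, ← ENNReal.ofReal_mul (by norm_num)]
        exact ENNReal.ofReal_le_ofReal (by linarith)
      · rw [Real.volume_Icc, mul_one]
        norm_num
    have h2 : ∫⁻ y in (if w₀ = j then Set.Icc (k - η) (k + η) else
        if (w₀ : InfinitePlace K) = w₀ then Set.Iic 1 else Set.Icc (-1) 2),
        ENNReal.ofReal (Real.exp (y * d)) ≤
        (I + ENNReal.ofReal (2 * Real.exp (2 * d))) *
          (if j = w₀ then ENNReal.ofReal η else 1) := by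
      by_cases hj : j = w₀
      · simp only [hj, if_true]
        calc _ ≤ ∫⁻ y in Set.Icc (k - η) (k + η), ENNReal.ofReal (Real.exp (2 * d)) := by
              refine setLIntegral_mono' measurableSet_Icc fun y hy => ?_
              refine ENNReal.ofReal_le_ofReal (Real.exp_le_exp.2 ?_)
              have : y ≤ 2 := by linarith [hy.2]
              gcongr
          _ = ENNReal.ofReal (2 * Real.exp (2 * d)) * ENNReal.ofReal η := by
              rw [setLIntegral_const, Real.volume_Icc, ← ENNReal.ofReal_mul (by positivity),
                ← ENNReal.ofReal_mul (by positivity)]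
              congr 1
              ring
          _ ≤ _ := by gcongr; exact le_add_self
      · have hj' : ¬ w₀ = j := fun h => hj h.symm
        simp only [hj, hj', if_false, if_true, mul_one]
        exact le_self_add
    calc _ ≤ A * ((3 ^ m * (if j = w₀ then 1 else ENNReal.ofReal η)) *
          ((I + ENNReal.ofReal (2 * Real.exp (2 * d))) *
          (if j = w₀ then ENNReal.ofReal η else 1))) := by gcongr
      _ = M * ENNReal.ofReal η := by
        by_cases hj : j = w₀ <;> simp only [hj, if_true, if_false, hM] <;> ring
  refine hle.trans ?_
  rw [ENNReal.ofReal_mul (by positivity)]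
  gcongr
  rw [← ENNReal.ofReal_toReal hMfin, ENNReal.toReal_ofReal ENNReal.toReal_nonneg]
  exact ENNReal.ofReal_le_ofReal (by linarith)

end NormLeOne

section NormLeOneBoundary

open NumberField NumberField.InfinitePlace NumberField.mixedEmbedding
  NumberField.mixedEmbedding.fundamentalCone NumberField.Units NumberField.Units.dirichletUnitTheorem
open scoped ENNReal

variable (K : Type*) [Field K] [NumberField K]

lemma exists_expMapBasis_bounds : ∃ R : ℝ, 1 ≤ R ∧ ∀ ξ ∈ paramSet K, ∀ w,
    R⁻¹ * Real.exp (ξ w₀) ≤ expMapBasis ξ w ∧ expMapBasis ξ w ≤ R * Real.exp (ξ w₀) := by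
  set T := ((completeBasis K).equivFunL.symm : realSpace K →L[ℝ] realSpace K) with hT
  refine ⟨Real.exp ‖T‖, Real.one_le_exp (norm_nonneg _), fun ξ hξ w => ?_⟩
  rw [expMapBasis_apply'' ξ, Pi.smul_apply, smul_eq_mul, expMapBasis_apply, expMap_apply]
  set ζ : realSpace K := fun i => if i = w₀ then 0 else ξ i with hζ
  have hζ1 : ‖ζ‖ ≤ 1 := by
    rw [pi_norm_le_iff_of_nonneg zero_le_one]
    intro i
    simp only [hζ]
    split_ifs with hi
    · simp
    · have := hξ i (Set.mem_univ _)
      simp only [hi, if_false, Set.mem_Ico] at this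
      rw [Real.norm_of_nonneg this.1]
      exact this.2.le
  have h1 : |((completeBasis K).equivFun.symm ζ) w| ≤ ‖T‖ := by
    refine (norm_le_pi_norm (T ζ) w).trans ((T.le_opNorm ζ).trans ?_)
    exact mul_le_of_le_one_right (norm_nonneg _) hζ1
  have hm : (1 : ℝ) ≤ w.mult := by exact_mod_cast w.mult_pos
  have h2 : |(w.mult : ℝ)⁻¹ * ((completeBasis K).equivFun.symm ζ) w| ≤ ‖T‖ := by
    rw [abs_mul, abs_of_nonneg (by positivity)]
    exact (mul_le_of_le_one_left (abs_nonneg _) (inv_le_one_of_one_le₀ hm)).trans h1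
  obtain ⟨h3, h4⟩ := abs_le.1 h2
  rw [← Real.exp_neg, mul_comm]
  constructor
  · gcongr
  · rw [mul_comm]
    gcongr

lemma exists_expMapBasis_symm_lipschitz : ∃ L : ℝ, 0 < L ∧ ∀ (ξ q : realSpace K) (a e : ℝ),
    0 < a → (∀ w, a ≤ expMapBasis ξ w) → (∀ w, a ≤ q w) →
    (∀ w, |expMapBasis ξ w - q w| ≤ e) →
    ∃ ξ', expMapBasis ξ' = q ∧ ‖ξ - ξ'‖ ≤ L * (e / a) := by
  set T := ((completeBasis K).equivFunL : realSpace K →L[ℝ] realSpace K) with hT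
  refine ⟨2 * ‖T‖ + 1, by positivity, fun ξ q a e ha hξ hq hd => ?_⟩
  have he : 0 ≤ e := (abs_nonneg _).trans (hd w₀)
  have hqt : q ∈ (expMap : OpenPartialHomeomorph (realSpace K) (realSpace K)).target := by
    rw [expMap_target]
    exact fun w _ => ha.trans_le (hq w)
  set z := (completeBasis K).equivFun.symm ξ with hz
  refine ⟨T (expMap.symm q), ?_, ?_⟩
  · rw [expMapBasis_apply]
    have : (completeBasis K).equivFun.symm (T (expMap.symm q)) = expMap.symm q :=
      (completeBasis K).equivFunL.symm_apply_apply _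
    rw [this, expMap.right_inv hqt]
  · have h1 : ξ = T z := ((completeBasis K).equivFunL.apply_symm_apply ξ).symm
    have h2 : ‖z - expMap.symm q‖ ≤ 2 * (e / a) := by
      rw [pi_norm_le_iff_of_nonneg (by positivity)]
      intro w
      have hp : 0 < expMapBasis ξ w := expMapBasis_pos _ _
      have hq0 : 0 < q w := ha.trans_le (hq w)
      have h3 : z w = w.mult * Real.log (expMapBasis ξ w) := by
        rw [← expMap_symm_apply, expMapBasis_apply, expMap.left_inv]
        rw [expMap_source]
        trivial
      have hdw := abs_le.1 (hd w)
      have h4 : |Real.log (expMapBasis ξ w) - Real.log (q w)| ≤ e / a := by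
        rw [abs_le]
        constructor
        · have := Real.log_le_sub_one_of_pos (div_pos hq0 hp)
          rw [Real.log_div hq0.ne' hp.ne'] at this
          have h5 : q w / expMapBasis ξ w - 1 ≤ e / a := by
            rw [div_sub_one hp.ne']
            exact div_le_div₀ he (by linarith) ha (hξ w)
          linarith
        · have := Real.log_le_sub_one_of_pos (div_pos hp hq0)
          rw [Real.log_div hp.ne' hq0.ne'] at this
          have h5 : expMapBasis ξ w / q w - 1 ≤ e / a := by
            rw [div_sub_one hq0.ne']
            exact div_le_div₀ he (by linarith) ha (hq w)
          linarith
      have hm : (w.mult : ℝ) ≤ 2 := by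
        rw [mult]
        split_ifs <;> norm_num
      rw [Pi.sub_apply, h3, expMap_symm_apply, ← mul_sub, Real.norm_eq_abs, abs_mul,
        abs_of_nonneg (by positivity : (0 : ℝ) ≤ w.mult)]
      gcongr
    have hea : 0 ≤ e / a := by positivity
    calc ‖ξ - T (expMap.symm q)‖ = ‖T (z - expMap.symm q)‖ := by rw [map_sub, ← h1]
      _ ≤ ‖T‖ * (2 * (e / a)) := (T.le_opNorm _).trans (by gcongr)
      _ ≤ _ := by linarith

variable {K} in
lemma abs_normAtPlace_sub_le (x y : mixedSpace K) (w : InfinitePlace K) :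
    |normAtPlace w x - normAtPlace w y| ≤ ‖x - y‖ := by
  have h : ∀ x y : mixedSpace K, normAtPlace w x ≤ normAtPlace w y + ‖x - y‖ := fun x y => by
    have h1 := normAtPlace_add_le w y (x - y)
    rw [add_sub_cancel] at h1
    have h2 : normAtPlace w (x - y) ≤ ‖x - y‖ := by
      rw [norm_eq_sup'_normAtPlace]
      exact Finset.le_sup' (fun w => normAtPlace w (x - y)) (Finset.mem_univ w)
    linarith
  rw [abs_le]
  constructor
  · have := h y x
    rw [norm_sub_rev] at this
    linarith
  · linarith [h x y]

variable {K} in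
lemma mem_paramSlab_of_mem_of_notMem {ξ ξ' : realSpace K} {η : ℝ} (hη : η ≤ 1)
    (hξ : ξ ∈ paramSet K) (hξ' : ξ' ∉ paramSet K) (h : ‖ξ - ξ'‖ ≤ η) :
    ∃ j, ∃ k ∈ ({0, 1} : Set ℝ), ξ ∈ paramSlab K j k η ∧ ξ' ∈ paramSlab K j k η := by
  have hc : ∀ w, |ξ w - ξ' w| ≤ η := fun w => (norm_le_pi_norm (ξ - ξ') w).trans h
  simp only [paramSet, Set.mem_univ_pi, not_forall] at hξ hξ'
  obtain ⟨j, hj⟩ := hξ'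
  have key : ∃ k ∈ ({0, 1} : Set ℝ), |ξ j - k| ≤ η ∧ |ξ' j - k| ≤ η := by
    have h1 := hξ j
    have h2 := abs_le.1 (hc j)
    split_ifs at hj h1 with hjw
    · simp only [Set.mem_Iic] at hj h1
      exact ⟨0, by simp, abs_le.2 ⟨by linarith, by linarith⟩, abs_le.2 ⟨by linarith, by linarith⟩⟩
    · simp only [Set.mem_Ico, not_and_or, not_le, not_lt] at hj h1
      rcases hj with hj | hj
      · exact ⟨0, by simp, abs_le.2 ⟨by linarith, by linarith⟩,
          abs_le.2 ⟨by linarith, by linarith⟩⟩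
      · exact ⟨1, by simp, abs_le.2 ⟨by linarith, by linarith⟩,
          abs_le.2 ⟨by linarith, by linarith⟩⟩
  obtain ⟨k, hk, hk1, hk2⟩ := key
  rw [abs_le] at hk1 hk2
  refine ⟨j, k, hk, ?_, ?_⟩ <;> refine Set.mem_univ_pi.2 fun w => ?_
  · by_cases hw : w = j
    · subst hw
      rw [if_pos rfl]
      exact ⟨by linarith, by linarith⟩
    · rw [if_neg hw]
      have h1 := hξ w
      split_ifs at h1 ⊢
      · exact (Set.mem_Iic.1 h1).trans zero_le_one
      · exact ⟨by linarith [h1.1], by linarith [h1.2]⟩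
  · by_cases hw : w = j
    · subst hw
      rw [if_pos rfl]
      exact ⟨by linarith, by linarith⟩
    · rw [if_neg hw]
      have h1 := hξ w
      have h2 := abs_le.1 (hc w)
      split_ifs at h1 ⊢
      · have := Set.mem_Iic.1 h1
        exact Set.mem_Iic.2 (by linarith)
      · exact ⟨by linarith [h1.1], by linarith [h1.2]⟩

/-- The volume of a neighbourhood of the boundary of `normLeOne K`. -/
lemma exists_boundary_normLeOne : ∃ C ε₀ : ℝ, 0 < C ∧ 0 < ε₀ ∧ ∀ ε : ℝ, 0 < ε → ε ≤ ε₀ →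
    ∃ B : Set (mixedSpace K), volume B ≤ ENNReal.ofReal (C * √ε) ∧
      ∀ x y, ‖x - y‖ ≤ ε → x ∈ normLeOne K → y ∉ normLeOne K → x ∈ B ∧ y ∈ B := by
  obtain ⟨R, hR, hb⟩ := exists_expMapBasis_bounds K
  obtain ⟨L, hL, hlip⟩ := exists_expMapBasis_symm_lipschitz K
  obtain ⟨C, hC, hvol⟩ := exists_volume_paramSlab_le K
  have hR0 : 0 < R := by linarith
  set c₂ := L * (2 * R) with hc₂
  have hc₂0 : 0 < c₂ := by positivity
  set n := (Finset.univ : Finset (InfinitePlace K)).card with hn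
  set V := (volume (Metric.ball (0 : mixedSpace K) 1)).toReal with hV
  set s₀ := min ((2 * R)⁻¹) (min (c₂⁻¹) ((R + 1)⁻¹)) with hs₀
  have hs₀0 : 0 < s₀ := by positivity
  refine ⟨(R + 1) * V + n * (2 * (C * c₂)) + 1, s₀ ^ 2, by positivity, by positivity,
    fun ε hε hε₀ => ?_⟩
  set s := √ε with hs
  have hs0 : 0 < s := Real.sqrt_pos.2 hε
  have hss : ε = s ^ 2 := (Real.sq_sqrt hε.le).symm
  have hsle : s ≤ s₀ := by
    rw [hss] at hε₀
    exact (sq_le_sq₀ hs0.le hs₀0.le).1 hε₀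
  have hs1 : s ≤ (2 * R)⁻¹ := hsle.trans (min_le_left _ _)
  have hs2 : s ≤ c₂⁻¹ := hsle.trans ((min_le_right _ _).trans (min_le_left _ _))
  have hs3 : s ≤ (R + 1)⁻¹ := hsle.trans ((min_le_right _ _).trans (min_le_right _ _))
  have hη1 : c₂ * s ≤ 1 := by
    have := mul_le_mul_of_nonneg_left hs2 hc₂0.le
    rwa [mul_inv_cancel₀ hc₂0.ne'] at this
  have hr1 : (R + 1) * s ≤ 1 := by
    have := mul_le_mul_of_nonneg_left hs3 (by linarith : 0 ≤ R + 1)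
    rwa [mul_inv_cancel₀ (by linarith)] at this
  have hsl1 : s ≤ 1 := by nlinarith
  refine ⟨Metric.closedBall 0 ((R + 1) * s) ∪ ⋃ j ∈ (Finset.univ : Finset (InfinitePlace K)),
    (paramPreimage K (paramSlab K j 0 (c₂ * s)) ∪ paramPreimage K (paramSlab K j 1 (c₂ * s))),
    ?_, ?_⟩
  · have hball : volume (Metric.closedBall (0 : mixedSpace K) ((R + 1) * s)) ≤
        ENNReal.ofReal ((R + 1) * V * s) := by
      rw [Measure.addHaar_closedBall _ _ (by positivity), mixedEmbedding.finrank,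
        ← ENNReal.ofReal_toReal (measure_ball_lt_top (x := (0 : mixedSpace K)) (r := 1)).ne,
        ← ENNReal.ofReal_mul (by positivity)]
      refine ENNReal.ofReal_le_ofReal ?_
      have := pow_le_of_le_one (by positivity) hr1 (Module.finrank_pos (R := ℚ) (M := K)).ne'
      calc _ ≤ (R + 1) * s * V := by gcongr
        _ = _ := by ring
    have hslab : ∀ j ∈ (Finset.univ : Finset (InfinitePlace K)),
        volume (paramPreimage K (paramSlab K j 0 (c₂ * s)) ∪
          paramPreimage K (paramSlab K j 1 (c₂ * s))) ≤ ENNReal.ofReal (2 * (C * c₂) * s) := by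
      intro j _
      refine (measure_union_le _ _).trans ?_
      refine (add_le_add (hvol j 0 _ (by positivity) hη1 zero_le_one)
        (hvol j 1 _ (by positivity) hη1 le_rfl)).trans ?_
      rw [← ENNReal.ofReal_add (by positivity) (by positivity)]
      exact ENNReal.ofReal_le_ofReal (le_of_eq (by ring))
    refine (measure_union_le _ _).trans ((add_le_add hball ((measure_biUnion_finset_le _ _).trans
      (Finset.sum_le_sum hslab))).trans ?_)
    have hn0 : (0 : ℝ) ≤ n := n.cast_nonneg
    have h1 : 0 ≤ (R + 1) * V * s := by positivity
    have h2 : 0 ≤ 2 * (C * c₂) * s := by positivity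
    rw [Finset.sum_const, nsmul_eq_mul, ← hn, ← ENNReal.ofReal_natCast,
      ← ENNReal.ofReal_mul hn0, ← ENNReal.ofReal_add h1 (mul_nonneg hn0 h2)]
    exact ENNReal.ofReal_le_ofReal (by nlinarith)
  · intro x y hxy hx hy
    have hx' := hx
    rw [normLeOne_eq_preimage] at hx' hy
    obtain ⟨ξ, hξ, hξx⟩ := hx'
    have hpx : ∀ w, normAtPlace w x = expMapBasis ξ w := fun w => by
      rw [hξx, normAtAllPlaces_apply]
    have hd : ∀ w, |expMapBasis ξ w - normAtAllPlaces y w| ≤ ε := fun w => by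
      rw [← hpx w, normAtAllPlaces_apply]
      exact (abs_normAtPlace_sub_le x y w).trans hxy
    rcases le_or_gt s (Real.exp (ξ w₀)) with hcase | hcase
    · have hxa : ∀ w, R⁻¹ * s ≤ expMapBasis ξ w := fun w =>
        (mul_le_mul_of_nonneg_left hcase (by positivity)).trans (hb ξ hξ w).1
      have hsε : ε ≤ (2 * R)⁻¹ * s := by
        rw [hss, sq]
        gcongr
      have hRR : R⁻¹ * s = 2 * ((2 * R)⁻¹ * s) := by
        field_simp
      obtain ⟨ξ', hξ'y, hξξ'⟩ := hlip ξ (normAtAllPlaces y) ((2 * R)⁻¹ * s) ε (by positivity)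
        (fun w => by linarith [hxa w, (by positivity : 0 < (2 * R)⁻¹ * s)])
        (fun w => by linarith [hxa w, (abs_le.1 (hd w)).2]) hd
      have hη : L * (ε / ((2 * R)⁻¹ * s)) = c₂ * s := by
        rw [hss, hc₂]
        field_simp
      rw [hη] at hξξ'
      have hξ'n : ξ' ∉ paramSet K := fun h => hy ⟨ξ', h, hξ'y⟩
      obtain ⟨j, k, hk, h1, h2⟩ := mem_paramSlab_of_mem_of_notMem hη1 hξ hξ'n hξξ'
      have hmem : ∀ z ∈ paramPreimage K (paramSlab K j k (c₂ * s)),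
          z ∈ Metric.closedBall 0 ((R + 1) * s) ∪ ⋃ j ∈ (Finset.univ : Finset (InfinitePlace K)),
            (paramPreimage K (paramSlab K j 0 (c₂ * s)) ∪
              paramPreimage K (paramSlab K j 1 (c₂ * s))) := by
        intro z hz
        refine Or.inr (Set.mem_biUnion (Finset.mem_univ j) ?_)
        rcases hk with rfl | rfl
        · exact Or.inl hz
        · exact Or.inr hz
      exact ⟨hmem x ⟨ξ, h1, hξx⟩, hmem y ⟨ξ', h2, hξ'y⟩⟩
    · have hxn : ‖x‖ ≤ R * s := by
        rw [norm_eq_sup'_normAtPlace]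
        refine Finset.sup'_le _ _ fun w _ => ?_
        rw [hpx w]
        exact (hb ξ hξ w).2.trans (by gcongr)
      have hεs : ε ≤ s := by
        rw [hss]
        nlinarith
      have hyn : ‖y‖ ≤ (R + 1) * s := by
        have := norm_sub_norm_le y x
        rw [norm_sub_rev] at this
        linarith
      refine ⟨Or.inl ?_, Or.inl ?_⟩
      · rw [mem_closedBall_zero_iff]
        linarith
      · rwa [mem_closedBall_zero_iff]

end NormLeOneBoundary

section IdealCount

open NumberField NumberField.InfinitePlace NumberField.mixedEmbedding
  NumberField.mixedEmbedding.fundamentalCone Module Submodule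
open scoped nonZeroDivisors Pointwise

variable (K : Type*) [Field K] [NumberField K]

lemma exists_abs_card_smul_normLeOne_inter_sub_le (L : Submodule ℤ (mixedSpace K))
    [DiscreteTopology L] [IsZLattice ℝ L] :
    ∃ C : ℝ, 0 < C ∧ ∀ T : ℝ, 1 ≤ T →
      |Nat.card ↑((T • normLeOne K) ∩ (L : Set (mixedSpace K))) * ZLattice.covolume L -
        T ^ finrank ℚ K * volume.real (normLeOne K)| ≤
        C * (T ^ finrank ℚ K * (√T)⁻¹) := by
  obtain ⟨ρ, hρ, hL⟩ := ZLattice.exists_abs_card_mul_covolume_sub_le L volume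
  obtain ⟨C, ε₀, hC, hε₀, hB⟩ := exists_boundary_normLeOne K
  obtain ⟨R, hR, hbd⟩ := (isBounded_normLeOne K).exists_pos_norm_le
  set T₀ := ρ / ε₀ with hT₀
  have hT₀' : 0 < T₀ := by positivity
  set V := volume.real (Metric.closedBall (0 : mixedSpace K) (T₀ * R + ρ)) with hV
  have hd : 1 ≤ finrank ℚ K := finrank_pos
  have hvol : ∀ T : ℝ, 0 < T → ∀ S : Set (mixedSpace K),
      volume.real (T • S) = T ^ finrank ℚ K * volume.real S := by
    intro T hT S
    rw [measureReal_def, Measure.addHaar_smul, mixedEmbedding.finrank, ENNReal.toReal_mul,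
      ENNReal.toReal_ofReal (abs_nonneg _), abs_of_pos (by positivity), measureReal_def]
  have hpow : ∀ T : ℝ, 1 ≤ T → 1 ≤ T ^ finrank ℚ K * (√T)⁻¹ := by
    intro T hT
    have hs : 1 ≤ √T := Real.one_le_sqrt.2 hT
    rw [← div_eq_mul_inv, one_le_div (by positivity)]
    calc √T ≤ T := Real.sqrt_le_iff.2 ⟨by linarith, by nlinarith⟩
      _ = T ^ 1 := (pow_one T).symm
      _ ≤ T ^ finrank ℚ K := pow_le_pow_right₀ hT hd
  refine ⟨C * √ρ + V, by positivity, fun T hT => ?_⟩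
  have hT' : 0 < T := by linarith
  rw [← hvol T hT']
  have hTb : Bornology.IsBounded (T • normLeOne K) := (isBounded_normLeOne K).smul₀ T
  have h0 : 0 ≤ T ^ finrank ℚ K * (√T)⁻¹ := by positivity
  by_cases h : T₀ ≤ T
  · obtain ⟨B, hBv, hB⟩ := hB (ρ / T) (by positivity) (by
      rw [div_le_iff₀ hT']
      rwa [hT₀, div_le_iff₀ hε₀, mul_comm] at h)
    have hBr : volume.real B ≤ C * √(ρ / T) :=
      ENNReal.toReal_le_of_le_ofReal (by positivity) hBv
    have hBT : volume (T • B) ≠ ⊤ := by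
      rw [Measure.addHaar_smul]
      exact ENNReal.mul_ne_top ENNReal.ofReal_ne_top (ne_top_of_le_ne_top ENNReal.ofReal_ne_top hBv)
    refine (hL (T • normLeOne K) (T • B) hTb hBT fun x y hxy hx hy => ?_).trans ?_
    · rw [Set.mem_smul_set_iff_inv_smul_mem₀ hT'.ne'] at hx hy ⊢
      rw [Set.mem_smul_set_iff_inv_smul_mem₀ hT'.ne']
      refine hB _ _ ?_ hx hy
      rw [← smul_sub, _root_.norm_smul, norm_inv, Real.norm_of_nonneg hT'.le, inv_mul_eq_div]
      gcongr
    · rw [hvol T hT']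
      calc _ ≤ T ^ finrank ℚ K * (C * √(ρ / T)) := by gcongr
        _ = (C * √ρ) * (T ^ finrank ℚ K * (√T)⁻¹) := by
          rw [Real.sqrt_div hρ.le]
          ring
        _ ≤ _ := by
          gcongr
          have : 0 ≤ V := measureReal_nonneg
          linarith
  · refine (hL (T • normLeOne K) (Metric.closedBall 0 (T₀ * R + ρ)) hTb
      (measure_closedBall_lt_top).ne fun x y hxy hx _ => ?_).trans ?_
    · obtain ⟨z, hz, rfl⟩ := hx
      have h1 : ‖T • z‖ ≤ T₀ * R := by
        rw [_root_.norm_smul, Real.norm_of_nonneg hT'.le]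
        have := hbd z hz
        push Not at h
        gcongr
      have h2 : ‖y‖ ≤ ‖T • z‖ + ‖T • z - y‖ := by
        have := norm_sub_le (T • z) (T • z - y)
        rwa [sub_sub_cancel] at this
      simp only [mem_closedBall_zero_iff]
      exact ⟨by linarith, by linarith⟩
    · calc V ≤ V * (T ^ finrank ℚ K * (√T)⁻¹) := le_mul_of_one_le_right measureReal_nonneg
            (hpow T hT)
        _ ≤ _ := by
          gcongr
          have : 0 ≤ C * √ρ := by positivity
          linarith

lemma smul_normLeOne_eq {T s : ℝ} (hT : 0 < T) (hs : T ^ finrank ℚ K = s) :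
    T • normLeOne K = {x | x ∈ fundamentalCone K ∧ mixedEmbedding.norm x ≤ s} := by
  ext x
  rw [Set.mem_smul_set_iff_inv_smul_mem₀ hT.ne', Set.mem_ofPred_eq]
  have : ∀ y, y ∈ normLeOne K ↔ y ∈ fundamentalCone K ∧ mixedEmbedding.norm y ≤ 1 := fun y => by
    simp
  rw [this, smul_mem_iff_mem (inv_ne_zero hT.ne'), mixedEmbedding.norm_smul, abs_inv,
    abs_of_pos hT, inv_pow, hs, inv_mul_le_iff₀ (by rw [← hs]; positivity), mul_one]

lemma volume_real_normLeOne_pos : 0 < volume.real (normLeOne K) := by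
  rw [measureReal_def, volume_normLeOne, ENNReal.toReal_mul, ENNReal.toReal_mul,
    ENNReal.toReal_pow, ENNReal.toReal_pow, ENNReal.toReal_ofReal (Units.regulator_pos K).le]
  have := Units.regulator_pos K
  simp only [ENNReal.toReal_ofNat, ENNReal.coe_toReal, NNReal.coe_real_pi]
  positivity

lemma card_absNorm_le_and_mk0_eq {C : ClassGroup (𝓞 K)} {J : (Ideal (𝓞 K))⁰} (s : ℝ)
    (hJ : ClassGroup.mk0 J = C⁻¹) :
    Nat.card {I : (Ideal (𝓞 K))⁰ // (Ideal.absNorm (I : Ideal (𝓞 K)) : ℝ) ≤ s ∧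
      ClassGroup.mk0 I = C} * Units.torsionOrder K =
    Nat.card ↑({x | x ∈ fundamentalCone K ∧
      mixedEmbedding.norm x ≤ s * Ideal.absNorm (J : Ideal (𝓞 K))} ∩
      (idealLattice K (FractionalIdeal.mk0 K J) : Set (mixedSpace K))) := by
  have h1 : Nat.card {I : (Ideal (𝓞 K))⁰ // (Ideal.absNorm (I : Ideal (𝓞 K)) : ℝ) ≤ s ∧
      ClassGroup.mk0 I = C} =
      Nat.card {I : (Ideal (𝓞 K))⁰ // (J : Ideal (𝓞 K)) ∣ I ∧
        IsPrincipal (I : Ideal (𝓞 K)) ∧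
        (Ideal.absNorm (I : Ideal (𝓞 K)) : ℝ) ≤ s * Ideal.absNorm (J : Ideal (𝓞 K))} := by
    simp_rw [← nonZeroDivisors_dvd_iff_dvd_coe]
    refine Nat.card_congr ?_
    refine ((Equiv.dvd J).subtypeEquiv fun I ↦ ?_).trans
      (Equiv.subtypeSubtypeEquivSubtypeInter (fun I : (Ideal (𝓞 K))⁰ ↦ J ∣ I) _)
    rw [← ClassGroup.mk0_eq_one_iff (SetLike.coe_mem _)]
    simp_rw [Equiv.dvd_apply, Submonoid.coe_mul, ← Submonoid.mul_def, map_mul, hJ,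
      inv_mul_eq_one, Nat.cast_mul, mul_comm s, eq_comm, and_comm, and_congr_left_iff]
    exact fun _ ↦ (mul_le_mul_iff_of_pos_left
      (Nat.cast_pos.mpr (Ideal.absNorm_pos_of_nonZeroDivisors J))).symm
  rw [h1, card_isPrincipal_dvd_norm_le]
  refine Nat.card_congr ((Equiv.subtypeSubtypeEquivSubtypeInter _
    (mixedEmbedding.norm · ≤ s * Ideal.absNorm (J : Ideal (𝓞 K)))).trans
    (Equiv.subtypeEquivProp ?_))
  ext x
  simp only [idealSet, Set.mem_inter_iff, Set.mem_ofPred_eq, SetLike.mem_coe]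
  tauto

lemma exists_abs_card_absNorm_le_and_mk0_eq_sub_le (c : ClassGroup (𝓞 K)) :
    ∃ κ C : ℝ, 0 < κ ∧ 0 < C ∧ ∀ s : ℝ, 1 ≤ s →
      |Nat.card {I : (Ideal (𝓞 K))⁰ // (Ideal.absNorm (I : Ideal (𝓞 K)) : ℝ) ≤ s ∧
        ClassGroup.mk0 I = c} - κ * s| ≤ C * s ^ (1 - 1 / (2 * (finrank ℚ K : ℝ))) := by
  obtain ⟨J, hJ⟩ := ClassGroup.mk0_surjective c⁻¹
  obtain ⟨C, hC, h⟩ := exists_abs_card_smul_normLeOne_inter_sub_le K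
    (idealLattice K (FractionalIdeal.mk0 K J))
  set v := ZLattice.covolume (idealLattice K (FractionalIdeal.mk0 K J)) with hv
  have hvpos : 0 < v := ZLattice.covolume_pos _ _
  set N : ℝ := ((Ideal.absNorm (J : Ideal (𝓞 K)) : ℕ) : ℝ) with hN
  have hN1 : 1 ≤ N := by
    rw [hN]
    exact_mod_cast Ideal.absNorm_pos_of_nonZeroDivisors J
  have hV := volume_real_normLeOne_pos K
  set V := volume.real (normLeOne K)
  set w : ℝ := ((Units.torsionOrder K : ℕ) : ℝ) with hw
  have hw0 : 0 < w := by
    rw [hw]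
    exact_mod_cast Units.torsionOrder_pos K
  have hd : 0 < (finrank ℚ K : ℝ) := by exact_mod_cast (finrank_pos : 0 < finrank ℚ K)
  set d : ℝ := (finrank ℚ K : ℝ)
  refine ⟨N * V / (v * w), C * N ^ (1 - 1 / (2 * d)) / (v * w), by positivity, by positivity,
    fun s hs => ?_⟩
  have hsN : 1 ≤ s * N := one_le_mul_of_one_le_of_one_le hs hN1
  have hsN0 : 0 < s * N := by linarith
  set T := (s * N) ^ (1 / d) with hT
  have hT1 : 1 ≤ T := Real.one_le_rpow hsN (by positivity)
  have hTd : T ^ finrank ℚ K = s * N := by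
    rw [hT, ← Real.rpow_natCast, ← Real.rpow_mul (by linarith), one_div_mul_cancel hd.ne',
      Real.rpow_one]
  have h2 := h T hT1
  rw [smul_normLeOne_eq K (by linarith) hTd, ← card_absNorm_le_and_mk0_eq K s hJ, hTd] at h2
  have hsq : s * N * (√T)⁻¹ = N ^ (1 - 1 / (2 * d)) * s ^ (1 - 1 / (2 * d)) := by
    rw [← Real.mul_rpow (by linarith) (by linarith), mul_comm N s, Real.rpow_sub hsN0,
      Real.rpow_one, Real.sqrt_eq_rpow, hT, ← Real.rpow_mul hsN0.le, div_eq_mul_inv]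
    congr 3
    field_simp
  rw [hsq] at h2
  push_cast at h2
  rw [← hw] at h2
  set n : ℝ := (Nat.card {I : (Ideal (𝓞 K))⁰ // (Ideal.absNorm (I : Ideal (𝓞 K)) : ℝ) ≤ s ∧
        ClassGroup.mk0 I = c} : ℝ)
  have : n - N * V / (v * w) * s = (n * w * v - s * N * V) / (v * w) := by
    field_simp
  rw [this, abs_div, abs_of_pos (by positivity : 0 < v * w), div_le_iff₀ (by positivity)]
  refine h2.trans (le_of_eq ?_)
  field_simp

lemma exists_abs_sum_card_absNorm_eq_sub_le :
    ∃ κ C : ℝ, 0 < κ ∧ 0 < C ∧ ∀ s : ℝ, 1 ≤ s →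
      |∑ k ∈ Finset.Icc 1 ⌊s⌋₊, (Nat.card {I : Ideal (𝓞 K) // Ideal.absNorm I = k} : ℝ) - κ * s| ≤
        C * s ^ (1 - 1 / (2 * (finrank ℚ K : ℝ))) := by
  choose κ C hκ hC h using exists_abs_card_absNorm_le_and_mk0_eq_sub_le K
  refine ⟨∑ c, κ c, ∑ c, C c, Finset.sum_pos (fun c _ => hκ c) Finset.univ_nonempty,
    Finset.sum_pos (fun c _ => hC c) Finset.univ_nonempty, fun s hs => ?_⟩
  have hs0 : 0 ≤ s := by linarith
  have key : ∑ k ∈ Finset.Icc 1 ⌊s⌋₊, (Nat.card {I : Ideal (𝓞 K) // Ideal.absNorm I = k} : ℝ) =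
      ∑ c : ClassGroup (𝓞 K), (Nat.card {I : (Ideal (𝓞 K))⁰ //
        (Ideal.absNorm (I : Ideal (𝓞 K)) : ℝ) ≤ s ∧ ClassGroup.mk0 I = c} : ℝ) := by
    have e1 : ∑ k ∈ Finset.Icc 1 ⌊s⌋₊, Nat.card {I : Ideal (𝓞 K) // Ideal.absNorm I = k} =
        Nat.card {I : (Ideal (𝓞 K))⁰ // Ideal.absNorm (I : Ideal (𝓞 K)) ≤ ⌊s⌋₊} := by
      rw [← add_left_inj 1, ← Ideal.card_norm_le_eq_card_norm_le_add_one,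
        show Finset.Icc 1 ⌊s⌋₊ = Finset.Ioc 0 ⌊s⌋₊ from Finset.Icc_succ_left_eq_Ioc _ _]
      rw [show 1 = Nat.card {I : Ideal (𝓞 K) // Ideal.absNorm I = 0} by
        simp [Ideal.absNorm_eq_zero_iff],
        Finset.sum_Ioc_add_eq_sum_Icc (Nat.zero_le _),
        ← Finset.card_preimage_eq_sum_card_image_eq
          (fun k _ ↦ Ideal.finite_setOfPred_absNorm_eq k)]
      simp [Set.coe_eq_subtype]
    have e2 : Nat.card {I : (Ideal (𝓞 K))⁰ // Ideal.absNorm (I : Ideal (𝓞 K)) ≤ ⌊s⌋₊} =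
        ∑ c : ClassGroup (𝓞 K), Nat.card {I : (Ideal (𝓞 K))⁰ //
        (Ideal.absNorm (I : Ideal (𝓞 K)) : ℝ) ≤ s ∧ ClassGroup.mk0 I = c} := by
      simp_rw [← Nat.le_floor_iff hs0]
      have : Fintype {I : (Ideal (𝓞 K))⁰ // Ideal.absNorm (I : Ideal (𝓞 K)) ≤ ⌊s⌋₊} :=
        @Fintype.ofFinite _ (Ideal.finite_setOfPred_absNorm_le₀ ⌊s⌋₊)
      let e := fun C : ClassGroup (𝓞 K) ↦ Equiv.subtypeSubtypeEquivSubtypeInter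
        (fun I : (Ideal (𝓞 K))⁰ ↦ Ideal.absNorm I.1 ≤ ⌊s⌋₊) (fun I ↦ ClassGroup.mk0 I = C)
      simp_rw [← Nat.card_congr (e _), Nat.card_eq_fintype_card, Fintype.subtype_card]
      rw [Fintype.card, Finset.card_eq_sum_card_fiberwise (f := fun I ↦ ClassGroup.mk0 I.1)
        (t := Finset.univ) (fun _ _ ↦ Finset.mem_univ _)]
    rw [← Nat.cast_sum, e1, e2, Nat.cast_sum]
  rw [key, Finset.sum_mul, Finset.sum_mul, ← Finset.sum_sub_distrib]
  exact (Finset.abs_sum_le_sum_abs _ _).trans (Finset.sum_le_sum fun c _ => h c s hs)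

end IdealCount

section IdealMangoldt

open NumberField Ideal

variable {K : Type*} [Field K] [NumberField K]

/-- The von Mangoldt function on the ideals of the ring of integers of a number field. -/
noncomputable def idealMangoldt (I : Ideal (𝓞 K)) : ℝ :=
  if IsPrimePow I then Real.log (absNorm I.radical) else 0

lemma idealMangoldt_pow {P : Ideal (𝓞 K)} (hP : Prime P) {k : ℕ} (hk : k ≠ 0) :
    idealMangoldt (P ^ k) = Real.log (absNorm P) := by
  rw [idealMangoldt, if_pos (hP.isPrimePow.pow hk), Ideal.radical_pow _ hk,
    ((Ideal.prime_iff_isPrime hP.ne_zero).1 hP).radical]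

lemma idealMangoldt_nonneg (I : Ideal (𝓞 K)) : 0 ≤ idealMangoldt I := by
  rw [idealMangoldt]
  split_ifs
  exacts [Real.log_natCast_nonneg _, le_rfl]

lemma finite_ideal_dvd {I : Ideal (𝓞 K)} (hI : I ≠ 0) : {J : Ideal (𝓞 K) | J ∣ I}.Finite := by
  refine (Ideal.finite_setOfPred_absNorm_le (absNorm I)).subset fun J hJ => ?_
  exact Nat.le_of_dvd (Nat.pos_of_ne_zero (Ideal.absNorm_eq_zero_iff.not.2 hI))
    (absNorm_dvd_absNorm_of_le (Ideal.le_of_dvd hJ))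

lemma sum_idealMangoldt_dvd (I : Ideal (𝓞 K)) (hI : I ≠ 0) :
    ∑ J ∈ (finite_ideal_dvd hI).toFinset, idealMangoldt J = Real.log (absNorm I) := by
  induction I using UniqueFactorizationMonoid.induction_on_prime with
  | h₁ => exact absurd rfl hI
  | h₂ I hu =>
    rw [absNorm_eq_one_iff.2 (Ideal.isUnit_iff.1 hu), Nat.cast_one, Real.log_one]
    refine Finset.sum_eq_zero fun J hJ => ?_
    rw [Set.Finite.mem_toFinset, Set.mem_ofPred_eq] at hJ
    rw [idealMangoldt, if_neg fun h => h.not_isUnit (isUnit_of_dvd_unit hJ hu)]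
  | h₃ I P hI0 hP ih =>
    have hfm : FiniteMultiplicity P I := FiniteMultiplicity.of_prime_left hP hI0
    set v := multiplicity P I with hv
    have hsub : (finite_ideal_dvd hI0).toFinset ⊆ (finite_ideal_dvd hI).toFinset := by
      intro J hJ
      rw [Set.Finite.mem_toFinset, Set.mem_ofPred_eq] at hJ ⊢
      exact hJ.mul_left P
    have hmem : P ^ (v + 1) ∈ (finite_ideal_dvd hI).toFinset \ (finite_ideal_dvd hI0).toFinset := by
      rw [Finset.mem_sdiff, Set.Finite.mem_toFinset, Set.Finite.mem_toFinset, Set.mem_ofPred_eq,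
        Set.mem_ofPred_eq, pow_succ']
      refine ⟨mul_dvd_mul_left P (pow_multiplicity_dvd P I), ?_⟩
      rw [← pow_succ', ← hfm.multiplicity_lt_iff_not_dvd]
      exact Nat.lt_succ_self v
    rw [← Finset.sum_sdiff hsub, ih hI0, Finset.sum_eq_single_of_mem _ hmem,
      idealMangoldt_pow hP v.succ_ne_zero, map_mul, Nat.cast_mul, Real.log_mul]
    · exact Nat.cast_ne_zero.2 (Ideal.absNorm_eq_zero_iff.not.2 hP.ne_zero)
    · exact Nat.cast_ne_zero.2 (Ideal.absNorm_eq_zero_iff.not.2 hI0)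
    · intro J hJ hJne
      rw [Finset.mem_sdiff, Set.Finite.mem_toFinset, Set.Finite.mem_toFinset, Set.mem_ofPred_eq,
        Set.mem_ofPred_eq] at hJ
      refine if_neg ?_
      rintro ⟨Q, k, hQ, hk, rfl⟩
      obtain rfl | hQP := eq_or_ne Q P
      · obtain ⟨j, rfl⟩ := Nat.exists_eq_succ_of_ne_zero hk.ne'
        have h1 : Q ^ j ∣ I := by
          have := hJ.1
          rw [Nat.succ_eq_add_one, pow_succ'] at this
          exact (mul_dvd_mul_iff_left hP.ne_zero).1 this
        have h2 := hfm.multiplicity_lt_iff_not_dvd.2 hJ.2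
        have h3 := hfm.pow_dvd_iff_le_multiplicity.1 h1
        apply hJne
        congr 1
        omega
      · refine hJ.2 (hQ.pow_dvd_of_dvd_mul_left k (fun h => hQP ?_) hJ.1)
        exact associated_iff_eq.1 (hQ.associated_of_dvd hP h)

variable (K) in
/-- The ideals of given norm. -/
noncomputable def idealsOfNorm (n : ℕ) : Finset (Ideal (𝓞 K)) :=
  (Ideal.finite_setOfPred_absNorm_eq n).toFinset

@[simp]
lemma mem_idealsOfNorm {n : ℕ} {I : Ideal (𝓞 K)} : I ∈ idealsOfNorm K n ↔ absNorm I = n := by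
  simp [idealsOfNorm]

variable (K) in
lemma card_idealsOfNorm_mul_log {n : ℕ} (hn : n ≠ 0) :
    ((idealsOfNorm K n).card : ℝ) * Real.log n =
      ∑ p ∈ n.divisorsAntidiagonal,
        (∑ I ∈ idealsOfNorm K p.1, idealMangoldt I) * ((idealsOfNorm K p.2).card : ℝ) := by
  have hne : ∀ I ∈ idealsOfNorm K n, I ≠ 0 := by
    rintro I hI rfl
    rw [mem_idealsOfNorm] at hI
    simp at hI
    exact hn hI.symm
  obtain ⟨T, hmT⟩ : ∃ T : Finset (Ideal (𝓞 K) × Ideal (𝓞 K)),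
      ∀ q, q ∈ T ↔ absNorm q.1 * absNorm q.2 = n := by
    have hfin := Ideal.finite_setOfPred_absNorm_le (S := 𝓞 K) n
    refine ⟨(hfin.toFinset ×ˢ hfin.toFinset).filter fun q => absNorm q.1 * absNorm q.2 = n,
      fun q => ?_⟩
    simp only [Finset.mem_filter, Finset.mem_product, Set.Finite.mem_toFinset,
      Set.mem_ofPred_eq, and_iff_right_iff_imp]
    rintro rfl
    exact ⟨Nat.le_of_dvd (Nat.pos_of_ne_zero hn) (dvd_mul_right _ _),
      Nat.le_of_dvd (Nat.pos_of_ne_zero hn) (dvd_mul_left _ _)⟩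
  have h1 : ∑ q ∈ T, idealMangoldt q.1 = ((idealsOfNorm K n).card : ℝ) * Real.log n := by
    rw [← Finset.sum_fiberwise_of_maps_to (t := idealsOfNorm K n) (g := fun q => q.1 * q.2)
      fun q hq => by rw [mem_idealsOfNorm, map_mul, (hmT q).1 hq], ← nsmul_eq_mul,
      ← Finset.sum_const]
    refine Finset.sum_congr rfl fun I hI => ?_
    rw [← mem_idealsOfNorm.1 hI, ← sum_idealMangoldt_dvd I (hne I hI)]
    refine Finset.sum_nbij (fun q => q.1) ?_ ?_ ?_ fun _ _ => rfl
    · intro q hq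
      rw [Set.Finite.mem_toFinset, Set.mem_ofPred_eq]
      exact ⟨q.2, (Finset.mem_filter.1 hq).2.symm⟩
    · rintro ⟨J, J₁⟩ hq ⟨J', J₂⟩ hq' (rfl : J = J')
      have e1 := (Finset.mem_filter.1 hq).2
      have e2 := (Finset.mem_filter.1 hq').2
      have hJ : J ≠ 0 := by
        rintro rfl
        exact hne I hI (by rw [← e1, zero_mul])
      exact Prod.ext rfl (mul_left_cancel₀ hJ (e1.trans e2.symm))
    · intro J hJ
      rw [Finset.mem_coe, Set.Finite.mem_toFinset, Set.mem_ofPred_eq] at hJ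
      obtain ⟨J', rfl⟩ := hJ
      refine ⟨(J, J'), Finset.mem_coe.2 (Finset.mem_filter.2 ⟨(hmT _).2 ?_, rfl⟩), rfl⟩
      rw [← map_mul, mem_idealsOfNorm.1 hI]
  have hmaps : ∀ q ∈ T, (absNorm q.1, absNorm q.2) ∈ n.divisorsAntidiagonal := fun q hq =>
    Nat.mem_divisorsAntidiagonal.2 ⟨(hmT q).1 hq, hn⟩
  rw [← h1, ← Finset.sum_fiberwise_of_maps_to hmaps]
  refine Finset.sum_congr rfl fun p hp => ?_
  have : (T.filter fun q => (absNorm q.1, absNorm q.2) = p) =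
      idealsOfNorm K p.1 ×ˢ idealsOfNorm K p.2 := by
    ext q
    rw [Finset.mem_filter, hmT, Finset.mem_product, mem_idealsOfNorm, mem_idealsOfNorm,
      Prod.ext_iff]
    refine ⟨fun h => h.2, fun h => ⟨?_, h⟩⟩
    rw [h.1, h.2, (Nat.mem_divisorsAntidiagonal.1 hp).1]
  rw [this, Finset.sum_product, Finset.sum_mul]
  refine Finset.sum_congr rfl fun I _ => ?_
  simp [mul_comm]

lemma sum_idealMangoldt_le (n : ℕ) :
    ∑ I ∈ idealsOfNorm K n, idealMangoldt I ≤
      Module.finrank ℤ (𝓞 K) * ArithmeticFunction.vonMangoldt n := by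
  have hprime : ∀ P : Ideal (𝓞 K), Prime P → ∃ p m : ℕ, p.Prime ∧ m ≠ 0 ∧ absNorm P = p ^ m ∧
      (p : 𝓞 K) ∈ P := by
    intro P hP
    have := ((Ideal.prime_iff_isPrime hP.ne_zero).1 hP).isMaximal hP.ne_zero
    obtain ⟨p, m, hm, hpP, hp, h⟩ := Ideal.exists_prime_and_absNorm_eq_pow P
    exact ⟨p, m, hp, hm.ne', h, hpP⟩
  by_cases hn : IsPrimePow n
  · obtain ⟨p, m, hp, hm, rfl⟩ := hn
    rw [← Nat.prime_iff] at hp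
    rw [ArithmeticFunction.vonMangoldt_apply_pow hm.ne',
      ArithmeticFunction.vonMangoldt_apply_prime hp]
    set S := (idealsOfNorm K (p ^ m)).filter IsPrimePow with hS
    have hSP : ∀ I ∈ S, ∃ P : Ideal (𝓞 K), ∃ k : ℕ, Prime P ∧ k ≠ 0 ∧ I = P ^ k ∧
        I.radical = P ∧ absNorm P ^ k = p ^ m := by
      intro I hI
      rw [hS, Finset.mem_filter, mem_idealsOfNorm] at hI
      obtain ⟨hI, P, k, hP, hk, rfl⟩ := hI
      refine ⟨P, k, hP, hk.ne', rfl, ?_, by rw [← hI, map_pow]⟩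
      rw [Ideal.radical_pow _ hk.ne', ((Ideal.prime_iff_isPrime hP.ne_zero).1 hP).radical]
    have hinj : Set.InjOn Ideal.radical (S : Set (Ideal (𝓞 K))) := by
      intro I hI J hJ hIJ
      obtain ⟨P, k, hP, -, rfl, hr, hk⟩ := hSP I hI
      obtain ⟨Q, j, -, -, rfl, hr', hj⟩ := hSP J hJ
      rw [hr, hr'] at hIJ
      subst hIJ
      obtain ⟨q, i, hq, hi, h, -⟩ := hprime P hP
      have h2 : 2 ≤ absNorm P := by
        rw [h]
        exact hq.two_le.trans (Nat.le_self_pow hi q)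
      rw [Nat.pow_right_injective h2 (hk.trans hj.symm)]
    have hdvd : ∏ P ∈ S.image Ideal.radical, P ∣ Ideal.span {(p : 𝓞 K)} := by
      refine Finset.prod_primes_dvd _ ?_ ?_
      · intro P hP
        obtain ⟨I, hI, rfl⟩ := Finset.mem_image.1 hP
        obtain ⟨P, k, hP, -, -, rfl, -⟩ := hSP I hI
        exact hP
      · intro P hP
        obtain ⟨I, hI, rfl⟩ := Finset.mem_image.1 hP
        obtain ⟨P, k, hP, hk, -, rfl, hn⟩ := hSP I hI
        rw [Ideal.dvd_span_singleton]
        have hPp := (Ideal.prime_iff_isPrime hP.ne_zero).1 hP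
        have := absNorm_mem (I.radical ^ k)
        rw [map_pow, hn, Nat.cast_pow] at this
        exact hPp.mem_of_pow_mem _ (Ideal.pow_le_self hk this)
    have hp0 : (p : ℝ) ≠ 0 := Nat.cast_ne_zero.2 hp.ne_zero
    calc ∑ I ∈ idealsOfNorm K (p ^ m), idealMangoldt I
        = ∑ I ∈ S, Real.log (absNorm I.radical) := by
          rw [hS, Finset.sum_filter]
          rfl
      _ = ∑ P ∈ S.image Ideal.radical, Real.log (absNorm P) := (Finset.sum_image (f := fun P => Real.log (absNorm P)) hinj).symm
      _ = Real.log (absNorm (∏ P ∈ S.image Ideal.radical, P)) := by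
          rw [map_prod, Nat.cast_prod, Real.log_prod]
          intro P hP
          obtain ⟨I, hI, rfl⟩ := Finset.mem_image.1 hP
          obtain ⟨P, k, hP, -, -, rfl, -⟩ := hSP I hI
          exact Nat.cast_ne_zero.2 (Ideal.absNorm_eq_zero_iff.not.2 hP.ne_zero)
      _ ≤ Real.log (absNorm (Ideal.span {(p : 𝓞 K)})) := by
          have h0 : 0 < absNorm (Ideal.span {(p : 𝓞 K)}) := by
            rw [Ideal.absNorm_span_natCast]
            exact pow_pos hp.pos _
          have h1 := absNorm_dvd_absNorm_of_le (Ideal.le_of_dvd hdvd)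
          exact Real.log_le_log (Nat.cast_pos.2 (Nat.pos_of_dvd_of_pos h1 h0))
            (Nat.cast_le.2 (Nat.le_of_dvd h0 h1))
      _ = _ := by
          rw [Ideal.absNorm_span_natCast, Nat.cast_pow, Real.log_pow]
  · rw [ArithmeticFunction.vonMangoldt_eq_zero_iff.2 hn, mul_zero]
    refine (Finset.sum_eq_zero fun I hI => if_neg ?_).le
    rintro ⟨P, k, hP, hk, rfl⟩
    obtain ⟨p, m, hp, hm, h, -⟩ := hprime P hP
    rw [mem_idealsOfNorm, map_pow, h, ← pow_mul] at hI
    exact hn (hI ▸ hp.isPrimePow.pow (mul_ne_zero hm hk.ne'))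

end IdealMangoldt

section RootsModP

lemma polyRho_eq_card (F : Polynomial ℤ) (d : ℕ) :
    polyRho F d = ((Finset.range d).filter fun n : ℕ => (d : ℤ) ∣ F.eval (n : ℤ)).card := by
  rw [polyRho]
  symm
  refine Finset.card_nbij (fun n : ℕ => (n : ℤ)) ?_ ?_ ?_
  · intro n hn
    simpa [Finset.bind_def, Finset.pure_def] using hn
  · intro n _ m _ hnm
    exact Int.ofNat_inj.1 hnm
  · intro z hz
    simp only [Finset.bind_def, Finset.pure_def, Finset.mem_coe, Finset.mem_filter,
      Finset.mem_sup, Finset.mem_singleton] at hz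
    obtain ⟨⟨n, hn, rfl⟩, h⟩ := hz
    exact ⟨n, Finset.mem_coe.2 (Finset.mem_filter.2 ⟨hn, h⟩), rfl⟩

open NumberField Ideal

variable {K : Type*} [Field K] [NumberField K]

lemma intCast_mem_iff_dvd {p : ℕ} (hp : p.Prime) {I : Ideal (𝓞 K)} (hI : I ≠ ⊤)
    (hpI : (p : 𝓞 K) ∈ I) (z : ℤ) : (z : 𝓞 K) ∈ I ↔ (p : ℤ) ∣ z := by
  refine ⟨fun hz => ?_, ?_⟩
  · by_contra h
    obtain ⟨a, b, hab⟩ := (Nat.prime_iff_prime_int.1 hp).irreducible.coprime_iff_not_dvd.2 h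
    refine hI ((Ideal.eq_top_iff_one I).2 ?_)
    have : (1 : 𝓞 K) = (a : 𝓞 K) * (p : 𝓞 K) + (b : 𝓞 K) * (z : 𝓞 K) := by
      exact_mod_cast hab.symm
    rw [this]
    exact I.add_mem (I.mul_mem_left _ hpI) (I.mul_mem_left _ hz)
  · rintro ⟨k, rfl⟩
    push_cast
    exact I.mul_mem_right _ hpI

lemma injective_natCast_quotient {p : ℕ} (hp : p.Prime) {I : Ideal (𝓞 K)} (hI : I ≠ ⊤)
    (hpI : (p : 𝓞 K) ∈ I) :
    Function.Injective fun i : Fin p => Ideal.Quotient.mk I ((i : ℕ) : 𝓞 K) := by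
  intro i j hij
  have h1 : (((i : ℕ) - (j : ℕ) : ℤ) : 𝓞 K) ∈ I := by
    push_cast
    exact Ideal.Quotient.eq.1 hij
  rw [intCast_mem_iff_dvd hp hI hpI, ← Int.modEq_iff_dvd] at h1
  have h2 := (Int.natCast_modEq_iff.1 h1)
  exact (Fin.ext (Nat.ModEq.eq_of_lt_of_lt h2 j.2 i.2)).symm

lemma exists_natCast_sub_mem {p : ℕ} (hp : p.Prime) {I : Ideal (𝓞 K)} (hI : absNorm I = p)
    (x : 𝓞 K) : ∃ i < p, (i : 𝓞 K) - x ∈ I := by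
  have htop : I ≠ ⊤ := by
    rintro rfl
    rw [absNorm_top] at hI
    exact hp.one_lt.ne hI
  have hpI : (p : 𝓞 K) ∈ I := hI ▸ absNorm_mem I
  have hcard : Nat.card (𝓞 K ⧸ I) = p := by
    rw [← hI, Ideal.absNorm_apply, Submodule.cardQuot_apply]
  have : Finite (𝓞 K ⧸ I) := Nat.finite_of_card_ne_zero (hcard ▸ hp.ne_zero)
  obtain ⟨i, hi⟩ := ((injective_natCast_quotient hp htop hpI).bijective_of_nat_card_le
    (by rw [hcard, Nat.card_eq_fintype_card, Fintype.card_fin])).2 (Ideal.Quotient.mk I x)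
  exact ⟨i, i.2, Ideal.Quotient.eq.1 hi⟩

lemma absNorm_eq_of_forall_exists {p : ℕ} (hp : p.Prime) {I : Ideal (𝓞 K)} (hI : I ≠ ⊤)
    (hpI : (p : 𝓞 K) ∈ I) (h : ∀ x : 𝓞 K, ∃ z : ℤ, (z : 𝓞 K) - x ∈ I) : absNorm I = p := by
  have hbij : Function.Bijective fun i : Fin p => Ideal.Quotient.mk I ((i : ℕ) : 𝓞 K) := by
    refine ⟨injective_natCast_quotient hp hI hpI, fun y => ?_⟩
    obtain ⟨x, rfl⟩ := Ideal.Quotient.mk_surjective y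
    obtain ⟨z, hz⟩ := h x
    have hp0 : (0 : ℤ) < p := by exact_mod_cast hp.pos
    have h0 := Int.emod_nonneg z hp0.ne'
    refine ⟨⟨(z % p).toNat, by
      have := Int.emod_lt_of_pos z hp0
      omega⟩, Ideal.Quotient.eq.2 ?_⟩
    have h1 : (((z % p).toNat : ℕ) : 𝓞 K) = ((z - p * (z / p) : ℤ) : 𝓞 K) := by
      rw [← Int.cast_natCast (R := 𝓞 K), Int.toNat_of_nonneg h0, Int.emod_def]
    have h2 : (((z % p).toNat : ℕ) : 𝓞 K) - x =
        ((z : 𝓞 K) - x) - (p : 𝓞 K) * ((z / p : ℤ) : 𝓞 K) := by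
      rw [h1]
      push_cast
      ring
    show (((z % p).toNat : ℕ) : 𝓞 K) - x ∈ I
    rw [h2]
    exact I.sub_mem hz (I.mul_mem_right _ hpI)
  rw [Ideal.absNorm_apply, Submodule.cardQuot_apply, ← Nat.card_eq_of_bijective _ hbij,
    Nat.card_eq_fintype_card, Fintype.card_fin]

omit [NumberField K] in
lemma aeval_sub_eval_intCast_mem {I : Ideal (𝓞 K)} {θ : 𝓞 K} {z : ℤ} (h : (z : 𝓞 K) - θ ∈ I)
    (q : Polynomial ℤ) : ((q.eval z : ℤ) : 𝓞 K) - Polynomial.aeval θ q ∈ I := by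
  have h1 : ((q.eval z : ℤ) : 𝓞 K) = (q.map (algebraMap ℤ (𝓞 K))).eval (z : 𝓞 K) := by
    rw [← eq_intCast (algebraMap ℤ (𝓞 K)) z, Polynomial.eval_map_apply, eq_intCast]
  rw [h1, ← Polynomial.eval_map_algebraMap]
  exact I.mem_of_dvd (Polynomial.sub_dvd_eval_sub _ _ _) h

lemma card_idealsOfNorm_eq_polyRho {F G : Polynomial ℤ} {θ : 𝓞 K} {c M : ℤ} {k : ℕ}
    (hM : ∀ x : 𝓞 K, ∃ q : Polynomial ℤ, (M : 𝓞 K) * x = Polynomial.aeval θ q)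
    (hdvd : ∀ q : Polynomial ℤ, Polynomial.aeval θ q = 0 →
      F ∣ q.comp (Polynomial.C c * Polynomial.X))
    (hG : Polynomial.aeval θ G = 0) (hGF : ∀ n : ℤ, G.eval (c * n) = c ^ k * F.eval n)
    {p : ℕ} (hp : p.Prime) (hpc : ¬ (p : ℤ) ∣ c) (hpM : ¬ (p : ℤ) ∣ M) :
    (idealsOfNorm K p).card = polyRho F p := by
  have hpp : Prime (p : ℤ) := Nat.prime_iff_prime_int.1 hp
  have htop : ∀ I ∈ idealsOfNorm K p, I ≠ ⊤ := by
    rintro I hI rfl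
    rw [mem_idealsOfNorm, absNorm_top] at hI
    exact hp.one_lt.ne hI
  have hpI : ∀ I ∈ idealsOfNorm K p, (p : 𝓞 K) ∈ I := fun I hI =>
    mem_idealsOfNorm.1 hI ▸ absNorm_mem I
  have hinv : ∀ m : ℤ, ¬ (p : ℤ) ∣ m → ∃ u v : ℤ, u * p + v * m = 1 := fun m hm =>
    hpp.irreducible.coprime_iff_not_dvd.2 hm
  have hex : ∀ I ∈ idealsOfNorm K p, ∃ n : ℕ, n < p ∧ ((c * n : ℤ) : 𝓞 K) - θ ∈ I := by
    intro I hI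
    obtain ⟨u, v, huv⟩ := hinv c hpc
    obtain ⟨n, hn, hnI⟩ := exists_natCast_sub_mem hp (mem_idealsOfNorm.1 hI) ((v : 𝓞 K) * θ)
    refine ⟨n, hn, ?_⟩
    have huv' : (u : 𝓞 K) * (p : 𝓞 K) + (v : 𝓞 K) * (c : 𝓞 K) = 1 := by exact_mod_cast huv
    have : ((c * n : ℤ) : 𝓞 K) - θ =
        (c : 𝓞 K) * ((n : 𝓞 K) - (v : 𝓞 K) * θ) - (u : 𝓞 K) * θ * (p : 𝓞 K) := by
      push_cast
      linear_combination θ * huv'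
    rw [this]
    exact I.sub_mem (I.mul_mem_left _ hnI) (I.mul_mem_left _ (hpI I hI))
  choose! f hfp hfI using hex
  have hroot : ∀ I ∈ idealsOfNorm K p, (p : ℤ) ∣ F.eval (f I : ℤ) := by
    intro I hI
    have h1 := aeval_sub_eval_intCast_mem (hfI I hI) G
    rw [hG, sub_zero, intCast_mem_iff_dvd hp (htop I hI) (hpI I hI), hGF] at h1
    exact (hpp.dvd_or_dvd h1).resolve_left fun h => hpc (hpp.dvd_of_dvd_pow h)
  have hmem : ∀ I ∈ idealsOfNorm K p, ∀ (x : 𝓞 K) (q : Polynomial ℤ),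
      (M : 𝓞 K) * x = Polynomial.aeval θ q → (x ∈ I ↔ (p : ℤ) ∣ q.eval (c * f I : ℤ)) := by
    intro I hI x q hx
    rw [← intCast_mem_iff_dvd hp (htop I hI) (hpI I hI)]
    have h1 := aeval_sub_eval_intCast_mem (hfI I hI) q
    rw [← hx] at h1
    obtain ⟨u, v, huv⟩ := hinv M hpM
    have huv' : (u : 𝓞 K) * (p : 𝓞 K) + (v : 𝓞 K) * (M : 𝓞 K) = 1 := by exact_mod_cast huv
    refine ⟨fun hxI => ?_, fun hqI => ?_⟩
    · simpa using I.add_mem h1 (I.mul_mem_left (M : 𝓞 K) hxI)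
    · have : x = (v : 𝓞 K) * (((q.eval (c * f I : ℤ) : ℤ) : 𝓞 K) -
          (((q.eval (c * f I : ℤ) : ℤ) : 𝓞 K) - (M : 𝓞 K) * x)) + (u : 𝓞 K) * x * (p : 𝓞 K) := by
        linear_combination -x * huv'
      rw [this]
      exact I.add_mem (I.mul_mem_left _ (I.sub_mem hqI h1)) (I.mul_mem_left _ (hpI I hI))
  have hsurj : ∀ n : ℕ, (p : ℤ) ∣ F.eval (n : ℤ) →
      ∃ I ∈ idealsOfNorm K p, ((c * n : ℤ) : 𝓞 K) - θ ∈ I := by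
    intro n hn
    set I₀ : Ideal (𝓞 K) := Ideal.span {(p : 𝓞 K), ((c * n : ℤ) : 𝓞 K) - θ} with hI₀
    have hne : I₀ ≠ ⊤ := by
      intro h
      rw [Ideal.eq_top_iff_one, hI₀, Ideal.mem_span_pair] at h
      obtain ⟨a, b, hab⟩ := h
      obtain ⟨A, hA⟩ := hM a
      obtain ⟨B, hB⟩ := hM b
      have hz : Polynomial.aeval θ (A * Polynomial.C (p : ℤ) +
          B * (Polynomial.C (c * n) - Polynomial.X) - Polynomial.C M) = 0 := by
        simp only [map_sub, map_add, map_mul, Polynomial.aeval_X, ← hA, ← hB, eq_intCast,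
          map_intCast, map_natCast]
        push_cast at hab
        linear_combination (M : 𝓞 K) * hab
      have h1 := Polynomial.eval_dvd (x := (n : ℤ)) (hdvd _ hz)
      have h2 := hn.trans h1
      simp only [Polynomial.eval_comp, Polynomial.eval_sub, Polynomial.eval_add,
        Polynomial.eval_mul, Polynomial.eval_C, Polynomial.eval_X, sub_self, mul_zero,
        add_zero] at h2
      exact hpM ((dvd_sub_right (dvd_mul_left _ _)).1 h2)
    obtain ⟨P, hP, hle⟩ := Ideal.exists_le_maximal I₀ hne
    have h1 : (p : 𝓞 K) ∈ P := hle (Ideal.subset_span (by simp))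
    have h2 : ((c * n : ℤ) : 𝓞 K) - θ ∈ P := hle (Ideal.subset_span (by simp))
    refine ⟨P, mem_idealsOfNorm.2 (absNorm_eq_of_forall_exists hp hP.ne_top h1 fun x => ?_), h2⟩
    obtain ⟨q, hq⟩ := hM x
    obtain ⟨u, v, huv⟩ := hinv M hpM
    have huv' : (u : 𝓞 K) * (p : 𝓞 K) + (v : 𝓞 K) * (M : 𝓞 K) = 1 := by exact_mod_cast huv
    have h3 := aeval_sub_eval_intCast_mem h2 q
    rw [← hq] at h3
    refine ⟨v * q.eval (c * n : ℤ), ?_⟩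
    have : ((v * q.eval (c * n : ℤ) : ℤ) : 𝓞 K) - x = (v : 𝓞 K) *
        (((q.eval (c * n : ℤ) : ℤ) : 𝓞 K) - (M : 𝓞 K) * x) - (u : 𝓞 K) * x * (p : 𝓞 K) := by
      push_cast
      linear_combination x * huv'
    rw [this]
    exact P.sub_mem (P.mul_mem_left _ h3) (P.mul_mem_left _ h1)
  rw [polyRho_eq_card]
  refine Finset.card_nbij f ?_ ?_ ?_
  · intro I hI
    exact Finset.mem_coe.2 (Finset.mem_filter.2 ⟨Finset.mem_range.2 (hfp I hI), hroot I hI⟩)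
  · intro I hI J hJ hIJ
    ext x
    obtain ⟨q, hq⟩ := hM x
    rw [hmem I hI x q hq, hmem J hJ x q hq, hIJ]
  · intro n hn
    obtain ⟨hnp, hnF⟩ := Finset.mem_filter.1 (Finset.mem_coe.1 hn)
    obtain ⟨I, hI, hnI⟩ := hsurj n hnF
    refine ⟨I, hI, ?_⟩
    have h1 := I.sub_mem hnI (hfI I hI)
    have h2 : ((c * n : ℤ) : 𝓞 K) - θ - (((c * f I : ℤ) : 𝓞 K) - θ) =
        ((c * (n - f I) : ℤ) : 𝓞 K) := by
      push_cast
      ring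
    rw [h2, intCast_mem_iff_dvd hp (htop I hI) (hpI I hI)] at h1
    have h3 := (hpp.dvd_or_dvd h1).resolve_left hpc
    rw [← Int.modEq_iff_dvd] at h3
    exact Nat.ModEq.eq_of_lt_of_lt (Int.natCast_modEq_iff.1 h3) (hfp I hI) (Finset.mem_range.1 hnp)

end RootsModP

section GeneratedByRoot

open NumberField Ideal

variable {K : Type*} [Field K] [NumberField K]

lemma exists_intCast_mul_eq_aeval {θ : 𝓞 K}
    (hθ : ∀ x : K, ∃ g : Polynomial ℚ, x = Polynomial.aeval (θ : K) g) :
    ∃ M : ℤ, M ≠ 0 ∧ ∀ x : 𝓞 K, ∃ q : Polynomial ℤ, (M : 𝓞 K) * x = Polynomial.aeval θ q := by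
  have hone : ∀ x : 𝓞 K, ∃ m : ℤ, m ≠ 0 ∧
      ∃ q : Polynomial ℤ, (m : 𝓞 K) * x = Polynomial.aeval θ q := by
    intro x
    obtain ⟨g, hg⟩ := hθ x
    obtain ⟨b, hb0, hb⟩ := IsLocalization.integerNormalization_spec (nonZeroDivisors ℤ) g
    refine ⟨b, nonZeroDivisors.ne_zero hb0,
      IsLocalization.integerNormalization (nonZeroDivisors ℤ) g, ?_⟩
    apply RingOfIntegers.coe_injective
    have h1 := congrArg (Polynomial.aeval (θ : K)) hb
    rw [Polynomial.aeval_map_algebraMap, map_zsmul, ← hg] at h1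
    have h2 := Polynomial.aeval_algebraMap_apply K θ
      (IsLocalization.integerNormalization (nonZeroDivisors ℤ) g)
    rw [map_mul, map_intCast, ← h2]
    refine Eq.trans ?_ h1.symm
    rw [zsmul_eq_mul]
  choose m hm q hq using hone
  obtain ⟨s, hs⟩ := (inferInstance : Module.Finite ℤ (𝓞 K)).fg_top
  refine ⟨∏ x ∈ s, m x, Finset.prod_ne_zero_iff.2 fun x _ => hm x, fun x => ?_⟩
  have hx : x ∈ Submodule.span ℤ (s : Set (𝓞 K)) := hs ▸ Submodule.mem_top
  induction hx using Submodule.span_induction with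
  | mem x hx =>
    refine ⟨Polynomial.C (∏ y ∈ s.erase x, m y) * q x, ?_⟩
    rw [map_mul, ← hq, ← Finset.mul_prod_erase s m hx, Polynomial.aeval_C, eq_intCast]
    push_cast
    ring
  | zero => exact ⟨0, by simp⟩
  | add x y _ _ hx hy =>
    obtain ⟨a, ha⟩ := hx
    obtain ⟨b, hb⟩ := hy
    exact ⟨a + b, by rw [map_add, ← ha, ← hb, mul_add]⟩
  | smul n x _ hx =>
    obtain ⟨a, ha⟩ := hx
    exact ⟨n • a, by rw [map_zsmul, ← ha, mul_smul_comm]⟩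

lemma exists_forall_card_idealsOfNorm_eq_polyRho {F : Polynomial ℤ} (hF : F.IsPrimitive)
    (hdeg : 1 ≤ F.natDegree) {α : K} (hα : Polynomial.aeval α F = 0)
    (hdvd : ∀ g : Polynomial ℚ, Polynomial.aeval α g = 0 → F.map (Int.castRingHom ℚ) ∣ g)
    (hgen : ∀ x : K, ∃ g : Polynomial ℚ, x = Polynomial.aeval α g) :
    ∃ P : ℕ, ∀ p : ℕ, p.Prime → P < p → (idealsOfNorm K p).card = polyRho F p := by
  set c := F.leadingCoeff with hc
  have hc0 : c ≠ 0 := Polynomial.leadingCoeff_ne_zero.2 hF.ne_zero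
  have hcK : (c : K) ≠ 0 := Int.cast_ne_zero.2 hc0
  have hInt : IsIntegral ℤ (c • α) := isIntegral_leadingCoeff_smul F α hα
  set θ : 𝓞 K := ⟨c • α, hInt⟩ with hθ
  have hθα : (θ : K) = (c : K) * α := by
    rw [← zsmul_eq_mul]
    rfl
  obtain ⟨M, hM0, hM⟩ := exists_intCast_mul_eq_aeval (θ := θ) fun x => by
    obtain ⟨g, hg⟩ := hgen x
    refine ⟨g.comp (Polynomial.C ((c : ℚ)⁻¹) * Polynomial.X), ?_⟩
    rw [Polynomial.aeval_comp, map_mul, Polynomial.aeval_C, Polynomial.aeval_X, hθα, map_inv₀,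
      map_intCast, inv_mul_cancel_left₀ hcK, hg]
  have hcomp : ∀ q : Polynomial ℤ, Polynomial.aeval θ q = 0 →
      F ∣ q.comp (Polynomial.C c * Polynomial.X) := by
    intro q hq
    rw [Polynomial.IsPrimitive.Int.dvd_iff_map_cast_dvd_map_cast _ _ hF]
    refine hdvd _ ?_
    rw [← algebraMap_int_eq, Polynomial.aeval_map_algebraMap, Polynomial.aeval_comp, map_mul,
      Polynomial.aeval_C, Polynomial.aeval_X, eq_intCast, ← hθα]
    have := Polynomial.aeval_algebraMap_apply K θ q
    rw [hq, map_zero] at this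
    exact this
  have hG : Polynomial.aeval θ F.integralNormalization = 0 := by
    apply RingOfIntegers.coe_injective
    have h1 := Polynomial.aeval_algebraMap_apply K θ F.integralNormalization
    have h2 := Polynomial.integralNormalization_eval₂_leadingCoeff_mul hdeg (algebraMap ℤ K) α
    rw [eq_intCast, ← hc, ← hθα, ← Polynomial.aeval_def, ← Polynomial.aeval_def, hα,
      mul_zero] at h2
    rw [map_zero]
    exact h1.symm.trans h2
  refine ⟨max c.natAbs M.natAbs, fun p hp hPp =>
    card_idealsOfNorm_eq_polyRho (k := F.natDegree - 1) hM hcomp hG (fun n => ?_) hp ?_ ?_⟩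
  · have := Polynomial.integralNormalization_eval₂_leadingCoeff_mul hdeg (RingHom.id ℤ) n
    simpa using this
  · intro h
    have := Nat.le_of_dvd (Int.natAbs_pos.2 hc0) (Int.natCast_dvd.1 h)
    omega
  · intro h
    have := Nat.le_of_dvd (Int.natAbs_pos.2 hM0) (Int.natCast_dvd.1 h)
    omega

end GeneratedByRoot

section PrimeRootSum

open NumberField Ideal

variable {K : Type*} [Field K] [NumberField K]

lemma idealsOfNorm_one : idealsOfNorm K 1 = {⊤} := by
  ext I
  rw [mem_idealsOfNorm, absNorm_eq_one_iff, Finset.mem_singleton]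

lemma sum_idealMangoldt_prime {p : ℕ} (hp : p.Prime) :
    ∑ I ∈ idealsOfNorm K p, idealMangoldt I = ((idealsOfNorm K p).card : ℝ) * Real.log p := by
  rw [← nsmul_eq_mul, ← Finset.sum_const]
  refine Finset.sum_congr rfl fun I hI => ?_
  rw [mem_idealsOfNorm] at hI
  have hI0 : I ≠ 0 := by
    rintro rfl
    exact hp.ne_zero (hI.symm.trans absNorm_bot)
  have hprime : Prime I := (Ideal.prime_iff_isPrime hI0).2
    (isPrime_of_irreducible_absNorm (hI ▸ hp))
  have := idealMangoldt_pow hprime one_ne_zero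
  rwa [pow_one, hI] at this

lemma natCard_absNorm_eq (n : ℕ) :
    Nat.card {I : Ideal (𝓞 K) // absNorm I = n} = (idealsOfNorm K n).card := by
  rw [Nat.subtype_card]
  exact fun _ => mem_idealsOfNorm

lemma exists_densityData_idealsOfNorm (K : Type*) [Field K] [NumberField K] :
    ∃ κ C δ : ℝ, DensityData (fun n => ((idealsOfNorm K n).card : ℝ))
      (fun n => ∑ I ∈ idealsOfNorm K n, idealMangoldt I) κ C δ := by
  obtain ⟨κ, C, hκ, hC, hcount⟩ := exists_abs_sum_card_absNorm_eq_sub_le K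
  have hd : (1 : ℝ) ≤ Module.finrank ℚ K := by exact_mod_cast Module.finrank_pos (R := ℚ) (M := K)
  refine ⟨κ, max C (Module.finrank ℤ (𝓞 K)), 1 / (2 * (Module.finrank ℚ K : ℝ)), ?_⟩
  exact
    { nonneg := fun n => Nat.cast_nonneg _
      one := by simp [idealsOfNorm_one]
      log_nonneg := fun n => Finset.sum_nonneg fun I _ => idealMangoldt_nonneg I
      log_le := fun n => (sum_idealMangoldt_le n).trans
        (mul_le_mul_of_nonneg_right (le_max_right _ _) ArithmeticFunction.vonMangoldt_nonneg)
      conv := fun n hn => card_idealsOfNorm_mul_log K hn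
      κ_pos := hκ
      C_pos := hC.trans_le (le_max_left _ _)
      δ_pos := by positivity
      δ_lt := by
        rw [div_lt_one (by positivity)]
        linarith
      count := fun t ht => by
        have h := hcount t ht
        simp only [natCard_absNorm_eq] at h
        exact h.trans (mul_le_mul_of_nonneg_right (le_max_left _ _) (by positivity)) }

end PrimeRootSum

theorem stmt3 (F : Polynomial ℤ) (hF : Irreducible F) (hdeg : 2 ≤ F.natDegree) :
    ∃ c₁ c₂ K : ℝ, 0 < c₂ ∧ 0 < K ∧ ∀ x : ℝ, 3 ≤ x →
      |(∑ p ∈ (Finset.range (⌊x⌋₊ + 1)).filter Nat.Prime, (polyRho F p : ℝ) / p) -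
          Real.log (Real.log x) - c₁| ≤ K * Real.exp (-c₂ * Real.sqrt (Real.log x)) := by
  have hprim : F.IsPrimitive := hF.isPrimitive (by omega)
  have hirr : Irreducible (F.map (Int.castRingHom ℚ)) :=
    (Polynomial.IsPrimitive.Int.irreducible_iff_irreducible_map_cast hprim).1 hF
  have : Fact (Irreducible (F.map (Int.castRingHom ℚ))) := ⟨hirr⟩
  let L := AdjoinRoot (F.map (Int.castRingHom ℚ))
  have : FiniteDimensional ℚ L := (AdjoinRoot.powerBasis hirr.ne_zero).finite
  have : CharZero L := algebraRat.charZero L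
  have : NumberField L := { }
  have hmk : ∀ g : Polynomial ℚ,
      Polynomial.aeval (AdjoinRoot.root (F.map (Int.castRingHom ℚ)) : L) g = AdjoinRoot.mk _ g :=
    fun g => AdjoinRoot.aeval_eq g
  obtain ⟨P, hP⟩ := exists_forall_card_idealsOfNorm_eq_polyRho (K := L) hprim (by omega)
    (α := AdjoinRoot.root _)
    (by
      have h := hmk (F.map (Int.castRingHom ℚ))
      rw [AdjoinRoot.mk_self] at h
      exact (Polynomial.aeval_map_algebraMap ℚ _ F).symm.trans h)
    (fun g hg => AdjoinRoot.mk_eq_zero.1 ((hmk g).symm.trans hg))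
    (fun x => by
      obtain ⟨g, rfl⟩ := AdjoinRoot.mk_surjective x
      exact ⟨g, (hmk g).symm⟩)
  obtain ⟨κ, C, δ, h⟩ := exists_densityData_idealsOfNorm L
  exact h.exists_prime_sum_bound (r := fun p => (polyRho F p : ℝ)) (P := P) fun p hp hPp => by
    rw [sum_idealMangoldt_prime hp, hP p hp hPp]
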